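/- arXiv:0706.3221 — 2 statements merged into one kernel-verified Lean document; each statement's English description precedes it below -/
import Mathlib

section
/- Let f : Ω → ℝ³ be a smooth conjugate net without parabolic points and (u₀, v₀) ∈ Ω. For ε > 0 set A = f(u₀, v₀), B = f(u₀ + ε, v₀), C = f(u₀, v₀ + ε), E = f(u₀ + 2ε, v₀), F = f(u₀ + 2ε, v₀ + ε). Then there exist constants C₀ > 0 and ε₀ > 0 such that for every 0 < ε < ε₀ there are real numbers δu and δv with |δu| ≤ C₀ ε³ and |δv| ≤ C₀ ε⁴ such that the point M = f(u₀ + ε + δu, v₀ + ε + δv) makes both quadrilaterals planar: the four points A, B, M, C lie in a common affine plane, and the four points B, M, F, E lie in a common affine plane. -/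
open Metric

noncomputable section

/-- Euclidean three-space. -/
abbrev E3 : Type := EuclideanSpace ℝ (Fin 3)

/-- The dot product in `ℝ³`. -/
def dot3 (x y : E3) : ℝ := x 0 * y 0 + x 1 * y 1 + x 2 * y 2

/-- The cross product in `ℝ³`. -/
def cross3 (x y : E3) : E3 :=
  (WithLp.equiv 2 (Fin 3 → ℝ)).symm
    ![x 1 * y 2 - x 2 * y 1, x 2 * y 0 - x 0 * y 2, x 0 * y 1 - x 1 * y 0]

/-- Partial derivative in the first coordinate direction. -/
def pd1 (f : ℝ × ℝ → E3) (p : ℝ × ℝ) : E3 := fderiv ℝ f p (1, 0)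

/-- Partial derivative in the second coordinate direction. -/
def pd2 (f : ℝ × ℝ → E3) (p : ℝ × ℝ) : E3 := fderiv ℝ f p (0, 1)

open Asymptotics Topology ContDiff

/-- The derivative of `F` in the fixed direction `w`. -/
def dirDeriv {V G : Type*} [NormedAddCommGroup V] [NormedSpace ℝ V] [NormedAddCommGroup G]
    [NormedSpace ℝ G] (w : V) (F : V → G) (p : V) : G := fderiv ℝ F p w

section DirDeriv

variable {V G : Type*} [NormedAddCommGroup V] [NormedSpace ℝ V] [NormedAddCommGroup G]
  [NormedSpace ℝ G] {Ω : Set V} {F H : V → G} {p : V}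

theorem ContDiffOn.dirDeriv (hΩ : IsOpen Ω) (hF : ContDiffOn ℝ ∞ F Ω) (w : V) :
    ContDiffOn ℝ ∞ (dirDeriv w F) Ω :=
  (hF.fderiv_of_isOpen hΩ (by simp)).clm_apply contDiffOn_const

theorem ContDiffOn.differentiableAt_of_isOpen (hΩ : IsOpen Ω) (hF : ContDiffOn ℝ ∞ F Ω)
    (hp : p ∈ Ω) : DifferentiableAt ℝ F p :=
  (hF.differentiableOn (by simp)).differentiableAt (hΩ.mem_nhds hp)

theorem dirDeriv_eqOn (hΩ : IsOpen Ω) (h : Set.EqOn F H Ω) (w : V) :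
    Set.EqOn (dirDeriv w F) (dirDeriv w H) Ω := fun p hp => by
  have : F =ᶠ[𝓝 p] H := h.eventuallyEq_of_mem (hΩ.mem_nhds hp)
  simp only [dirDeriv, this.fderiv_eq]

theorem dirDeriv_iterate_eqOn (hΩ : IsOpen Ω) (h : Set.EqOn F H Ω) (w : V) (n : ℕ) :
    Set.EqOn ((dirDeriv w)^[n] F) ((dirDeriv w)^[n] H) Ω := by
  induction n generalizing F H with
  | zero => exact h
  | succ n ih => exact ih (dirDeriv_eqOn hΩ h w)

theorem dirDeriv_comm (hΩ : IsOpen Ω) (hF : ContDiffOn ℝ ∞ F Ω) (w w' : V) :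
    Set.EqOn (dirDeriv w (dirDeriv w' F)) (dirDeriv w' (dirDeriv w F)) Ω := fun p hp => by
  have hd : DifferentiableAt ℝ (fderiv ℝ F) p :=
    (hF.fderiv_of_isOpen (m := ∞) hΩ (by simp)).differentiableAt_of_isOpen hΩ hp
  have key (w w' : V) : dirDeriv w (dirDeriv w' F) p = fderiv ℝ (fderiv ℝ F) p w w' := by
    have : HasFDerivAt (dirDeriv w' F) ((fderiv ℝ (fderiv ℝ F) p).flip w') p := by
      unfold dirDeriv
      simpa using hd.hasFDerivAt.clm_apply (hasFDerivAt_const w' p)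
    simp [dirDeriv, this.fderiv]
  rw [key, key]
  exact ((hF.contDiffAt (hΩ.mem_nhds hp)).isSymmSndFDerivAt
    (by simpa using WithTop.coe_le_coe.2 (le_top (a := (2 : ℕ∞))))).eq w w'

theorem dirDeriv_iterate_comm (hΩ : IsOpen Ω) (hF : ContDiffOn ℝ ∞ F Ω) (w w' : V) (n : ℕ) :
    Set.EqOn ((dirDeriv w)^[n] (dirDeriv w' F)) (dirDeriv w' ((dirDeriv w)^[n] F)) Ω := by
  induction n generalizing F with
  | zero => exact fun _ _ => rfl
  | succ n ih =>
    exact (dirDeriv_iterate_eqOn hΩ (dirDeriv_comm hΩ hF w w') w n).trans (ih (hF.dirDeriv hΩ w))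

theorem dirDeriv_iterate_smul_add_smul (hΩ : IsOpen Ω) (hF : ContDiffOn ℝ ∞ F Ω)
    (hH : ContDiffOn ℝ ∞ H Ω) (c d : ℝ) (w : V) (n : ℕ) :
    Set.EqOn ((dirDeriv w)^[n] (fun q => c • F q + d • H q))
      (fun q => c • (dirDeriv w)^[n] F q + d • (dirDeriv w)^[n] H q) Ω := by
  induction n generalizing F H with
  | zero => exact fun _ _ => rfl
  | succ n ih =>
    refine (dirDeriv_iterate_eqOn hΩ (fun p hp => ?_) w n).trans
      (ih (hF.dirDeriv hΩ w) (hH.dirDeriv hΩ w))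
    have hFp := hF.differentiableAt_of_isOpen hΩ hp
    have hHp := hH.differentiableAt_of_isOpen hΩ hp
    simp only [dirDeriv]
    rw [fderiv_fun_add (hFp.fun_const_smul c) (hHp.fun_const_smul d), fderiv_fun_const_smul hFp,
      fderiv_fun_const_smul hHp]
    simp

theorem dirDeriv_smul (hΩ : IsOpen Ω) {c : V → ℝ} (hc : ContDiffOn ℝ ∞ c Ω)
    (hF : ContDiffOn ℝ ∞ F Ω) (hp : p ∈ Ω) (w : V) :
    dirDeriv w (fun q => c q • F q) p = dirDeriv w c p • F p + c p • dirDeriv w F p := by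
  simp [dirDeriv, fderiv_fun_smul (hc.differentiableAt_of_isOpen hΩ hp)
    (hF.differentiableAt_of_isOpen hΩ hp), add_comm]

theorem dirDeriv_add (hΩ : IsOpen Ω) (hF : ContDiffOn ℝ ∞ F Ω) (hH : ContDiffOn ℝ ∞ H Ω)
    (hp : p ∈ Ω) (w : V) :
    dirDeriv w (fun q => F q + H q) p = dirDeriv w F p + dirDeriv w H p := by
  simp [dirDeriv, fderiv_fun_add (hF.differentiableAt_of_isOpen hΩ hp)
    (hH.differentiableAt_of_isOpen hΩ hp)]

/-- The binomial formula for iterated derivatives in the direction `i • w + j • w'`. -/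
theorem dirDeriv_iterate_smul_add_smul_dir (hΩ : IsOpen Ω) (hF : ContDiffOn ℝ ∞ F Ω) (w w' : V)
    (i j : ℝ) (n : ℕ) :
    Set.EqOn ((dirDeriv (i • w + j • w'))^[n] F)
      (fun q => ∑ mk ∈ Finset.HasAntidiagonal.antidiagonal n, n.choose mk.1 •
        ((i ^ mk.1 * j ^ mk.2) • (dirDeriv w')^[mk.2] ((dirDeriv w)^[mk.1] F) q)) Ω := by
  induction n generalizing F with
  | zero => intro q _; simp
  | succ n ih =>
    intro q hq
    have h1 : dirDeriv (i • w + j • w') F = fun q => i • dirDeriv w F q + j • dirDeriv w' F q := by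
      funext q; simp [dirDeriv]
    have h2 (m k : ℕ) : (dirDeriv w')^[k] ((dirDeriv w)^[m] (dirDeriv w' F)) q =
        (dirDeriv w')^[k + 1] ((dirDeriv w)^[m] F) q :=
      dirDeriv_iterate_eqOn hΩ (dirDeriv_iterate_comm hΩ hF w w' m) w' k hq
    rw [Function.iterate_succ_apply, h1, dirDeriv_iterate_smul_add_smul hΩ (hF.dirDeriv hΩ w)
      (hF.dirDeriv hΩ w') i j _ n hq]
    simp only []
    rw [ih (hF.dirDeriv hΩ w) hq, ih (hF.dirDeriv hΩ w') hq,
      Finset.sum_antidiagonal_choose_succ_nsmul (fun m k =>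
        (i ^ m * j ^ k) • (dirDeriv w')^[k] ((dirDeriv w)^[m] F) q) n, add_comm,
      Finset.smul_sum, Finset.smul_sum]
    congr 1
    · refine Finset.sum_congr rfl fun mk _ => ?_
      rw [h2, smul_comm j, smul_smul j]
      congr 2; ring
    · refine Finset.sum_congr rfl fun mk hmk => ?_
      rw [← Nat.choose_symm_of_eq_add (Finset.HasAntidiagonal.mem_antidiagonal.1 hmk).symm,
        smul_comm i, smul_smul i, Function.iterate_succ_apply]
      congr 2; ring

theorem isBigO_pow_succ_of_hasDerivAt {g g' : ℝ → G} {n : ℕ}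
    (hg : ∀ᶠ e in 𝓝 (0 : ℝ), HasDerivAt g (g' e) e) (hg0 : g 0 = 0)
    (hg' : g' =O[𝓝 0] fun e => e ^ n) : g =O[𝓝 0] fun e => e ^ (n + 1) := by
  obtain ⟨C, hC0, hC'⟩ := hg'.exists_nonneg
  have hC := hC'.bound
  obtain ⟨r, hr, hball⟩ := Metric.eventually_nhds_iff_ball.1 (hg.and hC)
  refine IsBigO.of_bound C (Metric.eventually_nhds_iff_ball.2 ⟨r, hr, fun e he => ?_⟩)
  have hsub : Metric.closedBall (0 : ℝ) |e| ⊆ Metric.ball 0 r :=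
    Metric.closedBall_subset_ball (by simpa using he)
  have := (convex_closedBall (0 : ℝ) |e|).norm_image_sub_le_of_norm_hasDerivWithin_le
    (f := g) (f' := g') (C := C * |e| ^ n)
    (fun x hx => (hball x (hsub hx)).1.hasDerivWithinAt)
    (fun x hx => (hball x (hsub hx)).2.trans ?_)
    (Metric.mem_closedBall_self (abs_nonneg e)) (y := e) (by simp)
  · simpa [hg0, pow_succ, mul_assoc] using this
  · have hx' : |x| ≤ |e| := by simpa using hx
    rw [norm_pow, Real.norm_eq_abs]
    gcongr

/-- Taylor's formula along a straight line. -/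
theorem taylor_along_line (hΩ : IsOpen Ω) (hF : ContDiffOn ℝ ∞ F Ω) (hp : p ∈ Ω) (w : V) (n : ℕ) :
    (fun e : ℝ => F (p + e • w) -
      ∑ k ∈ Finset.range n, (e ^ k / k.factorial) • (dirDeriv w)^[k] F p) =O[𝓝 0]
      fun e => e ^ n := by
  have hline : Continuous fun e : ℝ => p + e • w := by fun_prop
  have hmem : ∀ᶠ e in 𝓝 (0 : ℝ), p + e • w ∈ Ω :=
    hline.continuousAt.eventually_mem (hΩ.mem_nhds (by simpa))
  induction n generalizing F with
  | zero =>
    have hc : ContinuousAt (fun e : ℝ => F (p + e • w)) 0 :=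
      ContinuousAt.comp (f := fun e : ℝ => p + e • w) (x := 0) (g := F)
        (by simpa using (hF.differentiableAt_of_isOpen hΩ hp).continuousAt) hline.continuousAt
    simpa using hc.isBigO_one ℝ
  | succ n ih =>
    refine isBigO_pow_succ_of_hasDerivAt ?_ ?_ (ih (hF.dirDeriv hΩ w))
    · filter_upwards [hmem] with e he
      have h1 : HasDerivAt (fun e : ℝ => F (p + e • w)) (dirDeriv w F (p + e • w)) e := by
        have hl : HasDerivAt (fun e : ℝ => p + e • w) w e := by
          simpa using ((hasDerivAt_id e).smul_const w).const_add p
        exact (hF.differentiableAt_of_isOpen hΩ he).hasFDerivAt.comp_hasDerivAt e hl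
      refine h1.sub ?_
      have h2 : HasDerivAt (fun e : ℝ => ∑ k ∈ Finset.range n,
          (e ^ (k + 1) / ((k + 1).factorial : ℝ)) • (dirDeriv w)^[k + 1] F p + F p)
          (∑ k ∈ Finset.range n, (e ^ k / (k.factorial : ℝ)) • (dirDeriv w)^[k] (dirDeriv w F) p)
          e := by
        refine (HasDerivAt.fun_sum fun k _ => ?_).add_const _
        convert ((hasDerivAt_pow (k + 1) e).div_const ((k + 1).factorial : ℝ)).smul_const
          ((dirDeriv w)^[k + 1] F p) using 2
        rw [Nat.factorial_succ]
        have : (k.factorial : ℝ) ≠ 0 := by positivity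
        push_cast
        field_simp
        simp
      convert h2 using 2 with e
      simp [Finset.sum_range_succ']
    · simp [Finset.sum_range_succ']

end DirDeriv

/-- The determinant of three vectors in `ℝ³`. -/
def det3 (x y z : E3) : ℝ := dot3 (cross3 x y) z

theorem det3_eq (x y z : E3) :
    det3 x y z = (x 1 * y 2 - x 2 * y 1) * z 0 + (x 2 * y 0 - x 0 * y 2) * z 1 +
      (x 0 * y 1 - x 1 * y 0) * z 2 := by
  simp [det3, dot3, cross3]

theorem det3_rotate (x y z : E3) : det3 x y z = det3 y z x := by
  simp only [det3_eq]; ring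

theorem det3_add_right (x y z w : E3) : det3 x y (z + w) = det3 x y z + det3 x y w := by
  simp only [det3_eq, PiLp.add_apply]; ring

theorem det3_sub_right (x y z w : E3) : det3 x y (z - w) = det3 x y z - det3 x y w := by
  simp only [det3_eq, PiLp.sub_apply]; ring

theorem det3_neg_left (x y z : E3) : det3 (-x) y z = -det3 x y z := by
  simp only [det3_eq, PiLp.neg_apply]; ring

theorem det3_smul_right (x y z : E3) (c : ℝ) : det3 x y (c • z) = c * det3 x y z := by
  simp only [det3_eq, PiLp.smul_apply, smul_eq_mul]; ring

theorem det3_add_combination (x y z : E3) (c d : ℝ) :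
    det3 x y (z + c • x + d • y) = det3 x y z := by
  simp only [det3_eq, PiLp.add_apply, PiLp.smul_apply, smul_eq_mul]; ring

theorem abs_det3_le (x y z : E3) : |det3 x y z| ≤ 6 * (‖x‖ * ‖y‖ * ‖z‖) := by
  have h (i j k : Fin 3) : |x i * y j * z k| ≤ ‖x‖ * ‖y‖ * ‖z‖ := by
    rw [abs_mul, abs_mul]
    have hn (v : E3) (m : Fin 3) : |v m| ≤ ‖v‖ := PiLp.norm_apply_le v m
    gcongr <;> apply hn
  have e1 := abs_le.1 (h 1 2 0)
  have e2 := abs_le.1 (h 2 1 0)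
  have e3 := abs_le.1 (h 2 0 1)
  have e4 := abs_le.1 (h 0 2 1)
  have e5 := abs_le.1 (h 0 1 2)
  have e6 := abs_le.1 (h 1 0 2)
  rw [det3_eq, abs_le]
  constructor <;> linarith

theorem isBigO_det3 {P Q R : ℝ → E3} {l : Filter ℝ} {i j k : ℕ}
    (hP : P =O[l] fun e => e ^ i) (hQ : Q =O[l] fun e => e ^ j) (hR : R =O[l] fun e => e ^ k) :
    (fun e => det3 (P e) (Q e) (R e)) =O[l] fun e => e ^ (i + j + k) := by
  have h1 : (fun e => det3 (P e) (Q e) (R e)) =O[l] fun e => ‖P e‖ * ‖Q e‖ * ‖R e‖ :=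
    IsBigO.of_bound 6 (Filter.Eventually.of_forall fun e => by
      simpa using abs_det3_le (P e) (Q e) (R e))
  refine (h1.trans ((hP.norm_left.mul hQ.norm_left).mul hR.norm_left)).congr_right fun e => ?_
  ring

theorem isBigO_pow_pow_nhds_zero {m k : ℕ} (h : k ≤ m) :
    (fun e : ℝ => e ^ m) =O[𝓝 0] fun e => e ^ k := by
  obtain ⟨d, rfl⟩ := Nat.exists_eq_add_of_le h
  simpa [pow_add] using (isBigO_refl (fun e : ℝ => e ^ k) (𝓝 0)).mul
    (((continuous_pow d).tendsto (0 : ℝ)).isBigO_one ℝ)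

theorem isBigO_pow_of_sub_smul {G : Type*} [NormedAddCommGroup G] [NormedSpace ℝ G] {R : ℝ → G}
    {ρ : G} {k : ℕ} (hR : (fun e => R e - e ^ k • ρ) =O[𝓝 0] fun e => e ^ (k + 1)) :
    R =O[𝓝 0] fun e => e ^ k := by
  have h2 : (fun e : ℝ => e ^ k • ρ) =O[𝓝 0] fun e => e ^ k :=
    IsBigO.of_bound ‖ρ‖ (Filter.Eventually.of_forall fun e => by simp [norm_smul, mul_comm])
  simpa using (hR.trans (isBigO_pow_pow_nhds_zero k.le_succ)).add h2

/-- Leading term of the determinant of three vectors with known leading terms. -/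
theorem det3_isBigO_sub_leading {P Q R : ℝ → E3} {x y ρ : E3} {k : ℕ}
    (hP : (fun e => P e - e • x) =O[𝓝 0] fun e => e ^ 2)
    (hQ : (fun e => Q e - e • y) =O[𝓝 0] fun e => e ^ 2)
    (hR : (fun e => R e - e ^ k • ρ) =O[𝓝 0] fun e => e ^ (k + 1)) :
    (fun e => det3 (P e) (Q e) (R e) - e ^ (k + 2) * det3 x y ρ) =O[𝓝 0]
      fun e => e ^ (k + 3) := by
  have hQ1 : Q =O[𝓝 0] fun e => e ^ 1 := isBigO_pow_of_sub_smul (ρ := y) (by simpa using hQ)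
  have hR1 := isBigO_pow_of_sub_smul hR
  have hx (x : E3) : (fun e : ℝ => e • x) =O[𝓝 0] fun e => e ^ 1 :=
    isBigO_pow_of_sub_smul (ρ := x) (by simpa using isBigO_zero _ _)
  have h1 := isBigO_det3 hP hQ1 hR1
  have h2 := isBigO_det3 (hx x) hQ hR1
  have h3 := isBigO_det3 (hx x) (hx y) hR
  rw [show 2 + 1 + k = k + 3 by ring] at h1
  rw [show 1 + 2 + k = k + 3 by ring] at h2
  rw [show 1 + 1 + (k + 1) = k + 3 by ring] at h3
  refine ((h1.add h2).add h3).congr_left fun e => ?_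
  simp only [det3_eq, PiLp.sub_apply, PiLp.smul_apply, smul_eq_mul]
  ring

theorem coplanar_of_det3_eq_zero {X Y Z W : E3} (h : det3 (Y - X) (Z - X) (W - X) = 0) :
    Coplanar ℝ ({X, Y, Z, W} : Set E3) := by
  have hdep : ¬ LinearIndependent ℝ ![Y - X, Z - X, W - X] := by
    intro hli
    have hli' := hli.map' (WithLp.linearEquiv 2 ℝ (Fin 3 → ℝ)).toLinearMap (LinearEquiv.ker _)
    let M : Matrix (Fin 3) (Fin 3) ℝ :=
      fun i => (WithLp.linearEquiv 2 ℝ (Fin 3 → ℝ)) (![Y - X, Z - X, W - X] i)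
    have hM : IsUnit M := Matrix.linearIndependent_rows_iff_isUnit.1 hli'
    have hdet : M.det = det3 (Y - X) (Z - X) (W - X) := by
      rw [Matrix.det_fin_three, det3_eq]
      simp [M]
      ring
    exact ((Matrix.isUnit_iff_isUnit_det M).1 hM).ne_zero (hdet.trans h)
  rw [linearIndependent_iff_card_le_finrank_span, Fintype.card_fin, not_le,
    Set.finrank] at hdep
  rw [coplanar_iff_finrank_le_two,
    vectorSpan_eq_span_vsub_set_right ℝ (Set.mem_insert X {Y, Z, W})]
  have : Submodule.span ℝ ((· -ᵥ X) '' ({X, Y, Z, W} : Set E3)) =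
      Submodule.span ℝ (Set.range ![Y - X, Z - X, W - X]) := by
    rw [Matrix.range_cons, Matrix.range_cons, Matrix.range_cons, Matrix.range_empty]
    simp only [Set.image_insert_eq, Set.image_singleton, vsub_eq_sub, sub_self,
      Submodule.span_insert_zero, Set.union_empty]
    congr 1
  rw [this]
  omega

/-- A family of maps that are close to translations on shrinking balls has small zeros. -/
theorem exists_zero_of_approximates_id {Ψ : ℝ → ℝ × ℝ → ℝ × ℝ} {K : ℝ} (hK : 1 ≤ K)
    (hlin : ∀ᶠ e in 𝓝[>] (0 : ℝ), ∀ z ∈ Metric.closedBall (0 : ℝ × ℝ) (e ^ 2),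
      ∀ w ∈ Metric.closedBall (0 : ℝ × ℝ) (e ^ 2), ‖Ψ e z - Ψ e w - (z - w)‖ ≤ K * e * ‖z - w‖)
    (h1 : ∀ᶠ e in 𝓝[>] (0 : ℝ), |(Ψ e 0).1| ≤ K * e ^ 3)
    (h2 : ∀ᶠ e in 𝓝[>] (0 : ℝ), |(Ψ e 0).2| ≤ K * e ^ 4) :
    ∀ᶠ e in 𝓝[>] (0 : ℝ), ∃ z ∈ Metric.closedBall (0 : ℝ × ℝ) (e ^ 2),
      |z.1| ≤ 3 * K ^ 2 * e ^ 3 ∧ |z.2| ≤ 3 * K ^ 2 * e ^ 4 ∧ Ψ e z = 0 := by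
  have hsmall : ∀ᶠ e in 𝓝[>] (0 : ℝ), e < 1 / (2 * K) :=
    nhdsWithin_le_nhds (eventually_lt_nhds (by positivity))
  filter_upwards [hlin, h1, h2, hsmall, self_mem_nhdsWithin] with e hlin h1 h2 hsmall he
  have he0 : 0 < e := he
  have hKe : 2 * K * e ≤ 1 := by
    rw [lt_div_iff₀ (by positivity)] at hsmall; linarith
  have he1 : e ≤ 1 := by nlinarith
  set r := 2 * K * e ^ 3 with hr
  have hr2 : r ≤ e ^ 2 := by
    have : r = 2 * K * e * e ^ 2 := by rw [hr]; ring
    rw [this]; exact mul_le_of_le_one_left (by positivity) hKe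
  have hr0 : 0 ≤ r := by positivity
  have hsub : Metric.closedBall (0 : ℝ × ℝ) r ⊆ Metric.closedBall 0 (e ^ 2) :=
    Metric.closedBall_subset_closedBall hr2
  have happ : ApproximatesLinearOn (Ψ e)
      ((ContinuousLinearEquiv.refl ℝ (ℝ × ℝ) : (ℝ × ℝ) ≃L[ℝ] ℝ × ℝ) : (ℝ × ℝ) →L[ℝ] ℝ × ℝ)
      (Metric.closedBall 0 (e ^ 2)) ⟨K * e, by positivity⟩ :=
    hlin
  have hsurj := happ.surjOn_closedBall_of_nonlinearRightInverse
    (ContinuousLinearEquiv.refl ℝ (ℝ × ℝ)).toNonlinearRightInverse hr0 hsub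
  have hn : (((ContinuousLinearEquiv.refl ℝ (ℝ × ℝ)).toNonlinearRightInverse.nnnorm : NNReal) : ℝ)
      = 1 := by
    simp [ContinuousLinearEquiv.toNonlinearRightInverse]
  rw [hn] at hsurj
  have hnorm : ‖Ψ e 0‖ ≤ K * e ^ 3 := by
    rw [Prod.norm_def]
    refine max_le h1 (h2.trans ?_)
    exact mul_le_mul_of_nonneg_left (pow_le_pow_of_le_one he0.le he1 (Nat.le_succ 3))
      (by positivity)
  obtain ⟨z, hz, hz0⟩ := hsurj (show (0 : ℝ × ℝ) ∈
      Metric.closedBall (Ψ e 0) ((1⁻¹ - K * e) * (2 * K * e ^ 3)) by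
    rw [Metric.mem_closedBall, dist_zero_left]
    refine hnorm.trans ?_
    have : 0 < K * e ^ 3 := by positivity
    nlinarith)
  have hzn : ‖z‖ ≤ r := by simpa using hz
  refine ⟨z, hsub hz, ?_, ?_, hz0⟩
  · refine ((norm_fst_le z).trans hzn).trans ?_
    rw [hr]; gcongr <;> nlinarith
  · have h3 := (norm_snd_le _).trans
      (hlin z (hsub hz) 0 (Metric.mem_closedBall_self (by positivity)))
    simp only [hz0, sub_zero, zero_sub, Prod.snd_sub, Prod.snd_neg, Real.norm_eq_abs] at h3
    have h4 : K * e * ‖z‖ ≤ K * e * r := by gcongr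
    have h5 : K * e * r = 2 * K ^ 2 * e ^ 4 := by rw [hr]; ring
    have h6 : K * e ^ 4 ≤ K ^ 2 * e ^ 4 := by gcongr; nlinarith
    have h7 := abs_le.1 h3
    have h8 := abs_le.1 h2
    rw [abs_le]
    constructor <;> linarith

theorem Asymptotics.IsBigO.continuous_smul {R : ℝ → E3} {c : ℝ → ℝ} {n : ℕ}
    (hR : R =O[𝓝 0] fun e => e ^ n) (hc : Continuous c) :
    (fun e => c e • R e) =O[𝓝 0] fun e => e ^ n := by
  simpa using ((hc.tendsto 0).isBigO_one ℝ).smul hR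

theorem isBigO_pow_smul_continuous {S : ℝ → E3} (hS : Continuous S) (n : ℕ) :
    (fun e => e ^ n • S e) =O[𝓝 0] fun e => e ^ n := by
  simpa using (isBigO_refl (fun e : ℝ => e ^ n) (𝓝 0)).smul ((hS.tendsto 0).isBigO_one ℝ)

/-- A variant of `det3_isBigO_sub_leading` in which multiples of the first two vectors may be
added to the third one. -/
theorem det3_isBigO_sub_leading_of_combination {P Q R : ℝ → E3} {x y ρ : E3} {k : ℕ}
    (c d : ℝ → ℝ)
    (hP : (fun e => P e - e • x) =O[𝓝 0] fun e => e ^ 2)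
    (hQ : (fun e => Q e - e • y) =O[𝓝 0] fun e => e ^ 2)
    (hR : (fun e => R e + c e • P e + d e • Q e - e ^ k • ρ) =O[𝓝 0] fun e => e ^ (k + 1)) :
    (fun e => det3 (P e) (Q e) (R e) - e ^ (k + 2) * det3 x y ρ) =O[𝓝 0]
      fun e => e ^ (k + 3) := by
  simpa only [det3_add_combination] using det3_isBigO_sub_leading hP hQ hR

section Expansions

variable {g : ℝ → ℝ → ℝ → E3} {O x y p q t z s s' f11 f21 f12 f31 f22 f13 : E3}
  {a b a₁ b₁ a₂ b₂ a₃ b₃ a₄ b₄ a₅ b₅ c : ℝ}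

theorem isBigO_sub_fst {i i' j : ℝ}
    (h1 : ∀ i j, (fun e => g i j e - (O + e • (i • x + j • y))) =O[𝓝 0] fun e => e ^ 2)
    (hi : i' = i + 1) : (fun e => g i' j e - g i j e - e • x) =O[𝓝 0] fun e => e ^ 2 :=
  ((h1 i' j).sub (h1 i j)).congr_left fun e => by subst hi; module

theorem isBigO_sub_snd {i : ℝ}
    (h1 : ∀ i j, (fun e => g i j e - (O + e • (i • x + j • y))) =O[𝓝 0] fun e => e ^ 2) :
    (fun e => g i 1 e - g i 0 e - e • y) =O[𝓝 0] fun e => e ^ 2 :=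
  ((h1 i 1).sub (h1 i 0)).congr_left fun e => by module

/-- Planarity defect of the left quadrilateral of a conjugate net. -/
theorem det3_defect_left
    (h1 : ∀ i j, (fun e => g i j e - (O + e • (i • x + j • y))) =O[𝓝 0] fun e => e ^ 2)
    (h4 : ∀ i j, (fun e => g i j e - (O + e • (i • x + j • y) +
      (e ^ 2 / 2) • (i ^ 2 • p + (2 * i * j) • f11 + j ^ 2 • q) +
      (e ^ 3 / 6) • (i ^ 3 • t + (3 * i ^ 2 * j) • f21 + (3 * i * j ^ 2) • f12 + j ^ 3 • z) +
      (e ^ 4 / 24) • (i ^ 4 • s + (4 * i ^ 3 * j) • f31 + (6 * i ^ 2 * j ^ 2) • f22 +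
        (4 * i * j ^ 3) • f13 + j ^ 4 • s'))) =O[𝓝 0] fun e => e ^ 5)
    (hf11 : f11 = a • x + b • y) (hf21 : f21 = a₁ • x + b₁ • y + a • p)
    (hf12 : f12 = a₂ • x + b₂ • y + b • q)
    (hf31 : f31 = a₃ • x + b₃ • y + (2 * a₁ - a * b) • p + a • t)
    (hf22 : f22 = a₄ • x + b₄ • y + a₂ • p + b₁ • q)
    (hf13 : f13 = a₅ • x + b₅ • y + c • q + b • z) :
    (fun e => det3 (g 1 0 e - g 0 0 e) (g 0 1 e - g 0 0 e) (g 1 1 e - g 0 0 e) -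
      e ^ 6 * det3 x y ((a₁ / 12 - a * b / 6) • p + (c / 6 - b₂ / 4) • q)) =O[𝓝 0]
      fun e => e ^ 7 := by
  set k := (a₁ + a₂) / 2 with hk
  set l := (b₁ + b₂) / 2 with hl
  have key := det3_isBigO_sub_leading_of_combination (k := 4)
    (ρ := (a₃ / 6 + a₄ / 4 + a₅ / 6) • x + (b₃ / 6 + b₄ / 4 + b₅ / 6) • y +
      (a₁ / 12 - a * b / 6) • p + (c / 6 - b₂ / 4) • q)
    (R := fun e => g 1 1 e - g 0 0 e)
    (fun e => -1 - e * (a + k * e)) (fun e => -1 - e * (b + l * e))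
    (isBigO_sub_fst (j := 0) h1 (zero_add 1).symm) (isBigO_sub_snd (i := 0) h1) ?_
  · refine key.congr_left fun e => ?_
    simp only [det3_eq, PiLp.add_apply, PiLp.smul_apply, smul_eq_mul]
    ring
  · have hS := isBigO_pow_smul_continuous (S := fun e => -(((a + k * e) / 24) • s + (k / 6) • t +
      ((b + l * e) / 24) • s' + (l / 6) • z)) (by fun_prop) 5
    have hB := ((h4 1 0).sub (h4 0 0)).continuous_smul (c := fun e => -1 - e * (a + k * e))
      (by fun_prop)
    have hC := ((h4 0 1).sub (h4 0 0)).continuous_smul (c := fun e => -1 - e * (b + l * e))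
      (by fun_prop)
    refine (((((h4 1 1).sub (h4 0 0)).add hB).add hC).add hS).congr_left fun e => ?_
    simp only [hf11, hf21, hf12, hf31, hf22, hf13, hk, hl]
    module

/-- Planarity defect of the right quadrilateral of a conjugate net. -/
theorem det3_defect_right
    (h1 : ∀ i j, (fun e => g i j e - (O + e • (i • x + j • y))) =O[𝓝 0] fun e => e ^ 2)
    (h4 : ∀ i j, (fun e => g i j e - (O + e • (i • x + j • y) +
      (e ^ 2 / 2) • (i ^ 2 • p + (2 * i * j) • f11 + j ^ 2 • q) +
      (e ^ 3 / 6) • (i ^ 3 • t + (3 * i ^ 2 * j) • f21 + (3 * i * j ^ 2) • f12 + j ^ 3 • z) +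
      (e ^ 4 / 24) • (i ^ 4 • s + (4 * i ^ 3 * j) • f31 + (6 * i ^ 2 * j ^ 2) • f22 +
        (4 * i * j ^ 3) • f13 + j ^ 4 • s'))) =O[𝓝 0] fun e => e ^ 5)
    (hf11 : f11 = a • x + b • y) (hf21 : f21 = a₁ • x + b₁ • y + a • p)
    (hf12 : f12 = a₂ • x + b₂ • y + b • q)
    (hf31 : f31 = a₃ • x + b₃ • y + (2 * a₁ - a * b) • p + a • t)
    (hf22 : f22 = a₄ • x + b₄ • y + a₂ • p + b₁ • q)
    (hf13 : f13 = a₅ • x + b₅ • y + c • q + b • z) :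
    (fun e => det3 (g 2 0 e - g 1 0 e) (g 2 1 e - g 2 0 e) (g 1 1 e - g 2 0 e) +
      e ^ 6 * det3 x y ((a₁ / 12 - a * b / 6) • p + (c / 6 - b₂ / 4) • q)) =O[𝓝 0]
      fun e => e ^ 7 := by
  set k := 3 / 2 * a₁ + a₂ / 2 - 2 * a * b with hk
  set l := 3 / 2 * b₁ + b₂ / 2 - 2 * b ^ 2 with hl
  have key := det3_isBigO_sub_leading_of_combination (k := 4)
    (ρ := (-(7 / 6) * a₃ - 3 / 4 * a₄ - a₅ / 6 + 2 * b * a₁ + b * a₂ + 2 * l * a) • x +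
      (-(7 / 6) * b₃ - 3 / 4 * b₄ - b₅ / 6 + 2 * b * b₁ + b * b₂ + 2 * l * b) • y -
      ((a₁ / 12 - a * b / 6) • p + (c / 6 - b₂ / 4) • q))
    (R := fun e => g 1 1 e - g 2 0 e)
    (fun e => 1 + e * (a + k * e)) (fun e => -1 + e * (b + l * e))
    (isBigO_sub_fst (j := 0) h1 (one_add_one_eq_two (R := ℝ)).symm) (isBigO_sub_snd (i := 2) h1) ?_
  · refine key.congr_left fun e => ?_
    simp only [det3_eq, PiLp.add_apply, PiLp.sub_apply, PiLp.smul_apply, smul_eq_mul]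
    ring
  · have hS := isBigO_pow_smul_continuous (S := fun e => ((a + k * e) * (15 / 24)) • s +
      (k * (7 / 6)) • t +
      (b + l * e) • ((8 / 6 : ℝ) • f31 + f22 + (2 / 6 : ℝ) • f13 + (1 / 24 : ℝ) • s') +
      l • ((2 : ℝ) • f21 + f12 + (1 / 6 : ℝ) • z)) (by fun_prop) 5
    have hB := ((h4 2 0).sub (h4 1 0)).continuous_smul (c := fun e => 1 + e * (a + k * e))
      (by fun_prop)
    have hC := ((h4 2 1).sub (h4 2 0)).continuous_smul (c := fun e => -1 + e * (b + l * e))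
      (by fun_prop)
    refine (((((h4 1 1).sub (h4 2 0)).add hB).add hC).add hS).congr_left fun e => ?_
    simp only [hf11, hf21, hf12, hf31, hf22, hf13, hk, hl]
    module

variable {U : ℝ → E3}

theorem det3_tangent_fst_left
    (h1 : ∀ i j, (fun e => g i j e - (O + e • (i • x + j • y))) =O[𝓝 0] fun e => e ^ 2)
    (h2 : ∀ i j, (fun e => g i j e - (O + e • (i • x + j • y) +
      (e ^ 2 / 2) • (i ^ 2 • p + (2 * i * j) • f11 + j ^ 2 • q))) =O[𝓝 0] fun e => e ^ 3)
    (hU : (fun e => U e - (x + e • (p + f11))) =O[𝓝 0] fun e => e ^ 2)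
    (hf11 : f11 = a • x + b • y) :
    (fun e => e * det3 (g 1 0 e - g 0 0 e) (g 0 1 e - g 0 0 e) (U e) -
      e ^ 4 * (det3 x y p / 2)) =O[𝓝 0] fun e => e ^ 5 := by
  have key := det3_isBigO_sub_leading_of_combination (k := 2) (ρ := (1 / 2 : ℝ) • p)
    (R := fun e => e • U e) (fun e => -1 - e * a) (fun e => -(e * b))
    (isBigO_sub_fst (j := 0) h1 (zero_add 1).symm) (isBigO_sub_snd (i := 0) h1) ?_
  · refine key.congr_left fun e => ?_
    simp only [det3_smul_right]
    ring
  · have hS := isBigO_pow_smul_continuous (S := fun _ => -((a / 2) • p + (b / 2) • q))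
      (by fun_prop) 3
    have hB := ((h2 1 0).sub (h2 0 0)).continuous_smul (c := fun e => -1 - e * a) (by fun_prop)
    have hC := ((h2 0 1).sub (h2 0 0)).continuous_smul (c := fun e => -(e * b)) (by fun_prop)
    have hU' : (fun e => e • (U e - (x + e • (p + f11)))) =O[𝓝 0] fun e => e ^ 3 :=
      ((isBigO_refl (fun e : ℝ => e) _).smul hU).congr_right fun e => by simp; ring
    refine (((hU'.add hB).add hC).add hS).congr_left fun e => ?_
    simp only [hf11]
    module

theorem det3_tangent_snd_left
    (h1 : ∀ i j, (fun e => g i j e - (O + e • (i • x + j • y))) =O[𝓝 0] fun e => e ^ 2)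
    (h2 : ∀ i j, (fun e => g i j e - (O + e • (i • x + j • y) +
      (e ^ 2 / 2) • (i ^ 2 • p + (2 * i * j) • f11 + j ^ 2 • q))) =O[𝓝 0] fun e => e ^ 3)
    (hU : (fun e => U e - (y + e • (f11 + q))) =O[𝓝 0] fun e => e ^ 2)
    (hf11 : f11 = a • x + b • y) :
    (fun e => e * det3 (g 1 0 e - g 0 0 e) (g 0 1 e - g 0 0 e) (U e) -
      e ^ 4 * (det3 x y q / 2)) =O[𝓝 0] fun e => e ^ 5 := by
  have key := det3_isBigO_sub_leading_of_combination (k := 2) (ρ := (1 / 2 : ℝ) • q)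
    (R := fun e => e • U e) (fun e => -(e * a)) (fun e => -1 - e * b)
    (isBigO_sub_fst (j := 0) h1 (zero_add 1).symm) (isBigO_sub_snd (i := 0) h1) ?_
  · refine key.congr_left fun e => ?_
    simp only [det3_smul_right]
    ring
  · have hS := isBigO_pow_smul_continuous (S := fun _ => -((a / 2) • p + (b / 2) • q))
      (by fun_prop) 3
    have hB := ((h2 1 0).sub (h2 0 0)).continuous_smul (c := fun e => -(e * a)) (by fun_prop)
    have hC := ((h2 0 1).sub (h2 0 0)).continuous_smul (c := fun e => -1 - e * b) (by fun_prop)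
    have hU' : (fun e => e • (U e - (y + e • (f11 + q)))) =O[𝓝 0] fun e => e ^ 3 :=
      ((isBigO_refl (fun e : ℝ => e) _).smul hU).congr_right fun e => by simp; ring
    refine (((hU'.add hB).add hC).add hS).congr_left fun e => ?_
    simp only [hf11]
    module

theorem det3_tangent_fst_right
    (h1 : ∀ i j, (fun e => g i j e - (O + e • (i • x + j • y))) =O[𝓝 0] fun e => e ^ 2)
    (h2 : ∀ i j, (fun e => g i j e - (O + e • (i • x + j • y) +
      (e ^ 2 / 2) • (i ^ 2 • p + (2 * i * j) • f11 + j ^ 2 • q))) =O[𝓝 0] fun e => e ^ 3)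
    (hU : (fun e => U e - (x + e • (p + f11))) =O[𝓝 0] fun e => e ^ 2)
    (hf11 : f11 = a • x + b • y) :
    (fun e => e * det3 (g 2 0 e - g 1 0 e) (g 2 1 e - g 2 0 e) (U e) +
      e ^ 4 * (det3 x y p / 2)) =O[𝓝 0] fun e => e ^ 5 := by
  have key := det3_isBigO_sub_leading_of_combination (k := 2) (ρ := (-1 / 2 : ℝ) • p)
    (R := fun e => e • U e) (fun e => -1 - e * a) (fun e => -(e * b))
    (isBigO_sub_fst (j := 0) h1 (one_add_one_eq_two (R := ℝ)).symm) (isBigO_sub_snd (i := 2) h1) ?_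
  · refine key.congr_left fun e => ?_
    simp only [det3_smul_right]
    ring
  · have hS := isBigO_pow_smul_continuous
      (S := fun _ => -((3 / 2 * a) • p + b • ((2 : ℝ) • f11 + (1 / 2 : ℝ) • q))) (by fun_prop) 3
    have hB := ((h2 2 0).sub (h2 1 0)).continuous_smul (c := fun e => -1 - e * a) (by fun_prop)
    have hC := ((h2 2 1).sub (h2 2 0)).continuous_smul (c := fun e => -(e * b)) (by fun_prop)
    have hU' : (fun e => e • (U e - (x + e • (p + f11)))) =O[𝓝 0] fun e => e ^ 3 :=
      ((isBigO_refl (fun e : ℝ => e) _).smul hU).congr_right fun e => by simp; ring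
    refine (((hU'.add hB).add hC).add hS).congr_left fun e => ?_
    simp only [hf11]
    module

theorem det3_tangent_snd_right
    (h1 : ∀ i j, (fun e => g i j e - (O + e • (i • x + j • y))) =O[𝓝 0] fun e => e ^ 2)
    (h2 : ∀ i j, (fun e => g i j e - (O + e • (i • x + j • y) +
      (e ^ 2 / 2) • (i ^ 2 • p + (2 * i * j) • f11 + j ^ 2 • q))) =O[𝓝 0] fun e => e ^ 3)
    (hU : (fun e => U e - (y + e • (f11 + q))) =O[𝓝 0] fun e => e ^ 2)
    (hf11 : f11 = a • x + b • y) :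
    (fun e => e * det3 (g 2 0 e - g 1 0 e) (g 2 1 e - g 2 0 e) (U e) -
      e ^ 4 * (det3 x y q / 2)) =O[𝓝 0] fun e => e ^ 5 := by
  have key := det3_isBigO_sub_leading_of_combination (k := 2) (ρ := (1 / 2 : ℝ) • q)
    (R := fun e => e • U e) (fun e => e * a) (fun e => -1 + e * b)
    (isBigO_sub_fst (j := 0) h1 (one_add_one_eq_two (R := ℝ)).symm) (isBigO_sub_snd (i := 2) h1) ?_
  · refine key.congr_left fun e => ?_
    simp only [det3_smul_right]
    ring
  · have hS := isBigO_pow_smul_continuous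
      (S := fun _ => (3 / 2 * a) • p + b • ((2 : ℝ) • f11 + (1 / 2 : ℝ) • q)) (by fun_prop) 3
    have hB := ((h2 2 0).sub (h2 1 0)).continuous_smul (c := fun e => e * a) (by fun_prop)
    have hC := ((h2 2 1).sub (h2 2 0)).continuous_smul (c := fun e => -1 + e * b) (by fun_prop)
    have hU' : (fun e => e • (U e - (y + e • (f11 + q)))) =O[𝓝 0] fun e => e ^ 3 :=
      ((isBigO_refl (fun e : ℝ => e) _).smul hU).congr_right fun e => by simp; ring
    refine (((hU'.add hB).add hC).add hS).congr_left fun e => ?_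
    simp only [hf11]
    module

end Expansions

section Jets

variable {V G : Type*} [NormedAddCommGroup V] [NormedSpace ℝ V] [NormedAddCommGroup G]
  [NormedSpace ℝ G] {Ω : Set V} {F : V → G} {a b : V → ℝ} {p w w' : V}

theorem dirDeriv_smul_add_smul (hΩ : IsOpen Ω) {c d : V → ℝ} {F H : V → G}
    (hc : ContDiffOn ℝ ∞ c Ω) (hF : ContDiffOn ℝ ∞ F Ω) (hd : ContDiffOn ℝ ∞ d Ω)
    (hH : ContDiffOn ℝ ∞ H Ω) (hp : p ∈ Ω) (w : V) :
    dirDeriv w (fun q => c q • F q + d q • H q) p =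
      dirDeriv w c p • F p + c p • dirDeriv w F p +
        (dirDeriv w d p • H p + d p • dirDeriv w H p) := by
  rw [dirDeriv_add (F := fun q => c q • F q) (H := fun q => d q • H q) hΩ
      (hc.smul hF) (hd.smul hH) hp, dirDeriv_smul hΩ hc hF hp,
    dirDeriv_smul hΩ hd hH hp]

/-- The mixed derivatives up to order four of a conjugate net, expressed by its pure
derivatives. -/
theorem exists_mixed_derivative_coefficients (hΩ : IsOpen Ω) (hF : ContDiffOn ℝ ∞ F Ω)
    (ha : ContDiffOn ℝ ∞ a Ω) (hb : ContDiffOn ℝ ∞ b Ω)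
    (hconj : Set.EqOn (dirDeriv w' (dirDeriv w F))
      (fun q => a q • dirDeriv w F q + b q • dirDeriv w' F q) Ω) (hp : p ∈ Ω) :
    ∃ a₁ b₁ a₂ b₂ a₃ b₃ a₄ b₄ a₅ b₅ c : ℝ,
      dirDeriv w' (dirDeriv w (dirDeriv w F)) p = a₁ • dirDeriv w F p + b₁ • dirDeriv w' F p +
        a p • dirDeriv w (dirDeriv w F) p ∧
      dirDeriv w' (dirDeriv w' (dirDeriv w F)) p = a₂ • dirDeriv w F p + b₂ • dirDeriv w' F p +
        b p • dirDeriv w' (dirDeriv w' F) p ∧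
      dirDeriv w' (dirDeriv w (dirDeriv w (dirDeriv w F))) p = a₃ • dirDeriv w F p +
        b₃ • dirDeriv w' F p + (2 * a₁ - a p * b p) • dirDeriv w (dirDeriv w F) p +
        a p • dirDeriv w (dirDeriv w (dirDeriv w F)) p ∧
      dirDeriv w' (dirDeriv w' (dirDeriv w (dirDeriv w F))) p = a₄ • dirDeriv w F p +
        b₄ • dirDeriv w' F p + a₂ • dirDeriv w (dirDeriv w F) p +
        b₁ • dirDeriv w' (dirDeriv w' F) p ∧
      dirDeriv w' (dirDeriv w' (dirDeriv w' (dirDeriv w F))) p = a₅ • dirDeriv w F p +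
        b₅ • dirDeriv w' F p + c • dirDeriv w' (dirDeriv w' F) p +
        b p • dirDeriv w' (dirDeriv w' (dirDeriv w' F)) p := by
  set X := dirDeriv w F with hXdef
  set Y := dirDeriv w' F with hYdef
  have hX : ContDiffOn ℝ ∞ X Ω := hF.dirDeriv hΩ w
  have hY : ContDiffOn ℝ ∞ Y Ω := hF.dirDeriv hΩ w'
  have hYw : Set.EqOn (dirDeriv w Y) (fun q => a q • X q + b q • Y q) Ω :=
    (dirDeriv_comm hΩ hF w w').trans hconj
  have haw := ha.dirDeriv hΩ w
  have hbw := hb.dirDeriv hΩ w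
  have haw' := ha.dirDeriv hΩ w'
  have hbw' := hb.dirDeriv hΩ w'
  set A₁ : V → ℝ := fun q => dirDeriv w a q + a q * b q with hA₁
  set B₁ : V → ℝ := fun q => dirDeriv w b q + b q * b q with hB₁
  set A₂ : V → ℝ := fun q => dirDeriv w' a q + a q * a q with hA₂
  set B₂ : V → ℝ := fun q => dirDeriv w' b q + a q * b q with hB₂
  have cA₁ : ContDiffOn ℝ ∞ A₁ Ω := haw.add (ha.mul hb)
  have cB₁ : ContDiffOn ℝ ∞ B₁ Ω := hbw.add (hb.mul hb)
  have cA₂ : ContDiffOn ℝ ∞ A₂ Ω := haw'.add (ha.mul ha)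
  have cB₂ : ContDiffOn ℝ ∞ B₂ Ω := hbw'.add (ha.mul hb)
  have hXw := hX.dirDeriv hΩ w
  have hYw' := hY.dirDeriv hΩ w'
  have h21 : Set.EqOn (dirDeriv w' (dirDeriv w X))
      (fun q => (A₁ q • X q + B₁ q • Y q) + a q • dirDeriv w X q) Ω := fun q hq => by
    rw [dirDeriv_comm hΩ hX w' w hq, dirDeriv_eqOn hΩ hconj w hq,
      dirDeriv_smul_add_smul hΩ ha hX hb hY hq, hYw hq]
    module
  have h12 : Set.EqOn (dirDeriv w' (dirDeriv w' X))
      (fun q => (A₂ q • X q + B₂ q • Y q) + b q • dirDeriv w' Y q) Ω := fun q hq => by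
    rw [dirDeriv_eqOn hΩ hconj w' hq, dirDeriv_smul_add_smul hΩ ha hX hb hY hq, hconj hq]
    module
  refine ⟨A₁ p, B₁ p, A₂ p, B₂ p, dirDeriv w A₁ p + B₁ p * a p,
    dirDeriv w B₁ p + B₁ p * b p, dirDeriv w' A₁ p + A₁ p * a p + a p * A₁ p,
    dirDeriv w' B₁ p + A₁ p * b p + a p * B₁ p, dirDeriv w' A₂ p + A₂ p * a p,
    dirDeriv w' B₂ p + A₂ p * b p, B₂ p + dirDeriv w' b p, h21 hp, h12 hp, ?_, ?_, ?_⟩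
  · rw [dirDeriv_comm hΩ hXw w' w hp, dirDeriv_eqOn hΩ h21 w hp,
      dirDeriv_add (F := fun q => A₁ q • X q + B₁ q • Y q) (H := fun q => a q • dirDeriv w X q) hΩ
        ((cA₁.smul hX).add (cB₁.smul hY)) (ha.smul hXw) hp,
      dirDeriv_smul_add_smul hΩ cA₁ hX cB₁ hY hp, dirDeriv_smul hΩ ha hXw hp, hYw hp]
    module
  · rw [dirDeriv_eqOn hΩ h21 w' hp,
      dirDeriv_add (F := fun q => A₁ q • X q + B₁ q • Y q) (H := fun q => a q • dirDeriv w X q) hΩ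
        ((cA₁.smul hX).add (cB₁.smul hY)) (ha.smul hXw) hp,
      dirDeriv_smul_add_smul hΩ cA₁ hX cB₁ hY hp, dirDeriv_smul hΩ ha hXw hp, h21 hp, hconj hp]
    module
  · rw [dirDeriv_eqOn hΩ h12 w' hp,
      dirDeriv_add (F := fun q => A₂ q • X q + B₂ q • Y q) (H := fun q => b q • dirDeriv w' Y q) hΩ
        ((cA₂.smul hX).add (cB₂.smul hY)) (hb.smul hYw') hp,
      dirDeriv_smul_add_smul hΩ cA₂ hX cB₂ hY hp, dirDeriv_smul hΩ hb hYw' hp, hconj hp]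
    module

theorem taylor_two (hΩ : IsOpen Ω) (hF : ContDiffOn ℝ ∞ F Ω) (hp : p ∈ Ω) (i j : ℝ) :
    (fun e : ℝ => F (p + e • (i • w + j • w')) -
      (F p + e • (i • dirDeriv w F p + j • dirDeriv w' F p))) =O[𝓝 0] fun e => e ^ 2 := by
  refine (taylor_along_line hΩ hF hp (i • w + j • w') 2).congr_left fun e => ?_
  simp [Finset.sum_range_succ, dirDeriv]

theorem taylor_three (hΩ : IsOpen Ω) (hF : ContDiffOn ℝ ∞ F Ω) (hp : p ∈ Ω) (i j : ℝ) :
    (fun e : ℝ => F (p + e • (i • w + j • w')) -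
      (F p + e • (i • dirDeriv w F p + j • dirDeriv w' F p) +
        (e ^ 2 / 2) • (i ^ 2 • dirDeriv w (dirDeriv w F) p +
          (2 * i * j) • dirDeriv w' (dirDeriv w F) p +
          j ^ 2 • dirDeriv w' (dirDeriv w' F) p))) =O[𝓝 0] fun e => e ^ 3 := by
  refine (taylor_along_line hΩ hF hp (i • w + j • w') 3).congr_left fun e => ?_
  simp only [Finset.sum_range_succ, Finset.sum_range_zero,
    dirDeriv_iterate_smul_add_smul_dir hΩ hF w w' i j _ hp]
  simp [Finset.Nat.antidiagonal_succ, Nat.factorial, ← Nat.cast_smul_eq_nsmul ℝ]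
  module

theorem taylor_five (hΩ : IsOpen Ω) (hF : ContDiffOn ℝ ∞ F Ω) (hp : p ∈ Ω) (i j : ℝ) :
    (fun e : ℝ => F (p + e • (i • w + j • w')) -
      (F p + e • (i • dirDeriv w F p + j • dirDeriv w' F p) +
        (e ^ 2 / 2) • (i ^ 2 • dirDeriv w (dirDeriv w F) p +
          (2 * i * j) • dirDeriv w' (dirDeriv w F) p +
          j ^ 2 • dirDeriv w' (dirDeriv w' F) p) +
        (e ^ 3 / 6) • (i ^ 3 • dirDeriv w (dirDeriv w (dirDeriv w F)) p +
          (3 * i ^ 2 * j) • dirDeriv w' (dirDeriv w (dirDeriv w F)) p +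
          (3 * i * j ^ 2) • dirDeriv w' (dirDeriv w' (dirDeriv w F)) p +
          j ^ 3 • dirDeriv w' (dirDeriv w' (dirDeriv w' F)) p) +
        (e ^ 4 / 24) • (i ^ 4 • dirDeriv w (dirDeriv w (dirDeriv w (dirDeriv w F))) p +
          (4 * i ^ 3 * j) • dirDeriv w' (dirDeriv w (dirDeriv w (dirDeriv w F))) p +
          (6 * i ^ 2 * j ^ 2) • dirDeriv w' (dirDeriv w' (dirDeriv w (dirDeriv w F))) p +
          (4 * i * j ^ 3) • dirDeriv w' (dirDeriv w' (dirDeriv w' (dirDeriv w F))) p +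
          j ^ 4 • dirDeriv w' (dirDeriv w' (dirDeriv w' (dirDeriv w' F))) p))) =O[𝓝 0]
      fun e => e ^ 5 := by
  refine (taylor_along_line hΩ hF hp (i • w + j • w') 5).congr_left fun e => ?_
  have hch : Nat.choose 3 2 = 3 ∧ Nat.choose 4 2 = 6 ∧ Nat.choose 4 3 = 4 := by decide
  simp only [Finset.sum_range_succ, Finset.sum_range_zero,
    dirDeriv_iterate_smul_add_smul_dir hΩ hF w w' i j _ hp]
  simp [Finset.Nat.antidiagonal_succ, Nat.factorial, ← Nat.cast_smul_eq_nsmul ℝ, hch]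
  module

end Jets

section Perturbation

/-- A map of class `C²` differs from its linearization at a point near `p` by a second order
error, uniformly in the point. -/
theorem exists_norm_sub_sub_fderiv_le {V G : Type*} [NormedAddCommGroup V] [NormedSpace ℝ V]
    [NormedAddCommGroup G] [NormedSpace ℝ G] {F : V → G} {p : V} (hF : ContDiffAt ℝ 2 F p)
    (d : V) :
    ∃ K : ℝ, 0 ≤ K ∧ ∀ᶠ e in 𝓝[>] (0 : ℝ), ∀ z ∈ closedBall (0 : V) (e ^ 2),
      ∀ w ∈ closedBall (0 : V) (e ^ 2),
        ‖F (p + e • d + z) - F (p + e • d + w) - fderiv ℝ F (p + e • d) (z - w)‖ ≤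
          K * e ^ 2 * ‖z - w‖ := by
  obtain ⟨K, s, hs, hK⟩ := (hF.fderiv_right (m := 1) (by norm_num)).exists_lipschitzOnWith
  have hdiff : ∀ᶠ q in 𝓝 p, DifferentiableAt ℝ F q :=
    (hF.eventually (by norm_num)).mono fun q hq => hq.differentiableAt (by norm_num)
  obtain ⟨r, hr, hball⟩ := Metric.eventually_nhds_iff_ball.1 (hdiff.and hs)
  have hcont : Continuous fun e : ℝ => ‖e • d‖ + e ^ 2 := by fun_prop
  have hsmall : ∀ᶠ e in 𝓝 (0 : ℝ), ‖e • d‖ + e ^ 2 < r :=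
    hcont.continuousAt.eventually_lt continuousAt_const (by simpa)
  refine ⟨K, K.2, nhdsWithin_le_nhds (hsmall.mono fun e he z hz w hw => ?_)⟩
  have hmem {q : V} (hq : q ∈ closedBall (p + e • d) (e ^ 2)) : q ∈ ball p r := by
    rw [mem_closedBall, dist_eq_norm] at hq
    rw [mem_ball, dist_eq_norm]
    calc ‖q - p‖ = ‖(q - (p + e • d)) + e • d‖ := by congr 1; abel
      _ ≤ ‖q - (p + e • d)‖ + ‖e • d‖ := norm_add_le _ _
      _ < r := by linarith
  have hcenter : p + e • d ∈ closedBall (p + e • d) (e ^ 2) :=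
    mem_closedBall_self (by positivity)
  have hadd {y : V} (hy : y ∈ closedBall (0 : V) (e ^ 2)) :
      p + e • d + y ∈ closedBall (p + e • d) (e ^ 2) := by
    simpa [dist_eq_norm] using hy
  have := (convex_closedBall (p + e • d) (e ^ 2)).norm_image_sub_le_of_norm_fderiv_le'
    (f := F) (φ := fderiv ℝ F (p + e • d)) (C := K * e ^ 2)
    (fun q hq => (hball q (hmem hq)).1)
    (fun q hq => ?_) (hadd hw) (hadd hz)
  · simpa [add_sub_add_left_eq_sub] using this
  · refine (hK.norm_sub_le (hball q (hmem hq)).2 (hball _ (hmem hcenter)).2).trans ?_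
    rw [mem_closedBall, dist_eq_norm] at hq
    gcongr

theorem det3_increment {f : ℝ × ℝ → E3} {p d : ℝ × ℝ} {P Q : ℝ → E3} {α β : ℝ}
    (hf : ContDiffAt ℝ 2 f p)
    (hP : P =O[𝓝 0] fun e => e ^ 1) (hQ : Q =O[𝓝 0] fun e => e ^ 1)
    (hU : (fun e => e * det3 (P e) (Q e) (pd1 f (p + e • d)) - e ^ 4 * α) =O[𝓝 0]
      fun e => e ^ 5)
    (hV : (fun e => e * det3 (P e) (Q e) (pd2 f (p + e • d)) - e ^ 4 * β) =O[𝓝 0]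
      fun e => e ^ 5) :
    ∃ K : ℝ, ∀ᶠ e in 𝓝[>] (0 : ℝ), ∀ z ∈ closedBall (0 : ℝ × ℝ) (e ^ 2),
      ∀ w ∈ closedBall (0 : ℝ × ℝ) (e ^ 2),
        |det3 (P e) (Q e) (f (p + e • d + z) - f (p + e • d + w)) -
          e ^ 3 * (α * (z - w).1 + β * (z - w).2)| ≤ K * e ^ 4 * ‖z - w‖ := by
  obtain ⟨K, hK0, hK⟩ := exists_norm_sub_sub_fderiv_le hf d
  obtain ⟨c₁, hc₁, h₁⟩ := hP.exists_nonneg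
  obtain ⟨c₂, hc₂, h₂⟩ := hQ.exists_nonneg
  obtain ⟨c₃, hc₃, h₃⟩ := hU.exists_nonneg
  obtain ⟨c₄, hc₄, h₄⟩ := hV.exists_nonneg
  refine ⟨6 * (c₁ * c₂ * K) + c₃ + c₄, ?_⟩
  filter_upwards [hK, nhdsWithin_le_nhds h₁.bound, nhdsWithin_le_nhds h₂.bound,
    nhdsWithin_le_nhds h₃.bound, nhdsWithin_le_nhds h₄.bound, self_mem_nhdsWithin]
    with e hK h₁ h₂ h₃ h₄ he z hz w hw
  have he0 : 0 < e := he
  have div_e {u γ c : ℝ} (h : ‖e * u - e ^ 4 * γ‖ ≤ c * ‖e ^ 5‖) :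
      |u - e ^ 3 * γ| ≤ c * e ^ 4 := by
    rw [show e * u - e ^ 4 * γ = e * (u - e ^ 3 * γ) by ring, norm_mul, Real.norm_eq_abs,
      Real.norm_eq_abs, Real.norm_eq_abs, abs_of_pos he0, abs_of_pos (pow_pos he0 5)] at h
    refine le_of_mul_le_mul_left (h.trans_eq ?_) he0
    ring
  replace h₃ := div_e h₃
  replace h₄ := div_e h₄
  rw [pow_one, Real.norm_of_nonneg he0.le] at h₁ h₂
  set Δ := z - w with hΔ
  set R := f (p + e • d + z) - f (p + e • d + w) - fderiv ℝ f (p + e • d) Δ with hR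
  have hΔsplit : fderiv ℝ f (p + e • d) Δ =
      Δ.1 • pd1 f (p + e • d) + Δ.2 • pd2 f (p + e • d) := by
    rw [pd1, pd2, ← map_smul, ← map_smul, ← map_add]
    simp
  have hdecomp : f (p + e • d + z) - f (p + e • d + w) =
      R + (Δ.1 • pd1 f (p + e • d) + Δ.2 • pd2 f (p + e • d)) := by
    rw [hR, hΔsplit]; abel
  have hRb : |det3 (P e) (Q e) R| ≤ 6 * (c₁ * c₂ * K) * e ^ 4 * ‖Δ‖ := by
    calc |det3 (P e) (Q e) R| ≤ 6 * (‖P e‖ * ‖Q e‖ * ‖R‖) := abs_det3_le _ _ _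
      _ ≤ 6 * ((c₁ * e) * (c₂ * e) * (K * e ^ 2 * ‖Δ‖)) := by
        gcongr
        exact hK z hz w hw
      _ = _ := by ring
  have hΔ1 : |Δ.1| ≤ ‖Δ‖ := norm_fst_le Δ
  have hΔ2 : |Δ.2| ≤ ‖Δ‖ := norm_snd_le Δ
  rw [hdecomp, det3_add_right, det3_add_right, det3_smul_right, det3_smul_right]
  set u := det3 (P e) (Q e) (pd1 f (p + e • d))
  set v := det3 (P e) (Q e) (pd2 f (p + e • d))
  calc _ = |det3 (P e) (Q e) R + (u - e ^ 3 * α) * Δ.1 + (v - e ^ 3 * β) * Δ.2| := by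
        congr 1; ring
    _ ≤ |det3 (P e) (Q e) R| + |u - e ^ 3 * α| * |Δ.1| + |v - e ^ 3 * β| * |Δ.2| := by
        rw [← abs_mul, ← abs_mul]; exact abs_add_three _ _ _
    _ ≤ 6 * (c₁ * c₂ * K) * e ^ 4 * ‖Δ‖ + c₃ * e ^ 4 * ‖Δ‖ + c₄ * e ^ 4 * ‖Δ‖ := by
        gcongr
    _ = _ := by ring

/-- Two functions of two variables whose sum and difference dominate one variable each have a
small common zero. -/
theorem exists_common_zero {G₁ G₂ : ℝ → ℝ × ℝ → ℝ} {L N κ : ℝ} (hL : L ≠ 0) (hN : N ≠ 0)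
    (h₁ : ∃ K : ℝ, ∀ᶠ e in 𝓝[>] (0 : ℝ), ∀ z ∈ closedBall (0 : ℝ × ℝ) (e ^ 2),
      ∀ w ∈ closedBall (0 : ℝ × ℝ) (e ^ 2), |G₁ e z - G₁ e w -
        e ^ 3 * (L / 2 * (z - w).1 + N / 2 * (z - w).2)| ≤ K * e ^ 4 * ‖z - w‖)
    (h₂ : ∃ K : ℝ, ∀ᶠ e in 𝓝[>] (0 : ℝ), ∀ z ∈ closedBall (0 : ℝ × ℝ) (e ^ 2),
      ∀ w ∈ closedBall (0 : ℝ × ℝ) (e ^ 2), |G₂ e z - G₂ e w -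
        e ^ 3 * (-(L / 2) * (z - w).1 + N / 2 * (z - w).2)| ≤ K * e ^ 4 * ‖z - w‖)
    (hG₁ : (fun e => G₁ e 0 - e ^ 6 * κ) =O[𝓝 0] fun e => e ^ 7)
    (hG₂ : (fun e => G₂ e 0 + e ^ 6 * κ) =O[𝓝 0] fun e => e ^ 7) :
    ∃ C > (0 : ℝ), ∀ᶠ e in 𝓝[>] (0 : ℝ), ∃ z : ℝ × ℝ,
      |z.1| ≤ C * e ^ 3 ∧ |z.2| ≤ C * e ^ 4 ∧ G₁ e z = 0 ∧ G₂ e z = 0 := by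
  obtain ⟨K₁, h₁⟩ := h₁
  obtain ⟨K₂, h₂⟩ := h₂
  have hsum : (fun e => G₁ e 0 + G₂ e 0) =O[𝓝 0] fun e => e ^ 7 :=
    (hG₁.add hG₂).congr_left fun e => by ring
  have hdiff : (fun e => G₁ e 0 - G₂ e 0) =O[𝓝 0] fun e => e ^ 6 := by
    have h := ((hG₁.sub hG₂).trans (isBigO_pow_pow_nhds_zero (Nat.le_succ 6))).add
      ((isBigO_refl (fun e : ℝ => e ^ 6) (𝓝 0)).const_mul_left (2 * κ))
    exact h.congr_left fun e => by ring
  obtain ⟨c₁, hc₁⟩ := hdiff.bound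
  obtain ⟨c₂, hc₂⟩ := hsum.bound
  have hL' := abs_pos.2 hL
  have hN' := abs_pos.2 hN
  obtain ⟨K, hK1, hKL, hKN, hKc₁, hKc₂⟩ : ∃ K : ℝ, 1 ≤ K ∧ (K₁ + K₂) / |L| ≤ K ∧
      (K₁ + K₂) / |N| ≤ K ∧ c₁ / |L| ≤ K ∧ c₂ / |N| ≤ K := by
    refine ⟨max 1 (max (max ((K₁ + K₂) / |L|) ((K₁ + K₂) / |N|))
      (max (c₁ / |L|) (c₂ / |N|))), ?_⟩
    simp
  rw [div_le_iff₀ hL'] at hKL hKc₁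
  rw [div_le_iff₀ hN'] at hKN hKc₂
  have quot {e M u m : ℝ} (he : 0 < e) (hM : M ≠ 0) (hm : |u| ≤ K * |M| * (e ^ 3 * m)) :
      |u / (e ^ 3 * M)| ≤ K * m := by
    rw [abs_div, abs_mul, abs_of_pos (pow_pos he 3), div_le_iff₀ (by positivity)]
    exact hm.trans_eq (by ring)
  have key := exists_zero_of_approximates_id (K := K) hK1
    (Ψ := fun e z => ((G₁ e z - G₂ e z) / (e ^ 3 * L), (G₁ e z + G₂ e z) / (e ^ 3 * N)))
    ?_ ?_ ?_
  · refine ⟨3 * K ^ 2, by positivity, ?_⟩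
    filter_upwards [key, self_mem_nhdsWithin] with e ⟨z, _, hz1, hz2, hz⟩ he
    have he0 : (0 : ℝ) < e := he
    rw [Prod.mk_eq_zero, div_eq_zero_iff, div_eq_zero_iff] at hz
    have e1 := hz.1.resolve_right (by positivity)
    have e2 := hz.2.resolve_right (by positivity)
    exact ⟨z, hz1, hz2, by linarith, by linarith⟩
  · filter_upwards [h₁, h₂, self_mem_nhdsWithin] with e h₁ h₂ he z hz w hw
    have he0 : (0 : ℝ) < e := he
    have a₁ := abs_le.1 (h₁ z hz w hw)
    have a₂ := abs_le.1 (h₂ z hz w hw)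
    have hn : 0 ≤ e ^ 4 * ‖z - w‖ := by positivity
    have b₁ := mul_le_mul_of_nonneg_right hKL hn
    have b₂ := mul_le_mul_of_nonneg_right hKN hn
    rw [Prod.norm_def]
    refine max_le ?_ ?_
    · have : ((G₁ e z - G₂ e z) / (e ^ 3 * L) - (G₁ e w - G₂ e w) / (e ^ 3 * L) - (z - w).1) =
          (G₁ e z - G₁ e w - (G₂ e z - G₂ e w) - e ^ 3 * L * (z - w).1) / (e ^ 3 * L) := by
        field_simp
        ring
      simp only [Prod.fst_sub] at this a₁ a₂ ⊢
      rw [Real.norm_eq_abs, this, mul_assoc K]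
      refine quot he0 hL (abs_le.2 ?_)
      constructor <;> linarith
    · have : ((G₁ e z + G₂ e z) / (e ^ 3 * N) - (G₁ e w + G₂ e w) / (e ^ 3 * N) - (z - w).2) =
          (G₁ e z - G₁ e w + (G₂ e z - G₂ e w) - e ^ 3 * N * (z - w).2) / (e ^ 3 * N) := by
        field_simp
        ring
      simp only [Prod.snd_sub] at this a₁ a₂ ⊢
      rw [Real.norm_eq_abs, this, mul_assoc K]
      refine quot he0 hN (abs_le.2 ?_)
      constructor <;> linarith
  · filter_upwards [nhdsWithin_le_nhds hc₁, self_mem_nhdsWithin] with e hc₁ he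
    have he0 : (0 : ℝ) < e := he
    refine quot he0 hL (hc₁.trans ?_)
    rw [Real.norm_of_nonneg (by positivity), ← pow_add]
    gcongr
  · filter_upwards [nhdsWithin_le_nhds hc₂, self_mem_nhdsWithin] with e hc₂ he
    have he0 : (0 : ℝ) < e := he
    refine quot he0 hN (hc₂.trans ?_)
    rw [Real.norm_of_nonneg (by positivity), ← pow_add]
    gcongr

end Perturbation

/-- The third vertex of the two adjacent quadrilaterals of a net whose Taylor coefficients are
those of a conjugate net can be moved slightly so that both quadrilaterals become planar. -/
theorem exists_planarizing_shift {f : ℝ × ℝ → E3} {P₀ d : ℝ × ℝ} {g : ℝ → ℝ → ℝ → E3}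
    {O x y p q t z s s' f11 f21 f12 f31 f22 f13 : E3} {a b a₁ b₁ a₂ b₂ a₃ b₃ a₄ b₄ a₅ b₅ c : ℝ}
    (hf : ContDiffAt ℝ 2 f P₀) (hg : ∀ e, g 1 1 e = f (P₀ + e • d))
    (hp : det3 x y p ≠ 0) (hq : det3 x y q ≠ 0)
    (h1 : ∀ i j, (fun e => g i j e - (O + e • (i • x + j • y))) =O[𝓝 0] fun e => e ^ 2)
    (h2 : ∀ i j, (fun e => g i j e - (O + e • (i • x + j • y) +
      (e ^ 2 / 2) • (i ^ 2 • p + (2 * i * j) • f11 + j ^ 2 • q))) =O[𝓝 0] fun e => e ^ 3)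
    (h4 : ∀ i j, (fun e => g i j e - (O + e • (i • x + j • y) +
      (e ^ 2 / 2) • (i ^ 2 • p + (2 * i * j) • f11 + j ^ 2 • q) +
      (e ^ 3 / 6) • (i ^ 3 • t + (3 * i ^ 2 * j) • f21 + (3 * i * j ^ 2) • f12 + j ^ 3 • z) +
      (e ^ 4 / 24) • (i ^ 4 • s + (4 * i ^ 3 * j) • f31 + (6 * i ^ 2 * j ^ 2) • f22 +
        (4 * i * j ^ 3) • f13 + j ^ 4 • s'))) =O[𝓝 0] fun e => e ^ 5)
    (hU : (fun e : ℝ => pd1 f (P₀ + e • d) - (x + e • ((1 : ℝ) • p + (1 : ℝ) • f11))) =O[𝓝 0]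
      fun e => e ^ 2)
    (hV : (fun e : ℝ => pd2 f (P₀ + e • d) - (y + e • ((1 : ℝ) • f11 + (1 : ℝ) • q))) =O[𝓝 0]
      fun e => e ^ 2)
    (hf11 : f11 = a • x + b • y) (hf21 : f21 = a₁ • x + b₁ • y + a • p)
    (hf12 : f12 = a₂ • x + b₂ • y + b • q)
    (hf31 : f31 = a₃ • x + b₃ • y + (2 * a₁ - a * b) • p + a • t)
    (hf22 : f22 = a₄ • x + b₄ • y + a₂ • p + b₁ • q)
    (hf13 : f13 = a₅ • x + b₅ • y + c • q + b • z) :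
    ∃ C > (0 : ℝ), ∀ᶠ e in 𝓝[>] (0 : ℝ), ∃ δ : ℝ × ℝ, |δ.1| ≤ C * e ^ 3 ∧ |δ.2| ≤ C * e ^ 4 ∧
      det3 (g 1 0 e - g 0 0 e) (g 0 1 e - g 0 0 e) (f (P₀ + e • d + δ) - g 0 0 e) = 0 ∧
      det3 (g 2 0 e - g 1 0 e) (g 2 1 e - g 2 0 e) (f (P₀ + e • d + δ) - g 2 0 e) = 0 := by
  simp only [one_smul] at hU hV
  have hO {R : ℝ → E3} {r : E3} (h : (fun e => R e - e • r) =O[𝓝 0] fun e => e ^ 2) :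
      R =O[𝓝 0] fun e => e ^ 1 := isBigO_pow_of_sub_smul (ρ := r) (by simpa using h)
  have hU' : (fun e => e * det3 (g 2 0 e - g 1 0 e) (g 2 1 e - g 2 0 e) (pd1 f (P₀ + e • d)) -
      e ^ 4 * -(det3 x y p / 2)) =O[𝓝 0] fun e => e ^ 5 :=
    (det3_tangent_fst_right h1 h2 hU hf11).congr_left fun e => by ring
  refine exists_common_zero (L := det3 x y p) (N := det3 x y q) (κ := det3 x y
      ((a₁ / 12 - a * b / 6) • p + (c / 6 - b₂ / 4) • q)) hp hq
    (G₁ := fun e δ =>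
      det3 (g 1 0 e - g 0 0 e) (g 0 1 e - g 0 0 e) (f (P₀ + e • d + δ) - g 0 0 e))
    (G₂ := fun e δ =>
      det3 (g 2 0 e - g 1 0 e) (g 2 1 e - g 2 0 e) (f (P₀ + e • d + δ) - g 2 0 e)) ?_ ?_ ?_ ?_
  · simpa only [← det3_sub_right, sub_sub_sub_cancel_right] using
      det3_increment hf (hO (isBigO_sub_fst (j := 0) h1 (zero_add 1).symm))
        (hO (isBigO_sub_snd (i := 0) h1)) (det3_tangent_fst_left h1 h2 hU hf11)
        (det3_tangent_snd_left h1 h2 hV hf11)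
  · simpa only [← det3_sub_right, sub_sub_sub_cancel_right] using
      det3_increment hf (hO (isBigO_sub_fst (j := 0) h1 one_add_one_eq_two.symm))
        (hO (isBigO_sub_snd (i := 2) h1)) hU' (det3_tangent_snd_right h1 h2 hV hf11)
  · refine (det3_defect_left h1 h4 hf11 hf21 hf12 hf31 hf22 hf13).congr_left fun e => ?_
    rw [hg, add_zero]
  · refine (det3_defect_right h1 h4 hf11 hf21 hf12 hf31 hf22 hf13).congr_left fun e => ?_
    rw [hg, add_zero]

/-- For a smooth conjugate net without parabolic points, with `A = f(u₀,v₀)`,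
`B = f(u₀+ε,v₀)`, `C = f(u₀,v₀+ε)`, `E = f(u₀+2ε,v₀)`, `F = f(u₀+2ε,v₀+ε)`, one can find
shifts `δu = O(ε³)`, `δv = O(ε⁴)` such that `M = f(u₀+ε+δu, v₀+ε+δv)` makes both
quadrilaterals `A B M C` and `B M F E` planar. -/
theorem exists_point_making_two_adjacent_quads_planar
    (Ω : Set (ℝ × ℝ)) (hΩ : IsOpen Ω) (f : ℝ × ℝ → E3) (a b : ℝ × ℝ → ℝ)
    (hf : ContDiffOn ℝ (⊤ : ℕ∞) f Ω) (ha : ContDiffOn ℝ (⊤ : ℕ∞) a Ω) (hb : ContDiffOn ℝ (⊤ : ℕ∞) b Ω)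
    (hindep : ∀ p ∈ Ω, LinearIndependent ℝ ![pd1 f p, pd2 f p])
    (hconj : ∀ p ∈ Ω, pd2 (pd1 f) p = a p • pd1 f p + b p • pd2 f p)
    (hnonpar : ∀ p ∈ Ω,
      dot3 (cross3 (pd1 (pd1 f) p) (pd1 f p)) (pd2 f p) ≠ 0 ∧
      dot3 (cross3 (pd2 (pd2 f) p) (pd1 f p)) (pd2 f p) ≠ 0)
    (u₀ v₀ : ℝ) (h₀ : (u₀, v₀) ∈ Ω) :
    ∃ C₀ > (0 : ℝ), ∃ ε₀ > (0 : ℝ), ∀ ε : ℝ, 0 < ε → ε < ε₀ →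
      ∃ δu δv : ℝ, |δu| ≤ C₀ * ε ^ 3 ∧ |δv| ≤ C₀ * ε ^ 4 ∧
        Coplanar ℝ ({f (u₀, v₀), f (u₀ + ε, v₀), f (u₀ + ε + δu, v₀ + ε + δv),
          f (u₀, v₀ + ε)} : Set E3) ∧
        Coplanar ℝ ({f (u₀ + ε, v₀), f (u₀ + ε + δu, v₀ + ε + δv), f (u₀ + 2 * ε, v₀ + ε),
          f (u₀ + 2 * ε, v₀)} : Set E3) := by
  have hp : det3 (pd1 f (u₀, v₀)) (pd2 f (u₀, v₀)) (pd1 (pd1 f) (u₀, v₀)) ≠ 0 := by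
    rw [← det3_rotate]; exact (hnonpar _ h₀).1
  have hq : det3 (pd1 f (u₀, v₀)) (pd2 f (u₀, v₀)) (pd2 (pd2 f) (u₀, v₀)) ≠ 0 := by
    rw [← det3_rotate]; exact (hnonpar _ h₀).2
  obtain ⟨a₁, b₁, a₂, b₂, a₃, b₃, a₄, b₄, a₅, b₅, c, h21, h12, h31, h22, h13⟩ :=
    exists_mixed_derivative_coefficients hΩ hf ha hb hconj h₀
  have hU := taylor_two (w := (1, 0)) (w' := (0, 1)) hΩ (hf.dirDeriv hΩ (1, 0)) h₀ 1 1
  have hV := taylor_two (w := (1, 0)) (w' := (0, 1)) hΩ (hf.dirDeriv hΩ (0, 1)) h₀ 1 1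
  rw [dirDeriv_comm hΩ hf _ _ h₀] at hV
  have hf2 : ContDiffAt ℝ 2 f (u₀, v₀) := (hf.contDiffAt (hΩ.mem_nhds h₀)).of_le
    (by simpa using WithTop.coe_le_coe.2 (le_top (a := (2 : ℕ∞))))
  obtain ⟨C, hC, hev⟩ := exists_planarizing_shift
    (g := fun i j e => f ((u₀, v₀) + e • (i • (1, 0) + j • (0, 1)))) hf2 (fun _ => rfl) hp hq
    (taylor_two hΩ hf h₀) (taylor_three hΩ hf h₀) (taylor_five hΩ hf h₀) hU hV
    (hconj _ h₀) h21 h12 h31 h22 h13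
  obtain ⟨ε₀, hε₀, hsub⟩ := mem_nhdsGT_iff_exists_Ioo_subset.1 hev
  refine ⟨C, hC, ε₀, hε₀, fun ε hε hεε₀ => ?_⟩
  obtain ⟨δ, hδ1, hδ2, hl, hr⟩ := hsub ⟨hε, hεε₀⟩
  refine ⟨δ.1, δ.2, hδ1, hδ2, ?_, ?_⟩
  · have h := coplanar_of_det3_eq_zero hl
    rw [Set.pair_comm (f (u₀ + ε + _, _))]
    simpa [Prod.add_def] using h
  · rw [← neg_sub (f _) (f _), det3_neg_left, neg_eq_zero] at hr
    have h := coplanar_of_det3_eq_zero hr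
    have hperm (X Y Z W : E3) : ({X, Y, Z, W} : Set E3) = {W, X, Z, Y} := by
      ext; simp only [Set.mem_insert_iff, Set.mem_singleton_iff]; tauto
    rw [hperm]
    simpa [Prod.add_def, mul_comm ε] using h

end
end

section
/- Let f : Ω → ℝ³ be a smooth conjugate net without parabolic points and (u₀, v₀) ∈ Ω. Set A = f(u₀, v₀), C = f(u₀, v₀ + ε), E = f(u₀ + 2ε, v₀), F = f(u₀ + 2ε, v₀ + ε). Then for every K₀ > 0 there exist constants C₀ > 0 and ε₀ > 0 such that for all 0 < ε < ε₀ and all real numbers β_u, β_v with |β_u| ≤ K₀ ε² and |β_v| ≤ K₀ ε³, setting B₁ = f(u₀ + ε + β_u, v₀ + β_v), there exist real numbers δu, δv such that the point M = f(u₀ + ε + δu, v₀ + ε + δv) makes the quadrilaterals A, B₁, M, C and B₁, M, F, E each planar (each quadruple lies in a common affine plane), and moreover |δu − β_u| ≤ C₀ ε³ and |δv + β_v| ≤ C₀ (ε·|β_v| + ε²·|β_u| + ε⁴). -/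
open Metric

noncomputable section

/-- The triple product `(x × y) · z`. -/
def tripleProd (x y z : E3) : ℝ := dot3 (cross3 x y) z

lemma tripleProd_eq (x y z : E3) :
    tripleProd x y z = (x 1 * y 2 - x 2 * y 1) * z 0 + (x 2 * y 0 - x 0 * y 2) * z 1
      + (x 0 * y 1 - x 1 * y 0) * z 2 := by
  simp [tripleProd, dot3, cross3]

lemma abs_tripleProd_le (x y z : E3) : |tripleProd x y z| ≤ 6 * (‖x‖ * ‖y‖ * ‖z‖) := by
  have key : ∀ i j k : Fin 3, |x i * y j * z k| ≤ ‖x‖ * ‖y‖ * ‖z‖ := fun i j k => by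
    rw [abs_mul, abs_mul]
    gcongr
    exacts [PiLp.norm_apply_le x i, PiLp.norm_apply_le y j, PiLp.norm_apply_le z k]
  have := fun i j k => abs_le.1 (key i j k)
  rw [tripleProd_eq, abs_le]
  constructor <;>
  linarith [this 1 2 0, this 2 1 0, this 2 0 1, this 0 2 1, this 0 1 2, this 1 0 2]

lemma abs_tripleProd_le_of_norm_le {x y z : E3} {α β γ : ℝ} (hx : ‖x‖ ≤ α) (hy : ‖y‖ ≤ β)
    (hz : ‖z‖ ≤ γ) : |tripleProd x y z| ≤ 6 * (α * β * γ) := by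
  refine (abs_tripleProd_le x y z).trans ?_
  have := (norm_nonneg x).trans hx
  have := (norm_nonneg y).trans hy
  gcongr

/-- Four points are coplanar as soon as the triple product of their differences vanishes. -/
lemma coplanar_of_tripleProd_eq_zero {A B C M : E3}
    (h : tripleProd (B - A) (C - A) (M - B - C + A) = 0) :
    Coplanar ℝ ({A, B, M, C} : Set E3) := by
  have hdet : tripleProd (B - A) (C - A) (M - A) = 0 := by
    rw [← h]; simp only [tripleProd_eq, PiLp.sub_apply, PiLp.add_apply]; ring
  rw [coplanar_iff_finrank_le_two,
    vectorSpan_eq_span_vsub_set_right ℝ (Set.mem_insert A {B, M, C})]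
  have hspan : Submodule.span ℝ ((fun x => x -ᵥ A) '' ({A, B, M, C} : Set E3)) =
      Submodule.span ℝ (Set.range ![B - A, C - A, M - A]) := by
    simp only [Set.image_insert_eq, Set.image_singleton, vsub_eq_sub, sub_self,
      Submodule.span_insert_zero, Matrix.range_cons, Matrix.range_empty, Set.union_empty,
      Set.singleton_union]
    congr 2
    exact Set.pair_comm _ _
  rw [hspan]
  have hli : ¬ LinearIndependent ℝ ![B - A, C - A, M - A] := by
    intro hl
    have hl' : LinearIndependent ℝ (Matrix.of
        ![(B - A).ofLp, (C - A).ofLp, (M - A).ofLp]).row := by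
      have hrow : (Matrix.of ![(B - A).ofLp, (C - A).ofLp, (M - A).ofLp]).row =
          (WithLp.linearEquiv 2 ℝ (Fin 3 → ℝ)).toLinearMap ∘ ![B - A, C - A, M - A] := by
        ext i j
        fin_cases i <;> rfl
      rw [hrow]
      exact hl.map' _ (LinearEquiv.ker _)
    rw [Matrix.linearIndependent_rows_iff_isUnit, Matrix.isUnit_iff_isUnit_det,
      isUnit_iff_ne_zero] at hl'
    apply hl'
    rw [← hdet, Matrix.det_fin_three, tripleProd_eq]
    simp
    ring
  have hle := finrank_range_le_card (R := ℝ) ![B - A, C - A, M - A]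
  have hne := mt linearIndependent_iff_card_eq_finrank_span.2 hli
  exact Nat.le_of_lt_succ (lt_of_le_of_ne hle (Ne.symm hne))

/-- Expansion of the triple product of three vectors given to relative order three. -/
lemma exists_tripleProd_expansion_bound (K : ℝ) (hK : 0 ≤ K) :
    ∃ C > 0, ∀ ε : ℝ, 0 ≤ ε → ε ≤ 1 → ∀ b₁ b₂ b₃ b₄ c₁ c₂ c₃ c₄ m₁ m₂ m₃ m₄ : E3,
      ‖b₁‖ ≤ K → ‖b₂‖ ≤ K → ‖b₃‖ ≤ K → ‖b₄‖ ≤ K → ‖c₁‖ ≤ K → ‖c₂‖ ≤ K → ‖c₃‖ ≤ K → ‖c₄‖ ≤ K →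
      ‖m₁‖ ≤ K → ‖m₂‖ ≤ K → ‖m₃‖ ≤ K → ‖m₄‖ ≤ K →
      |tripleProd (b₁ + ε • b₂ + ε ^ 2 • b₃ + ε ^ 3 • b₄) (c₁ + ε • c₂ + ε ^ 2 • c₃ + ε ^ 3 • c₄)
          (m₁ + ε • m₂ + ε ^ 2 • m₃ + ε ^ 3 • m₄)
        - (tripleProd b₁ c₁ m₁
          + ε * (tripleProd b₂ c₁ m₁ + tripleProd b₁ c₂ m₁ + tripleProd b₁ c₁ m₂)
          + ε ^ 2 * (tripleProd b₃ c₁ m₁ + tripleProd b₁ c₃ m₁ + tripleProd b₁ c₁ m₃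
            + tripleProd b₂ c₂ m₁ + tripleProd b₂ c₁ m₂ + tripleProd b₁ c₂ m₂))| ≤ C * ε ^ 3 := by
  refine ⟨20 * (6 * (2 * K * (2 * K) * (2 * K))) + 1, by positivity, ?_⟩
  intro ε h0 h1 b₁ b₂ b₃ b₄ c₁ c₂ c₃ c₄ m₁ m₂ m₃ m₄ hb1 hb2 hb3 hb4 hc1 hc2 hc3 hc4 hm1 hm2 hm3 hm4
  have tail : ∀ x y : E3, ‖x‖ ≤ K → ‖y‖ ≤ K → ‖x + ε • y‖ ≤ 2 * K := fun x y hx hy => by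
    refine (norm_add_le _ _).trans ?_
    rw [norm_smul, Real.norm_of_nonneg h0]
    nlinarith [norm_nonneg y]
  have up : ∀ x : E3, ‖x‖ ≤ K → ‖x‖ ≤ 2 * K := fun x hx => by linarith
  have bd : ∀ n : ℕ, ∀ x y z : E3, ‖x‖ ≤ 2 * K → ‖y‖ ≤ 2 * K → ‖z‖ ≤ 2 * K →
      |ε ^ n * tripleProd x y z| ≤ 6 * (2 * K * (2 * K) * (2 * K)) := fun n x y z hx hy hz => by
    rw [abs_mul, abs_of_nonneg (pow_nonneg h0 n)]
    have := abs_tripleProd_le_of_norm_le hx hy hz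
    nlinarith [pow_le_one₀ (n := n) h0 h1, pow_nonneg h0 n, abs_nonneg (tripleProd x y z)]
  have b1 := up _ hb1; have b2 := up _ hb2; have b3 := tail _ _ hb3 hb4; have b4 := up _ hb4
  have c1 := up _ hc1; have c2 := up _ hc2; have c3 := tail _ _ hc3 hc4; have c4 := up _ hc4
  have m1 := up _ hm1; have m2 := up _ hm2; have m3 := tail _ _ hm3 hm4; have m4 := up _ hm4
  have expand : tripleProd (b₁ + ε • b₂ + ε ^ 2 • b₃ + ε ^ 3 • b₄)
      (c₁ + ε • c₂ + ε ^ 2 • c₃ + ε ^ 3 • c₄) (m₁ + ε • m₂ + ε ^ 2 • m₃ + ε ^ 3 • m₄)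
        - (tripleProd b₁ c₁ m₁
          + ε * (tripleProd b₂ c₁ m₁ + tripleProd b₁ c₂ m₁ + tripleProd b₁ c₁ m₂)
          + ε ^ 2 * (tripleProd b₃ c₁ m₁ + tripleProd b₁ c₃ m₁ + tripleProd b₁ c₁ m₃
            + tripleProd b₂ c₂ m₁ + tripleProd b₂ c₁ m₂ + tripleProd b₁ c₂ m₂)) =
      ε ^ 3 * (ε ^ 0 * tripleProd b₄ c₁ m₁ + ε ^ 0 * tripleProd b₁ c₄ m₁
        + ε ^ 0 * tripleProd b₁ c₁ m₄
        + ε ^ 0 * tripleProd b₂ c₂ m₂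
        + ε ^ 0 * tripleProd (b₃ + ε • b₄) c₂ m₁ + ε ^ 0 * tripleProd (b₃ + ε • b₄) c₁ m₂
        + ε ^ 0 * tripleProd b₂ (c₃ + ε • c₄) m₁ + ε ^ 0 * tripleProd b₁ (c₃ + ε • c₄) m₂
        + ε ^ 0 * tripleProd b₂ c₁ (m₃ + ε • m₄) + ε ^ 0 * tripleProd b₁ c₂ (m₃ + ε • m₄)
        + ε ^ 1 * tripleProd (b₃ + ε • b₄) (c₃ + ε • c₄) m₁
        + ε ^ 1 * tripleProd (b₃ + ε • b₄) c₁ (m₃ + ε • m₄)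
        + ε ^ 1 * tripleProd b₁ (c₃ + ε • c₄) (m₃ + ε • m₄)
        + ε ^ 1 * tripleProd (b₃ + ε • b₄) c₂ m₂ + ε ^ 1 * tripleProd b₂ (c₃ + ε • c₄) m₂
        + ε ^ 1 * tripleProd b₂ c₂ (m₃ + ε • m₄)
        + ε ^ 2 * tripleProd (b₃ + ε • b₄) (c₃ + ε • c₄) m₂
        + ε ^ 2 * tripleProd (b₃ + ε • b₄) c₂ (m₃ + ε • m₄)
        + ε ^ 2 * tripleProd b₂ (c₃ + ε • c₄) (m₃ + ε • m₄)
        + ε ^ 3 * tripleProd (b₃ + ε • b₄) (c₃ + ε • c₄) (m₃ + ε • m₄)) := by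
    simp only [tripleProd_eq, PiLp.add_apply, PiLp.smul_apply, smul_eq_mul]
    ring
  rw [expand, abs_mul, abs_of_nonneg (pow_nonneg h0 3), mul_comm]
  refine mul_le_mul_of_nonneg_right ?_ (pow_nonneg h0 3)
  rw [abs_le]
  have := fun n x y z hx hy hz => abs_le.1 (bd n x y z hx hy hz)
  constructor <;>
  linarith [this 0 _ _ _ b4 c1 m1, this 0 _ _ _ b1 c4 m1, this 0 _ _ _ b1 c1 m4,
    this 0 _ _ _ b2 c2 m2, this 0 _ _ _ b3 c2 m1, this 0 _ _ _ b3 c1 m2, this 0 _ _ _ b2 c3 m1,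
    this 0 _ _ _ b1 c3 m2, this 0 _ _ _ b2 c1 m3, this 0 _ _ _ b1 c2 m3, this 1 _ _ _ b3 c3 m1,
    this 1 _ _ _ b3 c1 m3, this 1 _ _ _ b1 c3 m3, this 1 _ _ _ b3 c2 m2, this 1 _ _ _ b2 c3 m2,
    this 1 _ _ _ b2 c2 m3, this 2 _ _ _ b3 c3 m2, this 2 _ _ _ b3 c2 m3, this 2 _ _ _ b2 c3 m3,
    this 3 _ _ _ b3 c3 m3]

section Partials

variable {Ω : Set (ℝ × ℝ)} {f : ℝ × ℝ → E3}

lemma ContDiffOn.fderiv_apply_const {E : Type*} [NormedAddCommGroup E] [NormedSpace ℝ E]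
    {g : ℝ × ℝ → E} (hΩ : IsOpen Ω) (hg : ContDiffOn ℝ (⊤ : ℕ∞) g Ω) (w : ℝ × ℝ) :
    ContDiffOn ℝ (⊤ : ℕ∞) (fun p => fderiv ℝ g p w) Ω :=
  (hg.fderiv_of_isOpen hΩ (by simp)).clm_apply contDiffOn_const

lemma contDiffOn_pd1 (hΩ : IsOpen Ω) (hf : ContDiffOn ℝ (⊤ : ℕ∞) f Ω) :
    ContDiffOn ℝ (⊤ : ℕ∞) (pd1 f) Ω := hf.fderiv_apply_const hΩ _

lemma contDiffOn_pd2 (hΩ : IsOpen Ω) (hf : ContDiffOn ℝ (⊤ : ℕ∞) f Ω) :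
    ContDiffOn ℝ (⊤ : ℕ∞) (pd2 f) Ω := hf.fderiv_apply_const hΩ _

lemma ContDiffOn.differentiableAt_of_isOpen_s11 {E : Type*} [NormedAddCommGroup E] [NormedSpace ℝ E]
    {g : ℝ × ℝ → E} (hΩ : IsOpen Ω) (hg : ContDiffOn ℝ (⊤ : ℕ∞) g Ω) {p : ℝ × ℝ} (hp : p ∈ Ω) :
    DifferentiableAt ℝ g p :=
  (hg.contDiffAt (hΩ.mem_nhds hp)).differentiableAt (by simp)

lemma fderiv_apply_eq_pd (f : ℝ × ℝ → E3) (p w : ℝ × ℝ) :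
    fderiv ℝ f p w = w.1 • pd1 f p + w.2 • pd2 f p := by
  have : w = w.1 • ((1 : ℝ), (0 : ℝ)) + w.2 • ((0 : ℝ), (1 : ℝ)) := by ext <;> simp
  conv_lhs => rw [this]
  rw [map_add, map_smul, map_smul]
  rfl

lemma pd1_congr (hΩ : IsOpen Ω) {g : ℝ × ℝ → E3} (h : ∀ p ∈ Ω, f p = g p) {p : ℝ × ℝ}
    (hp : p ∈ Ω) : pd1 f p = pd1 g p := by
  rw [pd1, pd1, Filter.EventuallyEq.fderiv_eq]
  filter_upwards [hΩ.mem_nhds hp] with q hq using h q hq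

lemma pd2_congr (hΩ : IsOpen Ω) {g : ℝ × ℝ → E3} (h : ∀ p ∈ Ω, f p = g p) {p : ℝ × ℝ}
    (hp : p ∈ Ω) : pd2 f p = pd2 g p := by
  rw [pd2, pd2, Filter.EventuallyEq.fderiv_eq]
  filter_upwards [hΩ.mem_nhds hp] with q hq using h q hq

lemma pd2_pd1_comm (hΩ : IsOpen Ω) (hf : ContDiffOn ℝ (⊤ : ℕ∞) f Ω) {p : ℝ × ℝ} (hp : p ∈ Ω) :
    pd2 (pd1 f) p = pd1 (pd2 f) p := by
  have hd : DifferentiableAt ℝ (fderiv ℝ f) p :=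
    (hf.fderiv_of_isOpen hΩ (m := (⊤ : ℕ∞)) (by simp)).differentiableAt_of_isOpen_s11 hΩ hp
  have hsymm : IsSymmSndFDerivAt ℝ f p :=
    (hf.contDiffAt (hΩ.mem_nhds hp)).isSymmSndFDerivAt (by
      simp only [minSmoothness_of_isRCLikeNormedField]; exact WithTop.coe_le_coe.2 le_top)
  have happ : ∀ w w' : ℝ × ℝ, fderiv ℝ (fun q => fderiv ℝ f q w) p w' =
      fderiv ℝ (fderiv ℝ f) p w' w := fun w w' => by
    rw [fderiv_clm_apply hd (differentiableAt_const w)]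
    simp
  change fderiv ℝ (fun q => fderiv ℝ f q (1, 0)) p (0, 1) =
    fderiv ℝ (fun q => fderiv ℝ f q (0, 1)) p (1, 0)
  rw [happ, happ, hsymm.eq]

/-- The mixed partial derivative `∂₁ⁱ ∂₂ʲ f`. -/
def mixedPartial (f : ℝ × ℝ → E3) (i j : ℕ) : ℝ × ℝ → E3 := pd1^[i] (pd2^[j] f)

lemma pd1_mixedPartial (f : ℝ × ℝ → E3) (i j : ℕ) :
    pd1 (mixedPartial f i j) = mixedPartial f (i + 1) j :=
  (Function.iterate_succ_apply' pd1 i _).symm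

lemma contDiffOn_mixedPartial (hΩ : IsOpen Ω) (hf : ContDiffOn ℝ (⊤ : ℕ∞) f Ω) (i j : ℕ) :
    ContDiffOn ℝ (⊤ : ℕ∞) (mixedPartial f i j) Ω := by
  induction i with
  | zero =>
    induction j with
    | zero => exact hf
    | succ j ih =>
      have := contDiffOn_pd2 hΩ ih
      rwa [mixedPartial, Function.iterate_zero, id, ← Function.iterate_succ_apply' pd2] at this
  | succ i ih =>
    rw [← pd1_mixedPartial]
    exact contDiffOn_pd1 hΩ ih

lemma pd2_mixedPartial (hΩ : IsOpen Ω) (hf : ContDiffOn ℝ (⊤ : ℕ∞) f Ω) (i j : ℕ) :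
    ∀ p ∈ Ω, pd2 (mixedPartial f i j) p = mixedPartial f i (j + 1) p := by
  induction i with
  | zero => exact fun p _ => congrFun (Function.iterate_succ_apply' pd2 j f).symm p
  | succ i ih =>
    intro p hp
    rw [← pd1_mixedPartial, ← pd1_mixedPartial,
      pd2_pd1_comm hΩ (contDiffOn_mixedPartial hΩ hf i j) hp]
    exact pd1_congr hΩ ih hp

lemma pd1_smul {a : ℝ × ℝ → ℝ} {p : ℝ × ℝ} (ha : DifferentiableAt ℝ a p)
    (hf : DifferentiableAt ℝ f p) :
    pd1 (fun q => a q • f q) p = fderiv ℝ a p (1, 0) • f p + a p • pd1 f p := by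
  rw [pd1, pd1, fderiv_fun_smul ha hf]
  simp [add_comm]

lemma pd2_smul {a : ℝ × ℝ → ℝ} {p : ℝ × ℝ} (ha : DifferentiableAt ℝ a p)
    (hf : DifferentiableAt ℝ f p) :
    pd2 (fun q => a q • f q) p = fderiv ℝ a p (0, 1) • f p + a p • pd2 f p := by
  rw [pd2, pd2, fderiv_fun_smul ha hf]
  simp [add_comm]

lemma pd1_add {g : ℝ × ℝ → E3} {p : ℝ × ℝ} (hf : DifferentiableAt ℝ f p)
    (hg : DifferentiableAt ℝ g p) : pd1 (fun q => f q + g q) p = pd1 f p + pd1 g p := by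
  rw [pd1, fderiv_fun_add hf hg]; rfl

lemma pd2_add {g : ℝ × ℝ → E3} {p : ℝ × ℝ} (hf : DifferentiableAt ℝ f p)
    (hg : DifferentiableAt ℝ g p) : pd2 (fun q => f q + g q) p = pd2 f p + pd2 g p := by
  rw [pd2, fderiv_fun_add hf hg]; rfl

/-- Linear relations between the mixed partial derivatives of a conjugate net up to order four,
with `x = ∂₁ a` and `y = ∂₂ b`. -/
structure ConjugateRelations (e : ℕ → ℕ → E3) (a b x y : ℝ) : Prop where
  e11 : e 1 1 = a • e 1 0 + b • e 0 1
  higher : ∃ α₁ β₁ α₂ β₂ κ₁ κ₂ l₁ l₂ n₁ n₂ : ℝ,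
    α₁ = x + a * b ∧ β₂ = y + a * b ∧
    e 2 1 = α₁ • e 1 0 + β₁ • e 0 1 + a • e 2 0 ∧
    e 1 2 = α₂ • e 1 0 + β₂ • e 0 1 + b • e 0 2 ∧
    e 2 2 = κ₁ • e 1 0 + κ₂ • e 0 1 + α₂ • e 2 0 + β₁ • e 0 2 ∧
    e 3 1 = l₁ • e 1 0 + l₂ • e 0 1 + (α₁ + x) • e 2 0 + a • e 3 0 ∧
    e 1 3 = n₁ • e 1 0 + n₂ • e 0 1 + (β₂ + y) • e 0 2 + b • e 0 3

lemma conjugateRelations {a b : ℝ × ℝ → ℝ} (hΩ : IsOpen Ω) (hf : ContDiffOn ℝ (⊤ : ℕ∞) f Ω)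
    (ha : ContDiffOn ℝ (⊤ : ℕ∞) a Ω) (hb : ContDiffOn ℝ (⊤ : ℕ∞) b Ω)
    (hconj : ∀ p ∈ Ω, pd2 (pd1 f) p = a p • pd1 f p + b p • pd2 f p) {p : ℝ × ℝ} (hp : p ∈ Ω) :
    ConjugateRelations (fun i j => mixedPartial f i j p) (a p) (b p)
      (fderiv ℝ a p (1, 0)) (fderiv ℝ b p (0, 1)) := by
  have hD : ∀ i j, ∀ q ∈ Ω, DifferentiableAt ℝ (mixedPartial f i j) q := fun i j q hq =>
    (contDiffOn_mixedPartial hΩ hf i j).differentiableAt_of_isOpen_s11 hΩ hq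
  have dif : ∀ {c : ℝ × ℝ → ℝ}, ContDiffOn ℝ (⊤ : ℕ∞) c Ω → ∀ q ∈ Ω, DifferentiableAt ℝ c q :=
    fun hc q hq => hc.differentiableAt_of_isOpen_s11 hΩ hq
  have two1 : ∀ {c d : ℝ × ℝ → ℝ} (i j k l : ℕ), ContDiffOn ℝ (⊤ : ℕ∞) c Ω →
      ContDiffOn ℝ (⊤ : ℕ∞) d Ω → ∀ q ∈ Ω,
      pd1 (fun q => c q • mixedPartial f i j q + d q • mixedPartial f k l q) q =
        fderiv ℝ c q (1, 0) • mixedPartial f i j q + c q • mixedPartial f (i + 1) j q +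
        (fderiv ℝ d q (1, 0) • mixedPartial f k l q + d q • mixedPartial f (k + 1) l q) := by
    intro c d i j k l hc hd q hq
    rw [pd1_add ((dif hc q hq).fun_smul (hD _ _ q hq)) ((dif hd q hq).fun_smul (hD _ _ q hq)),
      pd1_smul (dif hc q hq) (hD _ _ q hq), pd1_smul (dif hd q hq) (hD _ _ q hq),
      pd1_mixedPartial, pd1_mixedPartial]
  have two2 : ∀ {c d : ℝ × ℝ → ℝ} (i j k l : ℕ), ContDiffOn ℝ (⊤ : ℕ∞) c Ω →
      ContDiffOn ℝ (⊤ : ℕ∞) d Ω → ∀ q ∈ Ω,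
      pd2 (fun q => c q • mixedPartial f i j q + d q • mixedPartial f k l q) q =
        fderiv ℝ c q (0, 1) • mixedPartial f i j q + c q • mixedPartial f i (j + 1) q +
        (fderiv ℝ d q (0, 1) • mixedPartial f k l q + d q • mixedPartial f k (l + 1) q) := by
    intro c d i j k l hc hd q hq
    rw [pd2_add ((dif hc q hq).fun_smul (hD _ _ q hq)) ((dif hd q hq).fun_smul (hD _ _ q hq)),
      pd2_smul (dif hc q hq) (hD _ _ q hq), pd2_smul (dif hd q hq) (hD _ _ q hq),
      pd2_mixedPartial hΩ hf _ _ q hq, pd2_mixedPartial hΩ hf _ _ q hq]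
  have r11 : ∀ q ∈ Ω, mixedPartial f 1 1 q =
      a q • mixedPartial f 1 0 q + b q • mixedPartial f 0 1 q := fun q hq => by
    rw [← pd2_mixedPartial hΩ hf 1 0 q hq]
    exact hconj q hq
  have hau := ha.fderiv_apply_const hΩ (1, 0)
  have hav := ha.fderiv_apply_const hΩ (0, 1)
  have hbu := hb.fderiv_apply_const hΩ (1, 0)
  have hbv := hb.fderiv_apply_const hΩ (0, 1)
  obtain ⟨α₁, hα₁⟩ : ∃ c, c = fun q => fderiv ℝ a q (1, 0) + a q * b q := ⟨_, rfl⟩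
  obtain ⟨β₁, hβ₁⟩ : ∃ c, c = fun q => fderiv ℝ b q (1, 0) + b q * b q := ⟨_, rfl⟩
  obtain ⟨α₂, hα₂⟩ : ∃ c, c = fun q => fderiv ℝ a q (0, 1) + a q * a q := ⟨_, rfl⟩
  obtain ⟨β₂, hβ₂⟩ : ∃ c, c = fun q => fderiv ℝ b q (0, 1) + a q * b q := ⟨_, rfl⟩
  have sα₁ : ContDiffOn ℝ (⊤ : ℕ∞) α₁ Ω := hα₁ ▸ hau.add (ha.mul hb)
  have sβ₁ : ContDiffOn ℝ (⊤ : ℕ∞) β₁ Ω := hβ₁ ▸ hbu.add (hb.mul hb)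
  have sα₂ : ContDiffOn ℝ (⊤ : ℕ∞) α₂ Ω := hα₂ ▸ hav.add (ha.mul ha)
  have sβ₂ : ContDiffOn ℝ (⊤ : ℕ∞) β₂ Ω := hβ₂ ▸ hbv.add (ha.mul hb)
  have r21 : ∀ q ∈ Ω, mixedPartial f 2 1 q =
      (α₁ q • mixedPartial f 1 0 q + β₁ q • mixedPartial f 0 1 q) +
      a q • mixedPartial f 2 0 q := fun q hq => by
    rw [← pd1_mixedPartial, pd1_congr hΩ r11 hq, two1 1 0 0 1 ha hb q hq, r11 q hq, hα₁, hβ₁]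
    module
  have r12 : ∀ q ∈ Ω, mixedPartial f 1 2 q =
      (α₂ q • mixedPartial f 1 0 q + β₂ q • mixedPartial f 0 1 q) +
      b q • mixedPartial f 0 2 q := fun q hq => by
    rw [← pd2_mixedPartial hΩ hf _ _ q hq, pd2_congr hΩ r11 hq, two2 1 0 0 1 ha hb q hq, r11 q hq,
      hα₂, hβ₂]
    module
  have dif2 : ∀ {c d : ℝ × ℝ → ℝ} (i j k l : ℕ), ContDiffOn ℝ (⊤ : ℕ∞) c Ω →
      ContDiffOn ℝ (⊤ : ℕ∞) d Ω → ∀ q ∈ Ω, DifferentiableAt ℝ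
        (fun q => c q • mixedPartial f i j q + d q • mixedPartial f k l q) q :=
    fun i j k l hc hd q hq =>
      ((dif hc q hq).fun_smul (hD _ _ q hq)).fun_add ((dif hd q hq).fun_smul (hD _ _ q hq))
  refine ⟨r11 p hp, α₁ p, β₁ p, α₂ p, β₂ p,
    fderiv ℝ α₁ p (0, 1) + 2 * a p * α₁ p, fderiv ℝ β₁ p (0, 1) + b p * α₁ p + a p * β₁ p,
    fderiv ℝ α₁ p (1, 0) + a p * β₁ p, fderiv ℝ β₁ p (1, 0) + b p * β₁ p,
    fderiv ℝ α₂ p (0, 1) + a p * α₂ p, fderiv ℝ β₂ p (0, 1) + b p * α₂ p,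
    by rw [hα₁], by rw [hβ₂], r21 p hp, r12 p hp, ?_, ?_, ?_⟩
  · rw [← pd2_mixedPartial hΩ hf _ _ p hp, pd2_congr hΩ r21 hp,
      pd2_add (dif2 1 0 0 1 sα₁ sβ₁ p hp) ((dif ha p hp).fun_smul (hD 2 0 p hp)),
      two2 1 0 0 1 sα₁ sβ₁ p hp, pd2_smul (dif ha p hp) (hD 2 0 p hp),
      pd2_mixedPartial hΩ hf _ _ p hp, r11 p hp, r21 p hp, hα₂]
    module
  · rw [← pd1_mixedPartial, pd1_congr hΩ r21 hp,
      pd1_add (dif2 1 0 0 1 sα₁ sβ₁ p hp) ((dif ha p hp).fun_smul (hD 2 0 p hp)),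
      two1 1 0 0 1 sα₁ sβ₁ p hp, pd1_smul (dif ha p hp) (hD 2 0 p hp),
      pd1_mixedPartial, r11 p hp]
    module
  · rw [← pd2_mixedPartial hΩ hf _ _ p hp, pd2_congr hΩ r12 hp,
      pd2_add (dif2 1 0 0 1 sα₂ sβ₂ p hp) ((dif hb p hp).fun_smul (hD 0 2 p hp)),
      two2 1 0 0 1 sα₂ sβ₂ p hp, pd2_smul (dif hb p hp) (hD 0 2 p hp),
      pd2_mixedPartial hΩ hf _ _ p hp, r11 p hp]
    module

end Partials

section Taylor

variable {Ω : Set (ℝ × ℝ)} {f : ℝ × ℝ → E3}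

/-- Taylor's formula with a crude remainder, for a sequence of successive derivatives. -/
lemma norm_sub_sum_taylor_le {E : Type*} [NormedAddCommGroup E] [NormedSpace ℝ E] (n : ℕ) {C : ℝ} :
    ∀ φ : ℕ → ℝ → E, (∀ m, ∀ t ∈ Set.Icc (0 : ℝ) 1, HasDerivAt (φ m) (φ (m + 1) t) t) →
    (∀ t ∈ Set.Icc (0 : ℝ) 1, ‖φ n t‖ ≤ C) → ∀ t ∈ Set.Icc (0 : ℝ) 1,
    ‖φ 0 t - ∑ m ∈ Finset.range n, (t ^ m / m.factorial) • φ m 0‖ ≤ C := by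
  induction n with
  | zero => intro φ _ hC t ht; simpa using hC t ht
  | succ n ih =>
    intro φ hφ hC t ht
    have hder : ∀ s ∈ Set.Icc (0 : ℝ) 1, HasDerivAt
        (fun s => φ 0 s - ∑ m ∈ Finset.range (n + 1), (s ^ m / m.factorial) • φ m 0)
        (φ 1 s - ∑ m ∈ Finset.range n, (s ^ m / m.factorial) • φ (m + 1) 0) s := by
      intro s hs
      refine (hφ 0 s hs).sub ?_
      simp only [Finset.sum_range_succ']
      have hsum : HasDerivAt
          (fun s : ℝ => ∑ m ∈ Finset.range n, (s ^ (m + 1) / (m + 1).factorial) • φ (m + 1) 0)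
          (∑ m ∈ Finset.range n, (s ^ m / m.factorial) • φ (m + 1) 0) s := by
        refine HasDerivAt.fun_sum fun m _ => ?_
        have := ((hasDerivAt_pow (m + 1) s).div_const ((m + 1).factorial : ℝ)).smul_const
          (φ (m + 1) 0)
        convert this using 2
        rw [Nat.factorial_succ, Nat.add_sub_cancel]
        push_cast
        field_simp
      simpa using hsum.add_const (φ 0 0)
    have hbd := ih (fun m => φ (m + 1)) (fun m => hφ (m + 1)) hC
    have hC0 : 0 ≤ C := (norm_nonneg _).trans (hC 0 (by simp))
    have := norm_image_sub_le_of_norm_deriv_le_segment'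
      (fun s hs => (hder s hs).hasDerivWithinAt)
      (fun s hs => hbd s (Set.Ico_subset_Icc_self hs)) t ht
    simp only [Finset.sum_range_succ', zero_pow (Nat.succ_ne_zero _), zero_div, zero_smul,
      Finset.sum_const_zero, pow_zero, Nat.factorial_zero, Nat.cast_one, div_one, one_smul,
      zero_add, sub_self, sub_zero] at this ⊢
    exact this.trans (mul_le_of_le_one_right hC0 ht.2)

/-- The value `(h ∂₁ + k ∂₂)ᵐ` of a directional derivative, in terms of the values `c i j` of the
mixed partial derivatives `∂₁ⁱ ∂₂ʲ`. -/
def directionalPow (h k : ℝ) : ℕ → (ℕ → ℕ → E3) → E3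
  | 0, c => c 0 0
  | m + 1, c => h • directionalPow h k m (fun i j => c (i + 1) j) +
      k • directionalPow h k m (fun i j => c i (j + 1))

lemma norm_directionalPow_le (h k : ℝ) {K : ℝ} (m : ℕ) : ∀ c : ℕ → ℕ → E3,
    (∀ i j, i + j = m → ‖c i j‖ ≤ K) → ‖directionalPow h k m c‖ ≤ K * (|h| + |k|) ^ m := by
  induction m with
  | zero => intro c hc; simpa [directionalPow] using hc 0 0 rfl
  | succ m ih =>
    intro c hc
    rw [directionalPow]
    refine (norm_add_le _ _).trans ?_
    rw [norm_smul, norm_smul, Real.norm_eq_abs, Real.norm_eq_abs]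
    have h1 := ih (fun i j => c (i + 1) j) fun i j hij => hc _ _ (by omega)
    have h2 := ih (fun i j => c i (j + 1)) fun i j hij => hc _ _ (by omega)
    calc _ ≤ |h| * (K * (|h| + |k|) ^ m) + |k| * (K * (|h| + |k|) ^ m) := by gcongr
      _ = _ := by ring

lemma hasDerivAt_directionalPow (h k t : ℝ) (m : ℕ) : ∀ c : ℝ → ℕ → ℕ → E3,
    (∀ i j, HasDerivAt (fun s => c s i j) (h • c t (i + 1) j + k • c t i (j + 1)) t) →
    HasDerivAt (fun s => directionalPow h k m (c s)) (directionalPow h k (m + 1) (c t)) t := by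
  induction m with
  | zero => intro c hc; exact hc 0 0
  | succ m ih =>
    intro c hc
    exact ((ih (fun s i j => c s (i + 1) j) fun i j => hc _ _).const_smul h).add
      ((ih (fun s i j => c s i (j + 1)) fun i j => hc _ _).const_smul k)

lemma hasDerivAt_mixedPartial (hΩ : IsOpen Ω) (hf : ContDiffOn ℝ (⊤ : ℕ∞) f Ω) (i j : ℕ)
    {p : ℝ × ℝ} {h k t : ℝ} (hp : p + t • (h, k) ∈ Ω) :
    HasDerivAt (fun s : ℝ => mixedPartial f i j (p + s • (h, k)))
      (h • mixedPartial f (i + 1) j (p + t • (h, k)) +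
        k • mixedPartial f i (j + 1) (p + t • (h, k))) t := by
  have hd := ((contDiffOn_mixedPartial hΩ hf i j).differentiableAt_of_isOpen_s11 hΩ hp).hasFDerivAt
  have hl : HasDerivAt (fun s : ℝ => p + s • (h, k)) (h, k) t := by
    simpa using ((hasDerivAt_id t).smul_const (h, k)).const_add p
  have := hd.comp_hasDerivAt t hl
  rwa [fderiv_apply_eq_pd, pd1_mixedPartial, pd2_mixedPartial hΩ hf _ _ _ hp] at this

lemma add_mem_closedBall_of_abs_le {p₀ p : ℝ × ℝ} {R r h k : ℝ} (hp : p ∈ closedBall p₀ R)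
    (hh : |h| ≤ r) (hk : |k| ≤ r) : p + (h, k) ∈ closedBall p₀ (R + r) := by
  rw [mem_closedBall, dist_eq_norm] at *
  have : ‖((h, k) : ℝ × ℝ)‖ ≤ r := by simpa [Prod.norm_def] using ⟨hh, hk⟩
  calc ‖p + (h, k) - p₀‖ = ‖(p - p₀) + (h, k)‖ := by congr 1; abel
    _ ≤ _ := norm_add_le_of_le hp this

lemma exists_norm_le_mixedPartial (hΩ : IsOpen Ω) (hf : ContDiffOn ℝ (⊤ : ℕ∞) f Ω)
    {p₀ : ℝ × ℝ} {R : ℝ} (hR : closedBall p₀ R ⊆ Ω) (n : ℕ) :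
    ∃ K > 0, ∀ i j, i ≤ n → j ≤ n → ∀ p ∈ closedBall p₀ R, ‖mixedPartial f i j p‖ ≤ K := by
  have hK : ∀ i j, ∃ K, ∀ p ∈ closedBall p₀ R, ‖mixedPartial f i j p‖ ≤ K := fun i j =>
    (isCompact_closedBall p₀ R).exists_bound_of_continuousOn
      ((contDiffOn_mixedPartial hΩ hf i j).continuousOn.mono hR)
  choose K hK using hK
  refine ⟨1 + ∑ i ∈ Finset.range (n + 1), ∑ j ∈ Finset.range (n + 1), |K i j|, by positivity,
    fun i j hi hj p hp => (hK i j p hp).trans ?_⟩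
  have h1 : |K i j| ≤ ∑ j ∈ Finset.range (n + 1), |K i j| :=
    Finset.single_le_sum (f := fun j => |K i j|) (fun _ _ => abs_nonneg _)
      (Finset.mem_range.2 (by omega))
  have h2 : ∑ j ∈ Finset.range (n + 1), |K i j| ≤
      ∑ i ∈ Finset.range (n + 1), ∑ j ∈ Finset.range (n + 1), |K i j| :=
    Finset.single_le_sum (f := fun i => ∑ j ∈ Finset.range (n + 1), |K i j|)
      (fun _ _ => by positivity) (Finset.mem_range.2 (by omega))
  linarith [le_abs_self (K i j)]

/-- Taylor's formula for mixed partial derivatives, uniformly in the base point. -/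
lemma exists_taylor_bound (hΩ : IsOpen Ω) (hf : ContDiffOn ℝ (⊤ : ℕ∞) f Ω)
    {p₀ : ℝ × ℝ} {R : ℝ} (hR : closedBall p₀ (R + R) ⊆ Ω) (i j n : ℕ) :
    ∃ C > 0, ∀ p ∈ closedBall p₀ R, ∀ h k : ℝ, |h| ≤ R → |k| ≤ R →
      ‖mixedPartial f i j (p + (h, k)) - ∑ m ∈ Finset.range n, (1 / (m.factorial : ℝ)) •
        directionalPow h k m (fun i' j' => mixedPartial f (i + i') (j + j') p)‖ ≤
      C * (|h| + |k|) ^ n := by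
  obtain ⟨K, hK0, hK⟩ := exists_norm_le_mixedPartial hΩ hf hR (i + j + n)
  refine ⟨K, hK0, fun p hp h k hh hk => ?_⟩
  have hseg : ∀ t ∈ Set.Icc (0 : ℝ) 1, p + t • (h, k) ∈ closedBall p₀ (R + R) := by
    intro t ht
    have small : ∀ x : ℝ, |x| ≤ R → |t * x| ≤ R := fun x hx => by
      rw [abs_mul, abs_of_nonneg ht.1]
      exact (mul_le_of_le_one_left (abs_nonneg x) ht.2).trans hx
    exact add_mem_closedBall_of_abs_le hp (small h hh) (small k hk)
  have := norm_sub_sum_taylor_le n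
    (fun m t => directionalPow h k m
      (fun i' j' => mixedPartial f (i + i') (j + j') (p + t • (h, k))))
    (fun m t ht => hasDerivAt_directionalPow h k t m _ fun i' j' =>
      hasDerivAt_mixedPartial hΩ hf _ _ (hR (hseg t ht)))
    (fun t ht => norm_directionalPow_le h k n _ fun i' j' hij =>
      hK _ _ (by omega) (by omega) _ (hseg t ht)) 1 (by simp)
  simpa [directionalPow] using this

end Taylor

section LocalEstimates

variable {Ω : Set (ℝ × ℝ)} {f : ℝ × ℝ → E3}

lemma exists_first_order_bound (hΩ : IsOpen Ω) (hf : ContDiffOn ℝ (⊤ : ℕ∞) f Ω)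
    {p₀ : ℝ × ℝ} {R : ℝ} (hR : closedBall p₀ (R + R) ⊆ Ω) (i j : ℕ) :
    ∃ C > 0, ∀ p ∈ closedBall p₀ R, ∀ ε : ℝ, 0 ≤ ε → ε ≤ 1 → 3 * ε ≤ R → ∀ h k : ℝ,
      |h| ≤ 2 * ε → |k| ≤ 2 * ε → ∀ z ∈ closedBall (p + (h, k)) (ε ^ 2),
      ‖mixedPartial f i j z - (mixedPartial f i j p + h • mixedPartial f (i + 1) j p
        + k • mixedPartial f i (j + 1) p)‖ ≤ C * ε ^ 2 := by
  obtain ⟨C, hC0, hC⟩ := exists_taylor_bound hΩ hf hR i j 2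
  obtain ⟨K, hK0, hK⟩ := exists_norm_le_mixedPartial hΩ hf hR (i + j + 1)
  refine ⟨C * 36 + 2 * K, by positivity, fun p hp ε h0 h1 hεR h k hh hk z hz => ?_⟩
  have hpR : p ∈ closedBall p₀ (R + R) := closedBall_subset_closedBall (by linarith) hp
  obtain ⟨x, y, hx, hy, rfl⟩ : ∃ x y : ℝ, |x| ≤ ε ^ 2 ∧ |y| ≤ ε ^ 2 ∧ z = p + (h + x, k + y) := by
    refine ⟨(z - (p + (h, k))).1, (z - (p + (h, k))).2, ?_, ?_, ?_⟩
    · exact (norm_fst_le (z - (p + (h, k)))).trans (mem_closedBall_iff_norm.1 hz)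
    · exact (norm_snd_le (z - (p + (h, k)))).trans (mem_closedBall_iff_norm.1 hz)
    · ext <;> simp <;> ring
  have hε2 : ε ^ 2 ≤ ε := by nlinarith
  have hhx : |h + x| ≤ 3 * ε := (abs_add_le h x).trans (by linarith)
  have hky : |k + y| ≤ 3 * ε := (abs_add_le k y).trans (by linarith)
  have hT := hC p hp (h + x) (k + y) (hhx.trans hεR) (hky.trans hεR)
  simp only [Finset.sum_range_succ, Finset.sum_range_zero, directionalPow, Nat.factorial,
    zero_add, add_zero, Nat.cast_one, div_one, one_smul, mul_one] at hT
  have h36 : (|h + x| + |k + y|) ^ 2 ≤ 36 * ε ^ 2 := by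
    have : |h + x| + |k + y| ≤ 6 * ε := by linarith
    calc (|h + x| + |k + y|) ^ 2 ≤ (6 * ε) ^ 2 := by gcongr
      _ = _ := by ring
  have hxy : ‖x • mixedPartial f (i + 1) j p + y • mixedPartial f i (j + 1) p‖ ≤
      2 * K * ε ^ 2 := by
    refine (norm_add_le _ _).trans ?_
    rw [norm_smul, norm_smul, Real.norm_eq_abs, Real.norm_eq_abs]
    have := mul_le_mul hx (hK (i + 1) j (by omega) (by omega) p hpR) (norm_nonneg _) (by positivity)
    have := mul_le_mul hy (hK i (j + 1) (by omega) (by omega) p hpR) (norm_nonneg _) (by positivity)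
    linarith
  calc _ = ‖(mixedPartial f i j (p + (h + x, k + y)) - (mixedPartial f i j p +
        ((h + x) • mixedPartial f (i + 1) j p + (k + y) • mixedPartial f i (j + 1) p))) +
        (x • mixedPartial f (i + 1) j p + y • mixedPartial f i (j + 1) p)‖ := by
        congr 1; module
    _ ≤ C * (|h + x| + |k + y|) ^ 2 + 2 * K * ε ^ 2 := norm_add_le_of_le hT hxy
    _ ≤ C * (36 * ε ^ 2) + 2 * K * ε ^ 2 := by gcongr
    _ = _ := by ring

/-- Differences of values of `f` near `p + (h, k)`, with the partial derivatives replaced by their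
first order expansions at `p`. -/
lemma exists_difference_bound (hΩ : IsOpen Ω) (hf : ContDiffOn ℝ (⊤ : ℕ∞) f Ω)
    {p₀ : ℝ × ℝ} {R : ℝ} (hR : closedBall p₀ (R + R) ⊆ Ω) :
    ∃ C > 0, ∀ p ∈ closedBall p₀ R, ∀ ε : ℝ, 0 ≤ ε → ε ≤ 1 → 3 * ε ≤ R → ∀ h k : ℝ,
      |h| ≤ 2 * ε → |k| ≤ 2 * ε → ∀ z ∈ closedBall (p + (h, k)) (ε ^ 2),
      ∀ z' ∈ closedBall (p + (h, k)) (ε ^ 2),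
      ‖f z' - f z - ((z' - z).1 • (mixedPartial f 1 0 p + h • mixedPartial f 2 0 p
          + k • mixedPartial f 1 1 p) +
        (z' - z).2 • (mixedPartial f 0 1 p + h • mixedPartial f 1 1 p
          + k • mixedPartial f 0 2 p))‖ ≤ C * ε ^ 2 * ‖z' - z‖ := by
  obtain ⟨C₁, hC₁0, hC₁⟩ := exists_first_order_bound hΩ hf hR 1 0
  obtain ⟨C₂, hC₂0, hC₂⟩ := exists_first_order_bound hΩ hf hR 0 1
  refine ⟨C₁ + C₂, by positivity, fun p hp ε h0 h1 hεR h k hh hk z hz z' hz' => ?_⟩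
  have hε2 : ε ^ 2 ≤ ε := by nlinarith
  have hsub : closedBall (p + (h, k)) (ε ^ 2) ⊆ Ω := by
    refine (closedBall_subset_closedBall' ?_).trans hR
    have := mem_closedBall.1 (add_mem_closedBall_of_abs_le hp hh hk)
    linarith
  set w₁ := mixedPartial f 1 0 p + h • mixedPartial f 2 0 p + k • mixedPartial f 1 1 p
  set w₂ := mixedPartial f 0 1 p + h • mixedPartial f 1 1 p + k • mixedPartial f 0 2 p
  refine Convex.norm_image_sub_le_of_norm_fderiv_le' (𝕜 := ℝ)
    (φ := (ContinuousLinearMap.fst ℝ ℝ ℝ).smulRight w₁ +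
      (ContinuousLinearMap.snd ℝ ℝ ℝ).smulRight w₂)
    (fun ζ hζ => hf.differentiableAt_of_isOpen_s11 hΩ (hsub hζ)) (fun ζ hζ => ?_)
    (convex_closedBall _ _) hz hz'
  refine ContinuousLinearMap.opNorm_le_bound _ (by positivity) fun w => ?_
  have e₁ := hC₁ p hp ε h0 h1 hεR h k hh hk ζ hζ
  have e₂ := hC₂ p hp ε h0 h1 hεR h k hh hk ζ hζ
  have : (fderiv ℝ f ζ - ((ContinuousLinearMap.fst ℝ ℝ ℝ).smulRight w₁ +
      (ContinuousLinearMap.snd ℝ ℝ ℝ).smulRight w₂)) w =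
      w.1 • (mixedPartial f 1 0 ζ - w₁) + w.2 • (mixedPartial f 0 1 ζ - w₂) := by
    simp only [sub_apply, fderiv_apply_eq_pd, add_apply,
      ContinuousLinearMap.smulRight_apply, ContinuousLinearMap.coe_fst',
      ContinuousLinearMap.coe_snd']
    change w.1 • mixedPartial f 1 0 ζ + w.2 • mixedPartial f 0 1 ζ - _ = _
    module
  rw [this]
  refine (norm_add_le _ _).trans ?_
  rw [norm_smul, norm_smul]
  have n₁ := norm_fst_le w
  have n₂ := norm_snd_le w
  calc _ ≤ ‖w‖ * (C₁ * ε ^ 2) + ‖w‖ * (C₂ * ε ^ 2) := by gcongr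
    _ = _ := by ring

/-- Fourth order expansion of the closing defect of a coordinate rectangle, and third order
expansions of its two sides. -/
lemma exists_rectangle_bound (hΩ : IsOpen Ω) (hf : ContDiffOn ℝ (⊤ : ℕ∞) f Ω)
    {p₀ : ℝ × ℝ} {R : ℝ} (hR : closedBall p₀ (R + R) ⊆ Ω) :
    ∃ C > 0, ∀ p ∈ closedBall p₀ R, ∀ ε : ℝ, 0 ≤ ε → ε ≤ 1 → 3 * ε ≤ R → ∀ s : ℝ, |s| ≤ 2 →
      ‖f (p + (s * ε, 0)) - f p - (ε • (s • mixedPartial f 1 0 p)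
        + ε ^ 2 • ((s ^ 2 / 2) • mixedPartial f 2 0 p)
        + ε ^ 3 • ((s ^ 3 / 6) • mixedPartial f 3 0 p))‖ ≤ C * ε ^ 4 ∧
      ‖f (p + (0, ε)) - f p - (ε • mixedPartial f 0 1 p
        + ε ^ 2 • ((1 / 2 : ℝ) • mixedPartial f 0 2 p)
        + ε ^ 3 • ((1 / 6 : ℝ) • mixedPartial f 0 3 p))‖ ≤ C * ε ^ 4 ∧
      ‖f (p + (s * ε, ε)) - f (p + (s * ε, 0)) - f (p + (0, ε)) + f p
        - (ε ^ 2 • (s • mixedPartial f 1 1 p)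
        + ε ^ 3 • ((s ^ 2 / 2) • mixedPartial f 2 1 p + (s / 2) • mixedPartial f 1 2 p)
        + ε ^ 4 • ((s ^ 3 / 6) • mixedPartial f 3 1 p + (s ^ 2 / 4) • mixedPartial f 2 2 p
          + (s / 6) • mixedPartial f 1 3 p))‖ ≤ C * ε ^ 5 := by
  obtain ⟨C₄, hC₄0, hC₄⟩ := exists_taylor_bound hΩ hf hR 0 0 4
  obtain ⟨C₅, hC₅0, hC₅⟩ := exists_taylor_bound hΩ hf hR 0 0 5
  refine ⟨81 * C₄ + 3 * (243 * C₅), by positivity, fun p hp ε h0 h1 hεR s hs => ?_⟩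
  have hsε : |s * ε| ≤ 2 * ε := by rw [abs_mul, abs_of_nonneg h0]; gcongr
  have hε : |ε| ≤ ε := (abs_of_nonneg h0).le
  have h0R : |(0 : ℝ)| ≤ R := by simp; linarith
  have hsR : |s * ε| ≤ R := hsε.trans (by linarith)
  have heR : |ε| ≤ R := hε.trans (by linarith)
  have pow_bd : ∀ h k : ℝ, ∀ n : ℕ, |h| ≤ 2 * ε → |k| ≤ ε → (|h| + |k|) ^ n ≤ 3 ^ n * ε ^ n :=
    fun h k n hh hk => by
      rw [← mul_pow]
      exact pow_le_pow_left₀ (by positivity) (by linarith) n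
  have tay : ∀ C : ℝ, 0 < C → ∀ h k : ℝ, ∀ n : ℕ, |h| ≤ 2 * ε → |k| ≤ ε →
      C * (|h| + |k|) ^ n ≤ 3 ^ n * C * ε ^ n := fun C hC h k n hh hk => by
    calc _ ≤ C * (3 ^ n * ε ^ n) := by gcongr; exact pow_bd h k n hh hk
      _ = _ := by ring
  have z2 : |(0 : ℝ)| ≤ 2 * ε := by simpa using h0
  have z1 : |(0 : ℝ)| ≤ ε := by simpa using h0
  have a1 := (hC₄ p hp (s * ε) 0 hsR h0R).trans (tay C₄ hC₄0 _ _ 4 hsε z1)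
  have a2 := (hC₄ p hp 0 ε h0R heR).trans (tay C₄ hC₄0 _ _ 4 z2 hε)
  have a3 := (hC₅ p hp (s * ε) 0 hsR h0R).trans (tay C₅ hC₅0 _ _ 5 hsε z1)
  have a4 := (hC₅ p hp 0 ε h0R heR).trans (tay C₅ hC₅0 _ _ 5 z2 hε)
  have a5 := (hC₅ p hp (s * ε) ε hsR heR).trans (tay C₅ hC₅0 _ _ 5 hsε hε)
  have hf0 : mixedPartial f 0 0 = f := rfl
  simp only [Finset.sum_range_succ, Finset.sum_range_zero, directionalPow, Nat.factorial,
    zero_add, hf0] at a1 a2 a3 a4 a5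
  norm_num only [Nat.succ_eq_add_one, zero_smul, smul_zero, add_zero, zero_add] at a1 a2 a3 a4 a5
  have e4 : 0 ≤ C₄ * ε ^ 4 := by positivity
  have e4' : 0 ≤ C₅ * ε ^ 4 := by positivity
  have e5 : 0 ≤ C₄ * ε ^ 5 := by positivity
  refine ⟨le_trans ?_ (a1.trans (by linarith)), le_trans ?_ (a2.trans (by linarith)),
    le_trans ?_ ((norm_sub_le_of_le (norm_sub_le_of_le a5 a3) a4).trans
      (by linarith))⟩
  · apply le_of_eq; congr 1; module
  · apply le_of_eq; congr 1; module
  · apply le_of_eq; congr 1; module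

end LocalEstimates

lemma exists_eq_add_pow_smul {v w : E3} {C ε : ℝ} {n : ℕ} (hε : 0 < ε) (h : ‖v - w‖ ≤ C * ε ^ n) :
    ∃ r : E3, ‖r‖ ≤ C ∧ v = w + ε ^ n • r := by
  refine ⟨(ε ^ n)⁻¹ • (v - w), ?_, ?_⟩
  · rw [norm_smul, norm_inv, Real.norm_of_nonneg (by positivity)]
    rwa [inv_mul_le_iff₀ (by positivity), mul_comm]
  · rw [smul_inv_smul₀ (by positivity)]
    abel

section QuadDeterminant

variable {Ω : Set (ℝ × ℝ)} {f : ℝ × ℝ → E3}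

/-- Expansions of the edge vectors and of the closing defect of a perturbed quadrilateral. -/
lemma exists_edge_expansion (hΩ : IsOpen Ω) (hf : ContDiffOn ℝ (⊤ : ℕ∞) f Ω)
    {p₀ : ℝ × ℝ} {R : ℝ} (hR : closedBall p₀ (R + R) ⊆ Ω) {K : ℝ} (hK : 0 ≤ K) :
    ∃ C > 0, ∀ p ∈ closedBall p₀ R, ∀ ε : ℝ, 0 < ε → ε ≤ 1 → 3 * ε ≤ R → K * ε ≤ 1 →
      ∀ s Q X : ℝ, |s| ≤ 2 → |Q| ≤ K → |X| ≤ K → ∃ b₄ c₄ m₄ : E3,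
      ‖b₄‖ ≤ C ∧ ‖c₄‖ ≤ C ∧ ‖m₄‖ ≤ C ∧
      f (p + (s * ε, ε ^ 3 * Q)) - f p = ε • (s • mixedPartial f 1 0 p
        + ε • ((s ^ 2 / 2) • mixedPartial f 2 0 p)
        + ε ^ 2 • ((s ^ 3 / 6) • mixedPartial f 3 0 p + Q • mixedPartial f 0 1 p)
        + ε ^ 3 • b₄) ∧
      f (p + (0, ε)) - f p = ε • (mixedPartial f 0 1 p
        + ε • ((1 / 2 : ℝ) • mixedPartial f 0 2 p)
        + ε ^ 2 • ((1 / 6 : ℝ) • mixedPartial f 0 3 p) + ε ^ 3 • c₄) ∧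
      f (p + (s * ε + ε ^ 3 * X, ε - ε ^ 3 * Q)) - f (p + (s * ε, ε ^ 3 * Q)) - f (p + (0, ε))
          + f p = ε ^ 2 • (s • mixedPartial f 1 1 p
        + ε • (X • mixedPartial f 1 0 p - (2 * Q) • mixedPartial f 0 1 p
          + (s ^ 2 / 2) • mixedPartial f 2 1 p + (s / 2) • mixedPartial f 1 2 p)
        + ε ^ 2 • (X • (s • mixedPartial f 2 0 p + mixedPartial f 1 1 p)
          - Q • (s • mixedPartial f 1 1 p + mixedPartial f 0 2 p) - (Q * s) • mixedPartial f 1 1 p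
          + (s ^ 3 / 6) • mixedPartial f 3 1 p + (s ^ 2 / 4) • mixedPartial f 2 2 p
          + (s / 6) • mixedPartial f 1 3 p)
        + ε ^ 3 • m₄) := by
  obtain ⟨C₁, hC₁0, hC₁⟩ := exists_rectangle_bound hΩ hf hR
  obtain ⟨C₂, hC₂0, hC₂⟩ := exists_difference_bound hΩ hf hR
  obtain ⟨K₁, hK₁0, hK₁⟩ := exists_norm_le_mixedPartial hΩ hf hR 1
  refine ⟨C₁ + 2 * (C₂ * K) + K * (2 * K₁), by positivity,
    fun p hp ε h0 h1 hεR hKε s Q X hs hQ hX => ?_⟩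
  have hpR : p ∈ closedBall p₀ (R + R) := closedBall_subset_closedBall (by linarith) hp
  obtain ⟨r₁, r₂, r₃⟩ := hC₁ p hp ε h0.le h1 hεR s hs
  obtain ⟨ρ₁, hρ₁, e₁⟩ := exists_eq_add_pow_smul h0 r₁
  obtain ⟨ρ₂, hρ₂, e₂⟩ := exists_eq_add_pow_smul h0 r₂
  obtain ⟨ρ₃, hρ₃, e₃⟩ := exists_eq_add_pow_smul h0 r₃
  have hsε : |s * ε| ≤ 2 * ε := by rw [abs_mul, abs_of_pos h0]; gcongr
  have hKε3 : ε ^ 3 * K ≤ ε ^ 2 := by nlinarith [pow_pos h0 2]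
  have small : ∀ c : ℝ, |c| ≤ K → |ε ^ 3 * c| ≤ ε ^ 3 * K := fun c hc => by
    rw [abs_mul, abs_of_pos (by positivity)]; gcongr
  have shift : ∀ h k x y : ℝ, |x| ≤ K → |y| ≤ K → |h| ≤ 2 * ε → |k| ≤ 2 * ε →
      ∃ ρ : E3, ‖ρ‖ ≤ C₂ * K ∧ f (p + (h + ε ^ 3 * x, k + ε ^ 3 * y)) - f (p + (h, k)) =
        (ε ^ 3 * x) • (mixedPartial f 1 0 p + h • mixedPartial f 2 0 p
          + k • mixedPartial f 1 1 p) +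
        (ε ^ 3 * y) • (mixedPartial f 0 1 p + h • mixedPartial f 1 1 p
          + k • mixedPartial f 0 2 p) + ε ^ 5 • ρ := by
    intro h k x y hx hy hh hk
    have hd : p + (h + ε ^ 3 * x, k + ε ^ 3 * y) - (p + (h, k)) = (ε ^ 3 * x, ε ^ 3 * y) := by
      ext <;> simp
    have hn : ‖((ε ^ 3 * x, ε ^ 3 * y) : ℝ × ℝ)‖ ≤ ε ^ 3 * K := max_le (small x hx) (small y hy)
    have := hC₂ p hp ε h0.le h1 hεR h k hh hk (p + (h, k)) (mem_closedBall_self (by positivity))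
      (p + (h + ε ^ 3 * x, k + ε ^ 3 * y)) (by
        rw [mem_closedBall_iff_norm, hd]; exact hn.trans hKε3)
    rw [hd] at this
    refine exists_eq_add_pow_smul h0 (this.trans ?_)
    calc _ ≤ C₂ * ε ^ 2 * (ε ^ 3 * K) := by gcongr
      _ = _ := by ring
  obtain ⟨ρ₄, hρ₄, e₄⟩ := shift (s * ε) 0 0 Q (by simpa) hQ hsε (by simpa using h0.le)
  obtain ⟨ρ₅, hρ₅, e₅⟩ := shift (s * ε) ε X (-Q) hX (by simpa) hsε (by
    rw [abs_of_pos h0]; linarith)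
  simp only [mul_zero, add_zero, zero_add, zero_smul, mul_neg, ← sub_eq_add_neg] at e₄ e₅
  refine ⟨ρ₁ + (Q * s) • mixedPartial f 1 1 p + ε • ρ₄, ρ₂, ρ₃ + ρ₅ - ρ₄, ?_, ?_, ?_, ?_, ?_, ?_⟩
  · have q : ‖(Q * s) • mixedPartial f 1 1 p‖ ≤ K * (2 * K₁) := by
      rw [norm_smul, norm_mul, Real.norm_eq_abs, Real.norm_eq_abs, mul_assoc]
      have := hK₁ 1 1 le_rfl le_rfl p hpR
      gcongr
    have q' : ‖ε • ρ₄‖ ≤ C₂ * K := by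
      rw [norm_smul, Real.norm_of_nonneg h0.le]
      nlinarith [norm_nonneg ρ₄]
    have : 0 ≤ C₂ * K := by positivity
    linarith [norm_add₃_le (a := ρ₁) (b := (Q * s) • mixedPartial f 1 1 p) (c := ε • ρ₄)]
  · have : 0 ≤ C₂ * K := by positivity
    have : 0 ≤ K * (2 * K₁) := by positivity
    linarith
  · have : 0 ≤ K * (2 * K₁) := by positivity
    linarith [norm_sub_le (ρ₃ + ρ₅) ρ₄, norm_add_le ρ₃ ρ₅]
  · rw [← sub_add_sub_cancel _ (f (p + (s * ε, 0))) (f p), e₄, e₁]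
    module
  · rw [e₂]; module
  · have split : ∀ M M₀ B B₀ C A : E3,
        M - B - C + A = (M₀ - B₀ - C + A) + (M - M₀) - (B - B₀) := fun _ _ _ _ _ _ => by abel
    rw [split _ (f (p + (s * ε, ε))) _ (f (p + (s * ε, 0))), e₃, e₄, e₅]
    module

end QuadDeterminant

/-- The triple product measuring the failure of `A B M C` to be planar. -/
def quadDet (A B M C : E3) : ℝ := tripleProd (B - A) (C - A) (M - B - C + A)

lemma quadDet_order_zero_eq_zero {e : ℕ → ℕ → E3} {a b x y : ℝ} (h : ConjugateRelations e a b x y)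
    (s : ℝ) : tripleProd (s • e 1 0) (e 0 1) (s • e 1 1) = 0 := by
  rw [h.e11]
  simp only [tripleProd_eq, PiLp.add_apply, PiLp.smul_apply, smul_eq_mul]
  ring

lemma quadDet_order_one_eq_zero {e : ℕ → ℕ → E3} {a b x y : ℝ} (h : ConjugateRelations e a b x y)
    (s Q X : ℝ) :
    tripleProd ((s ^ 2 / 2) • e 2 0) (e 0 1) (s • e 1 1)
      + tripleProd (s • e 1 0) ((1 / 2 : ℝ) • e 0 2) (s • e 1 1)
      + tripleProd (s • e 1 0) (e 0 1)
        (X • e 1 0 - (2 * Q) • e 0 1 + (s ^ 2 / 2) • e 2 1 + (s / 2) • e 1 2) = 0 := by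
  obtain ⟨h11, α₁, β₁, α₂, β₂, κ₁, κ₂, l₁, l₂, n₁, n₂, rfl, rfl, h21, h12, -⟩ := h
  rw [h11, h21, h12]
  simp only [tripleProd_eq, PiLp.add_apply, PiLp.sub_apply, PiLp.smul_apply, smul_eq_mul]
  ring

lemma quadDet_order_two_eq {e : ℕ → ℕ → E3} {a b x y : ℝ} (h : ConjugateRelations e a b x y)
    (s Q X : ℝ) :
    tripleProd ((s ^ 3 / 6) • e 3 0 + Q • e 0 1) (e 0 1) (s • e 1 1)
      + tripleProd (s • e 1 0) ((1 / 6 : ℝ) • e 0 3) (s • e 1 1)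
      + tripleProd (s • e 1 0) (e 0 1) (X • (s • e 2 0 + e 1 1) - Q • (s • e 1 1 + e 0 2)
          - (Q * s) • e 1 1 + (s ^ 3 / 6) • e 3 1 + (s ^ 2 / 4) • e 2 2 + (s / 6) • e 1 3)
      + tripleProd ((s ^ 2 / 2) • e 2 0) ((1 / 2 : ℝ) • e 0 2) (s • e 1 1)
      + tripleProd ((s ^ 2 / 2) • e 2 0) (e 0 1)
          (X • e 1 0 - (2 * Q) • e 0 1 + (s ^ 2 / 2) • e 2 1 + (s / 2) • e 1 2)
      + tripleProd (s • e 1 0) ((1 / 2 : ℝ) • e 0 2)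
          (X • e 1 0 - (2 * Q) • e 0 1 + (s ^ 2 / 2) • e 2 1 + (s / 2) • e 1 2) =
    s ^ 2 * (X * tripleProd (e 1 0) (e 0 1) (e 2 0) / 2
      + tripleProd (e 1 0) (e 0 1) (e 2 0) * (x - a * b) / 12 * s ^ 2
      + tripleProd (e 1 0) (e 0 1) (e 0 2) * (y - a * b) / 12) := by
  obtain ⟨h11, α₁, β₁, α₂, β₂, κ₁, κ₂, l₁, l₂, n₁, n₂, rfl, rfl, h21, h12, h22, h31, h13⟩ := h
  rw [h31, h13, h22, h21, h12, h11]
  simp only [tripleProd_eq, PiLp.add_apply, PiLp.sub_apply, PiLp.smul_apply, smul_eq_mul]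
  ring

lemma tripleProd_smul (r s t : ℝ) (x y z : E3) :
    tripleProd (r • x) (s • y) (t • z) = r * s * t * tripleProd x y z := by
  simp only [tripleProd_eq, PiLp.smul_apply, smul_eq_mul]
  ring

lemma norm_smul_le_of_le {c α K : ℝ} {x : E3} (hc : |c| ≤ α) (hx : ‖x‖ ≤ K) :
    ‖c • x‖ ≤ α * K := by
  rw [norm_smul]
  exact mul_le_mul hc hx (norm_nonneg x) ((abs_nonneg c).trans hc)

section QuadDeterminant

variable {Ω : Set (ℝ × ℝ)} {f : ℝ × ℝ → E3} {a b : ℝ × ℝ → ℝ}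

lemma exists_quadDet_bound (hΩ : IsOpen Ω) (hf : ContDiffOn ℝ (⊤ : ℕ∞) f Ω)
    {p₀ : ℝ × ℝ} {R : ℝ} (hR : closedBall p₀ (R + R) ⊆ Ω) {K : ℝ} (hK : 0 ≤ K)
    {x y : ℝ × ℝ → ℝ} (hrel : ∀ p ∈ closedBall p₀ (R + R),
      ConjugateRelations (fun i j => mixedPartial f i j p) (a p) (b p) (x p) (y p)) :
    ∃ C > 0, ∀ p ∈ closedBall p₀ R, ∀ ε : ℝ, 0 < ε → ε ≤ 1 → 3 * ε ≤ R → K * ε ≤ 1 →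
      ∀ s Q X : ℝ, |s| ≤ 2 → |Q| ≤ K → |X| ≤ K →
      |quadDet (f p) (f (p + (s * ε, ε ^ 3 * Q))) (f (p + (s * ε + ε ^ 3 * X, ε - ε ^ 3 * Q)))
          (f (p + (0, ε)))
        - ε ^ 6 * (s ^ 2 * (X * tripleProd (pd1 f p) (pd2 f p) (pd1 (pd1 f) p) / 2
          + tripleProd (pd1 f p) (pd2 f p) (pd1 (pd1 f) p) * (x p - a p * b p) / 12 * s ^ 2
          + tripleProd (pd1 f p) (pd2 f p) (pd2 (pd2 f) p) * (y p - a p * b p) / 12))|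
        ≤ C * ε ^ 7 := by
  obtain ⟨C₁, hC₁0, hC₁⟩ := exists_edge_expansion hΩ hf hR hK
  obtain ⟨K₁, hK₁0, hK₁⟩ := exists_norm_le_mixedPartial hΩ hf hR 3
  obtain ⟨C₂, hC₂0, hC₂⟩ := exists_tripleProd_expansion_bound (C₁ + (10 + 10 * K) * K₁)
    (by positivity)
  refine ⟨C₂, hC₂0, fun p hp ε h0 h1 hεR hKε s Q X hs hQ hX => ?_⟩
  have hpR : p ∈ closedBall p₀ (R + R) := closedBall_subset_closedBall (by linarith) hp
  obtain ⟨b₄, c₄, m₄, hb, hc, hm, eB, eC, eM⟩ := hC₁ p hp ε h0 h1 hεR hKε s Q X hs hQ hX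
  have h := hrel p hpR
  have key := hC₂ ε h0.le h1 (s • mixedPartial f 1 0 p) ((s ^ 2 / 2) • mixedPartial f 2 0 p)
    ((s ^ 3 / 6) • mixedPartial f 3 0 p + Q • mixedPartial f 0 1 p) b₄
    (mixedPartial f 0 1 p) ((1 / 2 : ℝ) • mixedPartial f 0 2 p)
    ((1 / 6 : ℝ) • mixedPartial f 0 3 p) c₄
    (s • mixedPartial f 1 1 p)
    (X • mixedPartial f 1 0 p - (2 * Q) • mixedPartial f 0 1 p
          + (s ^ 2 / 2) • mixedPartial f 2 1 p + (s / 2) • mixedPartial f 1 2 p)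
    (X • (s • mixedPartial f 2 0 p + mixedPartial f 1 1 p)
          - Q • (s • mixedPartial f 1 1 p + mixedPartial f 0 2 p) - (Q * s) • mixedPartial f 1 1 p
          + (s ^ 3 / 6) • mixedPartial f 3 1 p + (s ^ 2 / 4) • mixedPartial f 2 2 p
          + (s / 6) • mixedPartial f 1 3 p) m₄
  have D : ∀ i j, i ≤ 3 → j ≤ 3 → ‖mixedPartial f i j p‖ ≤ K₁ := fun i j hi hj => hK₁ i j hi hj p hpR
  have hs2 : |s ^ 2| ≤ 4 := by
    rw [abs_pow]; calc |s| ^ 2 ≤ 2 ^ 2 := by gcongr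
      _ = 4 := by norm_num
  have hs3 : |s ^ 3| ≤ 8 := by
    rw [abs_pow]; calc |s| ^ 3 ≤ 2 ^ 3 := by gcongr
      _ = 8 := by norm_num
  have hs22 : |s ^ 2 / 2| ≤ 2 := by rw [abs_div]; norm_num at hs2 ⊢; linarith
  have hs24 : |s ^ 2 / 4| ≤ 1 := by rw [abs_div]; norm_num at hs2 ⊢; linarith
  have hs36 : |s ^ 3 / 6| ≤ 2 := by rw [abs_div]; norm_num at hs3 ⊢; linarith
  have hs12 : |s / 2| ≤ 1 := by rw [abs_div]; norm_num at hs ⊢; linarith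
  have hs16 : |s / 6| ≤ 1 := by rw [abs_div]; norm_num at hs ⊢; linarith
  have h2Q : |2 * Q| ≤ 2 * K := by rw [abs_mul]; norm_num; linarith
  have hQs : |Q * s| ≤ K * 2 := by rw [abs_mul]; gcongr
  have n2 : |(1 / 2 : ℝ)| ≤ 1 := by norm_num [abs_of_pos]
  have n6 : |(1 / 6 : ℝ)| ≤ 1 := by norm_num [abs_of_pos]
  have hKK : 0 ≤ K * K₁ := by positivity
  have e11 := D 1 1 (by norm_num) (by norm_num)
  have e01 := D 0 1 (by norm_num) (by norm_num)
  specialize key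
    ((norm_smul_le_of_le hs (D 1 0 (by norm_num) (by norm_num))).trans (by linarith))
    ((norm_smul_le_of_le hs22 (D 2 0 (by norm_num) (by norm_num))).trans (by linarith))
    ((norm_add_le_of_le (norm_smul_le_of_le hs36 (D 3 0 (by norm_num) (by norm_num)))
      (norm_smul_le_of_le hQ e01)).trans (by linarith))
    (hb.trans (by linarith))
    (e01.trans (by linarith))
    ((norm_smul_le_of_le n2 (D 0 2 (by norm_num) (by norm_num))).trans (by linarith))
    ((norm_smul_le_of_le n6 (D 0 3 (by norm_num) (by norm_num))).trans (by linarith))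
    (hc.trans (by linarith))
    ((norm_smul_le_of_le hs e11).trans (by linarith))
    ((norm_add_le_of_le (norm_add_le_of_le (norm_sub_le_of_le
      (norm_smul_le_of_le hX (D 1 0 (by norm_num) (by norm_num)))
      (norm_smul_le_of_le h2Q e01))
      (norm_smul_le_of_le hs22 (D 2 1 (by norm_num) (by norm_num))))
      (norm_smul_le_of_le hs12 (D 1 2 (by norm_num) (by norm_num)))).trans (by linarith))
    ((norm_add_le_of_le (norm_add_le_of_le (norm_add_le_of_le
      (norm_sub_le_of_le (norm_sub_le_of_le
      (norm_smul_le_of_le hX (norm_add_le_of_le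
        (norm_smul_le_of_le hs (D 2 0 (by norm_num) (by norm_num))) e11))
      (norm_smul_le_of_le hQ (norm_add_le_of_le
        (norm_smul_le_of_le hs e11) (D 0 2 (by norm_num) (by norm_num)))))
      (norm_smul_le_of_le hQs e11))
      (norm_smul_le_of_le hs36 (D 3 1 (by norm_num) (by norm_num))))
      (norm_smul_le_of_le hs24 (D 2 2 (by norm_num) (by norm_num))))
      (norm_smul_le_of_le hs16 (D 1 3 (by norm_num) (by norm_num)))).trans (by linarith))
    (hm.trans (by linarith))
  have o0 := quadDet_order_zero_eq_zero h s
  have o1 := quadDet_order_one_eq_zero h s Q X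
  have o2 := quadDet_order_two_eq h s Q X
  rw [o0, o1, o2, mul_zero, add_zero, zero_add] at key
  rw [quadDet, eB, eC, eM, tripleProd_smul]
  have scale : ∀ T c : ℝ, |T - ε ^ 2 * c| ≤ C₂ * ε ^ 3 →
      |ε * ε * ε ^ 2 * T - ε ^ 6 * c| ≤ C₂ * ε ^ 7 := fun T c hT => by
    calc _ = |ε ^ 4 * (T - ε ^ 2 * c)| := by congr 1; ring
      _ = ε ^ 4 * |T - ε ^ 2 * c| := by rw [abs_mul, abs_of_pos (by positivity)]
      _ ≤ ε ^ 4 * (C₂ * ε ^ 3) := by gcongr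
      _ = _ := by ring
  exact scale _ _ key

lemma exists_tripleProd_first_order_bound (K : ℝ) (hK : 0 ≤ K) :
    ∃ C > 0, ∀ ε : ℝ, 0 ≤ ε → ε ≤ 1 → ∀ b₁ b₂ b₃ c₁ c₂ c₃ m₁ m₂ : E3,
      ‖b₁‖ ≤ K → ‖b₂‖ ≤ K → ‖b₃‖ ≤ K → ‖c₁‖ ≤ K → ‖c₂‖ ≤ K → ‖c₃‖ ≤ K → ‖m₁‖ ≤ K → ‖m₂‖ ≤ K →
      |tripleProd (b₁ + ε • b₂ + ε ^ 2 • b₃) (c₁ + ε • c₂ + ε ^ 2 • c₃) (m₁ + ε • m₂)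
        - (tripleProd b₁ c₁ m₁
          + ε * (tripleProd b₂ c₁ m₁ + tripleProd b₁ c₂ m₁ + tripleProd b₁ c₁ m₂))|
        ≤ C * ε ^ 2 := by
  obtain ⟨C, hC0, hC⟩ := exists_tripleProd_expansion_bound K hK
  refine ⟨C + 5 * (6 * (K * K * K)), by positivity, ?_⟩
  intro ε h0 h1 b₁ b₂ b₃ c₁ c₂ c₃ m₁ m₂ hb₁ hb₂ hb₃ hc₁ hc₂ hc₃ hm₁ hm₂
  have hz : ‖(0 : E3)‖ ≤ K := by simpa
  have key := hC ε h0 h1 b₁ b₂ b₃ 0 c₁ c₂ c₃ 0 m₁ m₂ 0 0 hb₁ hb₂ hb₃ hz hc₁ hc₂ hc₃ hz hm₁ hm₂ hz hz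
  simp only [smul_zero, add_zero] at key
  have t₁ := abs_le.1 (abs_tripleProd_le_of_norm_le hb₃ hc₁ hm₁)
  have t₂ := abs_le.1 (abs_tripleProd_le_of_norm_le hb₁ hc₃ hm₁)
  have t₃ := abs_le.1 (abs_tripleProd_le_of_norm_le hb₂ hc₂ hm₁)
  have t₄ := abs_le.1 (abs_tripleProd_le_of_norm_le hb₂ hc₁ hm₂)
  have t₅ := abs_le.1 (abs_tripleProd_le_of_norm_le hb₁ hc₂ hm₂)
  have t₀ : tripleProd b₁ c₁ 0 = 0 := by simp [tripleProd_eq]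
  have hsum : |ε ^ 2 * (tripleProd b₃ c₁ m₁ + tripleProd b₁ c₃ m₁ + tripleProd b₁ c₁ 0
      + tripleProd b₂ c₂ m₁ + tripleProd b₂ c₁ m₂ + tripleProd b₁ c₂ m₂)|
      ≤ ε ^ 2 * (5 * (6 * (K * K * K))) := by
    rw [abs_mul, abs_of_nonneg (by positivity : 0 ≤ ε ^ 2)]
    refine mul_le_mul_of_nonneg_left (abs_le.2 ⟨?_, ?_⟩) (by positivity) <;> linarith
  have hε : C * ε ^ 3 ≤ C * ε ^ 2 :=
    mul_le_mul_of_nonneg_left (pow_le_pow_of_le_one h0 h1 (by norm_num)) hC0.le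
  rw [abs_le] at key hsum ⊢
  constructor <;> linarith

lemma tripleProd_add_smul_add_smul (u v w₁ w₂ r : E3) (x y : ℝ) :
    tripleProd u v (x • w₁ + y • w₂ + r) =
      x * tripleProd u v w₁ + y * tripleProd u v w₂ + tripleProd u v r := by
  simp only [tripleProd_eq, PiLp.add_apply, PiLp.smul_apply, smul_eq_mul]
  ring

lemma quadDet_sub_quadDet (A B M M' C : E3) :
    quadDet A B M' C - quadDet A B M C = tripleProd (B - A) (C - A) (M' - M) := by
  simp only [quadDet, tripleProd_eq, PiLp.add_apply, PiLp.sub_apply]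
  ring

/-- The dependence of the planarity determinant on the fourth vertex, to leading order. -/
lemma exists_quadDet_sub_bound (hΩ : IsOpen Ω) (hf : ContDiffOn ℝ (⊤ : ℕ∞) f Ω)
    {p₀ : ℝ × ℝ} {R : ℝ} (hR : closedBall p₀ (R + R) ⊆ Ω) {K : ℝ} (hK : 0 ≤ K)
    (hconj : ∀ p ∈ closedBall p₀ (R + R),
      mixedPartial f 1 1 p = a p • mixedPartial f 1 0 p + b p • mixedPartial f 0 1 p) :
    ∃ C > 0, ∀ p ∈ closedBall p₀ R, ∀ ε : ℝ, 0 < ε → ε ≤ 1 → 3 * ε ≤ R → K * ε ≤ 1 →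
      ∀ s Q : ℝ, |s| ≤ 2 → |Q| ≤ K →
      ∀ z ∈ closedBall (p + (s * ε, ε)) (ε ^ 2), ∀ z' ∈ closedBall (p + (s * ε, ε)) (ε ^ 2),
      |quadDet (f p) (f (p + (s * ε, ε ^ 3 * Q))) (f z') (f (p + (0, ε)))
        - quadDet (f p) (f (p + (s * ε, ε ^ 3 * Q))) (f z) (f (p + (0, ε)))
        - ε ^ 3 * ((z' - z).1 * (s ^ 2 * tripleProd (pd1 f p) (pd2 f p) (pd1 (pd1 f) p) / 2)
          + (z' - z).2 * (s * tripleProd (pd1 f p) (pd2 f p) (pd2 (pd2 f) p) / 2))|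
        ≤ C * ε ^ 4 * ‖z' - z‖ := by
  obtain ⟨C₁, hC₁0, hC₁⟩ := exists_edge_expansion hΩ hf hR hK
  obtain ⟨C₂, hC₂0, hC₂⟩ := exists_difference_bound hΩ hf hR
  obtain ⟨K₁, hK₁0, hK₁⟩ := exists_norm_le_mixedPartial hΩ hf hR 3
  set K₂ := C₁ + (10 + K) * K₁ with hK₂
  have hK₂0 : 0 < K₂ := by positivity
  obtain ⟨C₃, hC₃0, hC₃⟩ := exists_tripleProd_first_order_bound K₂ hK₂0.le
  refine ⟨2 * C₃ + 6 * (3 * K₂ * (3 * K₂) * C₂), by positivity,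
    fun p hp ε h0 h1 hεR hKε s Q hs hQ z hz z' hz' => ?_⟩
  have hpR : p ∈ closedBall p₀ (R + R) := closedBall_subset_closedBall (by linarith) hp
  obtain ⟨b₄, c₄, m₄, hb, hc, -, eB, eC, -⟩ :=
    hC₁ p hp ε h0 h1 hεR hKε s Q 0 hs hQ (by simpa using hK)
  have hsε : |s * ε| ≤ 2 * ε := by rw [abs_mul, abs_of_pos h0]; gcongr
  obtain ⟨r, hr, er⟩ : ∃ r, ‖r‖ ≤ C₂ * ε ^ 2 * ‖z' - z‖ ∧ f z' - f z = (z' - z).1 •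
      (mixedPartial f 1 0 p + (s * ε) • mixedPartial f 2 0 p + ε • mixedPartial f 1 1 p) +
      (z' - z).2 • (mixedPartial f 0 1 p + (s * ε) • mixedPartial f 1 1 p
        + ε • mixedPartial f 0 2 p) + r :=
    ⟨_, hC₂ p hp ε h0.le h1 hεR (s * ε) ε hsε (by rw [abs_of_pos h0]; linarith) z hz z' hz',
      by abel⟩
  have D : ∀ i j, i ≤ 3 → j ≤ 3 → ‖mixedPartial f i j p‖ ≤ K₁ := fun i j hi hj => hK₁ i j hi hj p hpR
  have e10 := D 1 0 (by norm_num) (by norm_num)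
  have e01 := D 0 1 (by norm_num) (by norm_num)
  have e11 := D 1 1 (by norm_num) (by norm_num)
  have e20 := D 2 0 (by norm_num) (by norm_num)
  have e02 := D 0 2 (by norm_num) (by norm_num)
  have e30 := D 3 0 (by norm_num) (by norm_num)
  have e03 := D 0 3 (by norm_num) (by norm_num)
  have hs22 : |s ^ 2 / 2| ≤ 2 := by
    rw [abs_div, abs_pow, abs_two]; nlinarith [abs_nonneg s]
  have hs36 : |s ^ 3 / 6| ≤ 2 := by
    have : |s| ^ 3 ≤ 2 ^ 3 := by gcongr
    rw [abs_div, abs_pow, abs_of_pos (by norm_num : (0 : ℝ) < 6)]; linarith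
  have n2 : |(1 / 2 : ℝ)| ≤ 1 := by norm_num [abs_of_pos]
  have n6 : |(1 / 6 : ℝ)| ≤ 1 := by norm_num [abs_of_pos]
  have hKK : 0 ≤ K * K₁ := by positivity
  have small : ∀ v : E3, ‖v‖ ≤ C₁ → ‖ε • v‖ ≤ C₁ := fun v hv => by
    rw [norm_smul, Real.norm_of_nonneg h0.le]; nlinarith [norm_nonneg v]
  set b₁ := s • mixedPartial f 1 0 p
  set b₂ := (s ^ 2 / 2) • mixedPartial f 2 0 p
  set b₃ := (s ^ 3 / 6) • mixedPartial f 3 0 p + Q • mixedPartial f 0 1 p + ε • b₄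
  set c₁ := mixedPartial f 0 1 p
  set c₂ := (1 / 2 : ℝ) • mixedPartial f 0 2 p
  set c₃ := (1 / 6 : ℝ) • mixedPartial f 0 3 p + ε • c₄
  have hb₁ : ‖b₁‖ ≤ K₂ := (norm_smul_le_of_le hs e10).trans (by linarith)
  have hb₂ : ‖b₂‖ ≤ K₂ := (norm_smul_le_of_le hs22 e20).trans (by linarith)
  have hb₃ : ‖b₃‖ ≤ K₂ := (norm_add_le_of_le (norm_add_le_of_le (norm_smul_le_of_le hs36 e30)
    (norm_smul_le_of_le hQ e01)) (small _ hb)).trans (by linarith)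
  have hc₁ : ‖c₁‖ ≤ K₂ := e01.trans (by linarith)
  have hc₂ : ‖c₂‖ ≤ K₂ := (norm_smul_le_of_le n2 e02).trans (by linarith)
  have hc₃ : ‖c₃‖ ≤ K₂ := (norm_add_le_of_le (norm_smul_le_of_le n6 e03) (small _ hc)).trans
    (by linarith)
  have eB' : f (p + (s * ε, ε ^ 3 * Q)) - f p = ε • (b₁ + ε • b₂ + ε ^ 2 • b₃) := by
    rw [eB]; module
  have eC' : f (p + (0, ε)) - f p = ε • (c₁ + ε • c₂ + ε ^ 2 • c₃) := by
    rw [eC]; module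
  have k₁ := hC₃ ε h0.le h1 b₁ b₂ b₃ c₁ c₂ c₃ (mixedPartial f 1 0 p)
    (s • mixedPartial f 2 0 p + mixedPartial f 1 1 p) hb₁ hb₂ hb₃ hc₁ hc₂ hc₃
    (e10.trans (by linarith))
    ((norm_add_le_of_le (norm_smul_le_of_le hs e20) e11).trans (by linarith))
  have k₂ := hC₃ ε h0.le h1 b₁ b₂ b₃ c₁ c₂ c₃ (mixedPartial f 0 1 p)
    (s • mixedPartial f 1 1 p + mixedPartial f 0 2 p) hb₁ hb₂ hb₃ hc₁ hc₂ hc₃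
    (e01.trans (by linarith))
    ((norm_add_le_of_le (norm_smul_le_of_le hs e11) e02).trans (by linarith))
  have i₁ : tripleProd b₁ c₁ (mixedPartial f 1 0 p) + ε * (tripleProd b₂ c₁ (mixedPartial f 1 0 p)
      + tripleProd b₁ c₂ (mixedPartial f 1 0 p)
      + tripleProd b₁ c₁ (s • mixedPartial f 2 0 p + mixedPartial f 1 1 p)) =
      ε * (s ^ 2 * tripleProd (mixedPartial f 1 0 p) (mixedPartial f 0 1 p)
        (mixedPartial f 2 0 p) / 2) := by
    rw [hconj p hpR]
    simp only [b₁, b₂, c₁, c₂, tripleProd_eq, PiLp.add_apply, PiLp.smul_apply, smul_eq_mul]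
    ring
  have i₂ : tripleProd b₁ c₁ (mixedPartial f 0 1 p) + ε * (tripleProd b₂ c₁ (mixedPartial f 0 1 p)
      + tripleProd b₁ c₂ (mixedPartial f 0 1 p)
      + tripleProd b₁ c₁ (s • mixedPartial f 1 1 p + mixedPartial f 0 2 p)) =
      ε * (s * tripleProd (mixedPartial f 1 0 p) (mixedPartial f 0 1 p)
        (mixedPartial f 0 2 p) / 2) := by
    rw [hconj p hpR]
    simp only [b₁, b₂, c₁, c₂, tripleProd_eq, PiLp.add_apply, PiLp.smul_apply, smul_eq_mul]
    ring
  rw [i₁] at k₁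
  rw [i₂] at k₂
  have side : ∀ v₁ v₂ v₃ : E3, ‖v₁‖ ≤ K₂ → ‖v₂‖ ≤ K₂ → ‖v₃‖ ≤ K₂ →
      ‖v₁ + ε • v₂ + ε ^ 2 • v₃‖ ≤ 3 * K₂ := fun v₁ v₂ v₃ hv₁ hv₂ hv₃ => by
    refine (norm_add_le_of_le (norm_add_le_of_le hv₁ (norm_smul_le_of_le (α := 1) ?_ hv₂))
      (norm_smul_le_of_le (α := 1) ?_ hv₃)).trans (by linarith)
    · rwa [abs_of_pos h0]
    · rw [abs_of_pos (by positivity)]; exact pow_le_one₀ h0.le h1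
  have k₃ := abs_tripleProd_le_of_norm_le (side _ _ _ hb₁ hb₂ hb₃) (side _ _ _ hc₁ hc₂ hc₃) hr
  have w₁ : mixedPartial f 1 0 p + (s * ε) • mixedPartial f 2 0 p + ε • mixedPartial f 1 1 p =
      mixedPartial f 1 0 p + ε • (s • mixedPartial f 2 0 p + mixedPartial f 1 1 p) := by module
  have w₂ : mixedPartial f 0 1 p + (s * ε) • mixedPartial f 1 1 p + ε • mixedPartial f 0 2 p =
      mixedPartial f 0 1 p + ε • (s • mixedPartial f 1 1 p + mixedPartial f 0 2 p) := by module
  have scale : ∀ u v w : E3, tripleProd (ε • u) (ε • v) w = ε ^ 2 * tripleProd u v w :=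
    fun u v w => by simpa [sq] using tripleProd_smul ε ε 1 u v w
  rw [quadDet_sub_quadDet, eB', eC', er, w₁, w₂, scale, tripleProd_add_smul_add_smul]
  change |_ - ε ^ 3 * ((z' - z).1 * (s ^ 2 * tripleProd (mixedPartial f 1 0 p)
    (mixedPartial f 0 1 p) (mixedPartial f 2 0 p) / 2) + (z' - z).2 * (s * tripleProd
    (mixedPartial f 1 0 p) (mixedPartial f 0 1 p) (mixedPartial f 0 2 p) / 2))| ≤ _
  have d₁ : |(z' - z).1| ≤ ‖z' - z‖ := norm_fst_le (z' - z)
  have d₂ : |(z' - z).2| ≤ ‖z' - z‖ := norm_snd_le (z' - z)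
  generalize tripleProd (b₁ + ε • b₂ + ε ^ 2 • b₃) (c₁ + ε • c₂ + ε ^ 2 • c₃) (mixedPartial f 1 0 p
    + ε • (s • mixedPartial f 2 0 p + mixedPartial f 1 1 p)) = T₁ at k₁ ⊢
  generalize tripleProd (b₁ + ε • b₂ + ε ^ 2 • b₃) (c₁ + ε • c₂ + ε ^ 2 • c₃) (mixedPartial f 0 1 p
    + ε • (s • mixedPartial f 1 1 p + mixedPartial f 0 2 p)) = T₂ at k₂ ⊢
  generalize tripleProd (b₁ + ε • b₂ + ε ^ 2 • b₃) (c₁ + ε • c₂ + ε ^ 2 • c₃) r = T₃ at k₃ ⊢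
  generalize s ^ 2 * tripleProd (mixedPartial f 1 0 p) (mixedPartial f 0 1 p)
    (mixedPartial f 2 0 p) / 2 = l at k₁ ⊢
  generalize s * tripleProd (mixedPartial f 1 0 p) (mixedPartial f 0 1 p)
    (mixedPartial f 0 2 p) / 2 = n at k₂ ⊢
  calc _ = |ε ^ 2 * ((z' - z).1 * (T₁ - ε * l) + (z' - z).2 * (T₂ - ε * n) + T₃)| := by
        congr 1; ring
    _ = ε ^ 2 * |(z' - z).1 * (T₁ - ε * l) + (z' - z).2 * (T₂ - ε * n) + T₃| := by
        rw [abs_mul, abs_of_pos (by positivity)]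
    _ ≤ ε ^ 2 * (‖z' - z‖ * (C₃ * ε ^ 2) + ‖z' - z‖ * (C₃ * ε ^ 2)
          + 6 * (3 * K₂ * (3 * K₂) * (C₂ * ε ^ 2 * ‖z' - z‖))) := by
        gcongr
        refine (abs_add_three _ _ _).trans ?_
        rw [abs_mul, abs_mul]
        gcongr
    _ = _ := by ring

end QuadDeterminant

/-- Two real functions on the plane whose increments are, up to a relatively small error, two
independent linear forms have a common zero near any point where both are small. -/
lemma exists_common_zero_s11 {Φ₁ Φ₂ : ℝ × ℝ → ℝ} {l n m η e δ r : ℝ} (hl : l ≠ 0) (hn : n ≠ 0)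
    (hml : |l|⁻¹ ≤ m) (hmn : |n|⁻¹ ≤ m) (hη : 0 < η) (hme : m * e ≤ 1 / 2)
    (hδr : 2 * m * δ ≤ r) (h₁ : |Φ₁ 0| ≤ η * δ) (h₂ : |Φ₂ 0| ≤ η * δ)
    (hΦ₁ : ∀ d ∈ closedBall (0 : ℝ × ℝ) r, ∀ d' ∈ closedBall (0 : ℝ × ℝ) r,
      |Φ₁ d' - Φ₁ d - η * ((d' - d).1 * l + (d' - d).2 * n)| ≤ η * e * ‖d' - d‖)
    (hΦ₂ : ∀ d ∈ closedBall (0 : ℝ × ℝ) r, ∀ d' ∈ closedBall (0 : ℝ × ℝ) r,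
      |Φ₂ d' - Φ₂ d - η * ((d' - d).1 * l - (d' - d).2 * n)| ≤ η * e * ‖d' - d‖) :
    ∃ d : ℝ × ℝ, ‖d‖ ≤ 2 * m * δ ∧ Φ₁ d = 0 ∧ Φ₂ d = 0 := by
  have hm : 0 < m := (inv_pos.2 (abs_pos.2 hl)).trans_le hml
  have hδ : 0 ≤ δ := nonneg_of_mul_nonneg_right ((abs_nonneg _).trans h₁) hη
  have average : ∀ c x y B : ℝ, c ≠ 0 → |c|⁻¹ ≤ m → |x| ≤ η * B → |y| ≤ η * B →
      |(x + y) / (2 * η * c)| ≤ m * B := fun c x y B hc hcm hx hy => by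
    have hB : 0 ≤ B := nonneg_of_mul_nonneg_right ((abs_nonneg _).trans hx) hη
    have hc' : 0 < |c| := abs_pos.2 hc
    rw [abs_div, abs_mul, abs_of_pos (by positivity : 0 < 2 * η)]
    calc _ ≤ (η * B + η * B) / (2 * η * |c|) := by
          gcongr; exact (abs_add_le x y).trans (add_le_add hx hy)
      _ = |c|⁻¹ * B := by field_simp; ring
      _ ≤ _ := by gcongr
  let F : ℝ × ℝ → ℝ × ℝ := fun d =>
    ((Φ₁ d + Φ₂ d) / (2 * η * l), (Φ₁ d + -Φ₂ d) / (2 * η * n))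
  have happ : ApproximatesLinearOn F (ContinuousLinearMap.id ℝ (ℝ × ℝ))
      (closedBall 0 (2 * m * δ)) (1 / 2 : NNReal) := by
    intro d' hd' d hd
    have k₁ := hΦ₁ d (closedBall_subset_closedBall hδr hd) d' (closedBall_subset_closedBall hδr hd')
    have k₂ := hΦ₂ d (closedBall_subset_closedBall hδr hd) d' (closedBall_subset_closedBall hδr hd')
    have k₂' : |-(Φ₂ d' - Φ₂ d - η * ((d' - d).1 * l - (d' - d).2 * n))| ≤ η * e * ‖d' - d‖ := by
      rwa [abs_neg]
    rw [mul_assoc] at k₁ k₂ k₂'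
    have hF : F d' - F d - ContinuousLinearMap.id ℝ (ℝ × ℝ) (d' - d) =
        ((Φ₁ d' - Φ₁ d - η * ((d' - d).1 * l + (d' - d).2 * n)
          + (Φ₂ d' - Φ₂ d - η * ((d' - d).1 * l - (d' - d).2 * n))) / (2 * η * l),
        (Φ₁ d' - Φ₁ d - η * ((d' - d).1 * l + (d' - d).2 * n)
          + -(Φ₂ d' - Φ₂ d - η * ((d' - d).1 * l - (d' - d).2 * n))) / (2 * η * n)) := by
      ext <;> simp only [F, Prod.fst_sub, Prod.snd_sub, ContinuousLinearMap.id_apply] <;>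
        field_simp <;> ring
    rw [hF]
    have half : m * (e * ‖d' - d‖) ≤ ((1 / 2 : NNReal) : ℝ) * ‖d' - d‖ := by
      rw [← mul_assoc]; push_cast; gcongr
    exact (max_le (average _ _ _ _ hl hml k₁ k₂) (average _ _ _ _ hn hmn k₁ k₂')).trans half
  have hF0 : ‖F 0‖ ≤ m * δ :=
    max_le (average _ _ _ _ hl hml h₁ h₂) (average _ _ _ _ hn hmn h₁ (by rwa [abs_neg]))
  obtain ⟨d, hd, hFd⟩ := happ.surjOn_closedBall_of_nonlinearRightInverse
    ⟨id, 1, fun y => by simp, fun y => rfl⟩ (by positivity) subset_rfl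
    (show (0 : ℝ × ℝ) ∈ closedBall (F 0) _ by
      rw [mem_closedBall_iff_norm, zero_sub, norm_neg]
      refine hF0.trans (le_of_eq ?_)
      push_cast
      ring)
  have z₁ : Φ₁ d + Φ₂ d = 0 := by
    have := congrArg Prod.fst hFd
    simpa [F, hη.ne', hl] using this
  have z₂ : Φ₁ d + -Φ₂ d = 0 := by
    have := congrArg Prod.snd hFd
    simpa only [F, Prod.snd_zero, div_eq_zero_iff, mul_eq_zero, hη.ne', hn, OfNat.ofNat_ne_zero,
      or_false] using this
  exact ⟨d, by simpa using hd, by linarith, by linarith⟩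

section LipschitzCoefficients

variable {Ω : Set (ℝ × ℝ)}

lemma ContDiffOn.tripleProd {g₁ g₂ g₃ : ℝ × ℝ → E3} (h₁ : ContDiffOn ℝ (⊤ : ℕ∞) g₁ Ω)
    (h₂ : ContDiffOn ℝ (⊤ : ℕ∞) g₂ Ω) (h₃ : ContDiffOn ℝ (⊤ : ℕ∞) g₃ Ω) :
    ContDiffOn ℝ (⊤ : ℕ∞) (fun p => tripleProd (g₁ p) (g₂ p) (g₃ p)) Ω := by
  rw [contDiffOn_euclidean] at h₁ h₂ h₃
  simp only [tripleProd_eq]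
  exact ((((h₁ 1).mul (h₂ 2)).sub ((h₁ 2).mul (h₂ 1))).mul (h₃ 0) |>.add
    ((((h₁ 2).mul (h₂ 0)).sub ((h₁ 0).mul (h₂ 2))).mul (h₃ 1))).add
    ((((h₁ 0).mul (h₂ 1)).sub ((h₁ 1).mul (h₂ 0))).mul (h₃ 2))

lemma exists_abs_le_abs_sub_le {g : ℝ × ℝ → ℝ} (hg : ContDiffOn ℝ (⊤ : ℕ∞) g Ω) {p₀ : ℝ × ℝ} {R : ℝ} (hR : closedBall p₀ R ⊆ Ω) (h0 : 0 ≤ R) :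
    ∃ B ≥ 0, ∀ p ∈ closedBall p₀ R, ∀ ε : ℝ, ‖p - p₀‖ ≤ 2 * ε → ε ≤ 1 →
      |g p| ≤ B ∧ |g p - g p₀| ≤ B * ε := by
  obtain ⟨Λ, hΛ⟩ := (hg.mono hR).exists_lipschitzOnWith (by simp) (convex_closedBall p₀ R)
    (isCompact_closedBall p₀ R)
  refine ⟨|g p₀| + Λ * 2, by positivity, fun p hp ε hpε h1 => ?_⟩
  have hε : 0 ≤ ε := by linarith [norm_nonneg (p - p₀)]
  have h : |g p - g p₀| ≤ Λ * 2 * ε := by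
    have := hΛ.dist_le_mul p hp p₀ (mem_closedBall_self h0)
    rw [Real.dist_eq, dist_eq_norm] at this
    calc _ ≤ _ := this
      _ ≤ Λ * (2 * ε) := by gcongr
      _ = _ := by ring
  have hΛε : Λ * 2 * ε ≤ Λ * 2 := mul_le_of_le_one_right (by positivity) h1
  constructor
  · calc |g p| = |g p₀ + (g p - g p₀)| := by rw [add_sub_cancel]
      _ ≤ _ := (abs_add_le _ _).trans (by linarith)
  · nlinarith [abs_nonneg (g p₀)]

end LipschitzCoefficients

/-- The planarity determinant of the quadrilateral with base vertex `f p`, seen as a function of a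
displacement `d` of the parameters of its fourth vertex. -/
def perturbedQuadDet (f : ℝ × ℝ → E3) (p : ℝ × ℝ) (ε s Q X : ℝ) (d : ℝ × ℝ) : ℝ :=
  quadDet (f p) (f (p + (s * ε, ε ^ 3 * Q))) (f (p + (s * ε + ε ^ 3 * X, ε - ε ^ 3 * Q) + d))
    (f (p + (0, ε)))

section PerturbedQuad

variable {Ω : Set (ℝ × ℝ)} {f : ℝ × ℝ → E3} {a b : ℝ × ℝ → ℝ}

lemma exists_perturbedQuadDet_bound (hΩ : IsOpen Ω) (hf : ContDiffOn ℝ (⊤ : ℕ∞) f Ω)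
    (ha : ContDiffOn ℝ (⊤ : ℕ∞) a Ω) (hb : ContDiffOn ℝ (⊤ : ℕ∞) b Ω)
    (hconj : ∀ p ∈ Ω, pd2 (pd1 f) p = a p • pd1 f p + b p • pd2 f p)
    {p₀ : ℝ × ℝ} {R : ℝ} (hR0 : 0 < R) (hR : closedBall p₀ (R + R) ⊆ Ω)
    (hL : tripleProd (pd1 f p₀) (pd2 f p₀) (pd1 (pd1 f) p₀) ≠ 0) {K : ℝ} (hK : 0 ≤ K) :
    ∃ X C ε₀ : ℝ, 0 < C ∧ 0 < ε₀ ∧ ∀ ε : ℝ, 0 < ε → ε < ε₀ → ∀ p : ℝ × ℝ, ‖p - p₀‖ ≤ 2 * ε →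
      ∀ σ s Q : ℝ, σ ^ 2 = 1 → |s - σ| ≤ K * ε → |Q| ≤ K →
      |perturbedQuadDet f p ε s Q X 0| ≤ ε ^ 3 * (C * ε ^ 4) ∧
      ∀ d ∈ closedBall (0 : ℝ × ℝ) (ε ^ 2 / 2), ∀ d' ∈ closedBall (0 : ℝ × ℝ) (ε ^ 2 / 2),
        |perturbedQuadDet f p ε s Q X d' - perturbedQuadDet f p ε s Q X d
          - ε ^ 3 * ((d' - d).1 * (tripleProd (pd1 f p₀) (pd2 f p₀) (pd1 (pd1 f) p₀) / 2)
            + (d' - d).2 * (σ * tripleProd (pd1 f p₀) (pd2 f p₀) (pd2 (pd2 f) p₀) / 2))|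
          ≤ ε ^ 3 * (C * ε) * ‖d' - d‖ := by
  have hrel : ∀ p ∈ closedBall p₀ (R + R), ConjugateRelations (fun i j => mixedPartial f i j p)
      (a p) (b p) (fderiv ℝ a p (1, 0)) (fderiv ℝ b p (0, 1)) :=
    fun p hp => conjugateRelations hΩ hf ha hb hconj (hR hp)
  have hR' : closedBall p₀ R ⊆ Ω := (closedBall_subset_closedBall (by linarith)).trans hR
  have hf₁ := contDiffOn_pd1 hΩ hf
  have hf₂ := contDiffOn_pd2 hΩ hf
  set L : ℝ × ℝ → ℝ := fun p => tripleProd (pd1 f p) (pd2 f p) (pd1 (pd1 f) p) with hLdef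
  set N : ℝ × ℝ → ℝ := fun p => tripleProd (pd1 f p) (pd2 f p) (pd2 (pd2 f) p) with hNdef
  have hLs : ContDiffOn ℝ (⊤ : ℕ∞) L Ω := hf₁.tripleProd hf₂ (contDiffOn_pd1 hΩ hf₁)
  have hNs : ContDiffOn ℝ (⊤ : ℕ∞) N Ω := hf₁.tripleProd hf₂ (contDiffOn_pd2 hΩ hf₂)
  set c₁ : ℝ × ℝ → ℝ := fun p => L p * (fderiv ℝ a p (1, 0) - a p * b p) / 12
  set c₃ : ℝ × ℝ → ℝ := fun p => N p * (fderiv ℝ b p (0, 1) - a p * b p) / 12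
  have hc₁s : ContDiffOn ℝ (⊤ : ℕ∞) c₁ Ω :=
    (hLs.mul ((ContDiffOn.fderiv_apply_const hΩ ha (1, 0)).sub (ha.mul hb))).div_const 12
  have hc₃s : ContDiffOn ℝ (⊤ : ℕ∞) c₃ Ω :=
    (hNs.mul ((ContDiffOn.fderiv_apply_const hΩ hb (0, 1)).sub (ha.mul hb))).div_const 12
  set X : ℝ := -2 * (c₁ p₀ + c₃ p₀) / L p₀ with hX
  set G : ℝ × ℝ → ℝ := fun p => X * L p / 2 + c₁ p + c₃ p with hG
  have hGs : ContDiffOn ℝ (⊤ : ℕ∞) G Ω :=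
    (((contDiffOn_const.mul hLs).div_const 2).add hc₁s).add hc₃s
  have hG0 : G p₀ = 0 := by
    have : L p₀ ≠ 0 := hL
    simp only [hG, hX]
    field_simp
    ring
  obtain ⟨BL, hBL0, hBL⟩ := exists_abs_le_abs_sub_le hLs hR' hR0.le
  obtain ⟨BN, hBN0, hBN⟩ := exists_abs_le_abs_sub_le hNs hR' hR0.le
  obtain ⟨Bc, hBc0, hBc⟩ := exists_abs_le_abs_sub_le hc₁s hR' hR0.le
  obtain ⟨BG, hBG0, hBG⟩ := exists_abs_le_abs_sub_le hGs hR' hR0.le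
  have hKX : 0 ≤ K + |X| := by positivity
  obtain ⟨C₁, hC₁0, hC₁⟩ := exists_quadDet_bound hΩ hf hR hKX hrel
  obtain ⟨C₂, hC₂0, hC₂⟩ := exists_quadDet_sub_bound hΩ hf hR hKX fun p hp => (hrel p hp).e11
  refine ⟨X, C₁ + 4 * (BG + 3 * K * Bc) + (C₂ + (3 * K * BL + BL) + (K * BN + BN)),
    min (min 1 (R / 3)) (1 / (2 * (K + |X|) + 1)), by positivity, by positivity, ?_⟩
  intro ε h0 hε p hp σ s Q hσ hs hQ
  obtain ⟨⟨h1, hεR⟩, hεK⟩ : (ε < 1 ∧ ε < R / 3) ∧ ε < 1 / (2 * (K + |X|) + 1) := by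
    simpa only [lt_min_iff] using hε
  rw [lt_div_iff₀ (by positivity)] at hεK
  have hKε : 2 * (K + |X|) * ε ≤ 1 := by linarith
  have hpR : p ∈ closedBall p₀ R := by rw [mem_closedBall_iff_norm]; linarith
  have hKε1 : K * ε ≤ 1 := by nlinarith [abs_nonneg X]
  have hσ1 : |σ| = 1 := by rwa [← sq_eq_sq₀ (abs_nonneg σ) zero_le_one, sq_abs, one_pow]
  have hs2 : |s| ≤ 2 := by
    have := abs_add_le (s - σ) σ
    rw [sub_add_cancel] at this
    linarith
  have hs4 : |s ^ 2| ≤ 4 := by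
    rw [abs_pow]; calc |s| ^ 2 ≤ 2 ^ 2 := by gcongr
      _ = 4 := by norm_num
  have hss : |s ^ 2 - 1| ≤ 3 * K * ε := by
    rw [← hσ, sq_sub_sq, abs_mul]
    calc |s + σ| * |s - σ| ≤ 3 * (K * ε) := by
          gcongr; linarith [abs_add_le s σ]
      _ = _ := by ring
  have hQX : |Q| ≤ K + |X| := by linarith [abs_nonneg X]
  have hXX : |X| ≤ K + |X| := by linarith
  obtain ⟨lL, lL'⟩ := hBL p hpR ε hp h1.le
  obtain ⟨lN', lN⟩ := hBN p hpR ε hp h1.le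
  obtain ⟨lc, -⟩ := hBc p hpR ε hp h1.le
  obtain ⟨-, lG⟩ := hBG p hpR ε hp h1.le
  rw [hG0, sub_zero] at lG
  constructor
  · have key := hC₁ p hpR ε h0 h1.le (by linarith) (by linarith) s Q X hs2 hQX hXX
    change |quadDet _ _ (f (p + (s * ε + ε ^ 3 * X, ε - ε ^ 3 * Q))) _
      - ε ^ 6 * (s ^ 2 * (X * L p / 2 + c₁ p * s ^ 2 + c₃ p))| ≤ _ at key
    have hlead : |ε ^ 6 * (s ^ 2 * (X * L p / 2 + c₁ p * s ^ 2 + c₃ p))|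
        ≤ ε ^ 6 * (4 * (BG * ε + Bc * (3 * K * ε))) := by
      rw [abs_mul, abs_of_pos (by positivity : 0 < ε ^ 6), abs_mul]
      gcongr
      calc _ = |G p + c₁ p * (s ^ 2 - 1)| := by congr 1; simp only [hG]; ring
        _ ≤ |G p| + |c₁ p| * |s ^ 2 - 1| := (abs_add_le _ _).trans_eq (by rw [abs_mul])
        _ ≤ _ := by gcongr
    have hsum := abs_add_le (quadDet (f p) (f (p + (s * ε, ε ^ 3 * Q)))
      (f (p + (s * ε + ε ^ 3 * X, ε - ε ^ 3 * Q))) (f (p + (0, ε)))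
      - ε ^ 6 * (s ^ 2 * (X * L p / 2 + c₁ p * s ^ 2 + c₃ p)))
      (ε ^ 6 * (s ^ 2 * (X * L p / 2 + c₁ p * s ^ 2 + c₃ p)))
    rw [sub_add_cancel] at hsum
    rw [perturbedQuadDet, add_zero]
    have hrest : 0 ≤ (C₂ + (3 * K * BL + BL) + (K * BN + BN)) * ε ^ 7 := by positivity
    calc _ ≤ C₁ * ε ^ 7 + ε ^ 6 * (4 * (BG * ε + Bc * (3 * K * ε)))
          + (C₂ + (3 * K * BL + BL) + (K * BN + BN)) * ε ^ 7 := by linarith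
      _ = _ := by ring
  · intro d hd d' hd'
    have hmem : ∀ d ∈ closedBall (0 : ℝ × ℝ) (ε ^ 2 / 2),
        p + (s * ε + ε ^ 3 * X, ε - ε ^ 3 * Q) + d ∈ closedBall (p + (s * ε, ε)) (ε ^ 2) := by
      intro d hd
      rw [mem_closedBall_zero_iff] at hd
      have e : p + (s * ε + ε ^ 3 * X, ε - ε ^ 3 * Q) + d - (p + (s * ε, ε)) =
          (ε ^ 3 * X, -(ε ^ 3 * Q)) + d := by ext <;> simp <;> ring
      have small : ∀ c : ℝ, |c| ≤ K + |X| → |ε ^ 3 * c| ≤ ε ^ 2 / 2 := fun c hc => by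
        rw [abs_mul, abs_of_pos (by positivity)]
        calc ε ^ 3 * |c| ≤ ε ^ 3 * (K + |X|) := by gcongr
          _ = ε ^ 2 * (2 * (K + |X|) * ε) / 2 := by ring
          _ ≤ ε ^ 2 * 1 / 2 := by gcongr
          _ = _ := by ring
      have : ‖((ε ^ 3 * X, -(ε ^ 3 * Q)) : ℝ × ℝ)‖ ≤ ε ^ 2 / 2 :=
        max_le (small X hXX) (by rw [norm_neg]; exact small Q hQX)
      rw [mem_closedBall_iff_norm, e]
      linarith [norm_add_le ((ε ^ 3 * X, -(ε ^ 3 * Q)) : ℝ × ℝ) d]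
    have key := hC₂ p hpR ε h0 h1.le (by linarith) (by linarith) s Q hs2 hQX _ (hmem d hd)
      _ (hmem d' hd')
    rw [add_sub_add_left_eq_sub] at key
    change |perturbedQuadDet f p ε s Q X d' - perturbedQuadDet f p ε s Q X d
      - ε ^ 3 * ((d' - d).1 * (s ^ 2 * L p / 2) + (d' - d).2 * (s * N p / 2))| ≤ _ at key
    change |perturbedQuadDet f p ε s Q X d' - perturbedQuadDet f p ε s Q X d
      - ε ^ 3 * ((d' - d).1 * (L p₀ / 2) + (d' - d).2 * (σ * N p₀ / 2))| ≤ _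
    have d₁ : |(d' - d).1| ≤ ‖d' - d‖ := norm_fst_le (d' - d)
    have d₂ : |(d' - d).2| ≤ ‖d' - d‖ := norm_snd_le (d' - d)
    have eL : |s ^ 2 * L p / 2 - L p₀ / 2| ≤ (3 * K * BL + BL) * ε := by
      have h := abs_add_le ((s ^ 2 - 1) * L p) (L p - L p₀)
      rw [abs_mul] at h
      have h' : |s ^ 2 - 1| * |L p| ≤ 3 * K * ε * BL := by gcongr
      have e : s ^ 2 * L p / 2 - L p₀ / 2 = ((s ^ 2 - 1) * L p + (L p - L p₀)) / 2 := by ring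
      rw [e, abs_div, abs_two]
      linarith [abs_nonneg ((s ^ 2 - 1) * L p + (L p - L p₀))]
    have eN : |s * N p / 2 - σ * N p₀ / 2| ≤ (K * BN + BN) * ε := by
      have h := abs_add_le ((s - σ) * N p) (σ * (N p - N p₀))
      rw [abs_mul, abs_mul, hσ1] at h
      have h' : |s - σ| * |N p| ≤ K * ε * BN := by gcongr
      have e : s * N p / 2 - σ * N p₀ / 2 = ((s - σ) * N p + σ * (N p - N p₀)) / 2 := by ring
      rw [e, abs_div, abs_two]
      linarith [abs_nonneg ((s - σ) * N p + σ * (N p - N p₀))]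
    have hcoef : |ε ^ 3 * ((d' - d).1 * (s ^ 2 * L p / 2 - L p₀ / 2)
        + (d' - d).2 * (s * N p / 2 - σ * N p₀ / 2))|
        ≤ ε ^ 3 * (‖d' - d‖ * ((3 * K * BL + BL) * ε) + ‖d' - d‖ * ((K * BN + BN) * ε)) := by
      rw [abs_mul, abs_of_pos (by positivity : 0 < ε ^ 3)]
      gcongr
      refine (abs_add_le _ _).trans ?_
      rw [abs_mul, abs_mul]
      gcongr
    have hrest : 0 ≤ (C₁ + 4 * (BG + 3 * K * Bc)) * (ε ^ 4 * ‖d' - d‖) := by positivity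
    calc _ = |(perturbedQuadDet f p ε s Q X d' - perturbedQuadDet f p ε s Q X d
          - ε ^ 3 * ((d' - d).1 * (s ^ 2 * L p / 2) + (d' - d).2 * (s * N p / 2)))
          + ε ^ 3 * ((d' - d).1 * (s ^ 2 * L p / 2 - L p₀ / 2)
            + (d' - d).2 * (s * N p / 2 - σ * N p₀ / 2))| := by congr 1; ring
      _ ≤ C₂ * ε ^ 4 * ‖d' - d‖ + ε ^ 3 * (‖d' - d‖ * ((3 * K * BL + BL) * ε)
          + ‖d' - d‖ * ((K * BN + BN) * ε)) := (abs_add_le _ _).trans (add_le_add key hcoef)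
      _ ≤ _ + (C₁ + 4 * (BG + 3 * K * Bc)) * (ε ^ 4 * ‖d' - d‖) := le_add_of_nonneg_right hrest
      _ = _ := by ring

end PerturbedQuad

/-- For a smooth conjugate net without parabolic points, with `A = f(u₀,v₀)`,
`C = f(u₀,v₀+ε)`, `E = f(u₀+2ε,v₀)`, `F = f(u₀+2ε,v₀+ε)` and a perturbed point
`B₁ = f(u₀+ε+βᵤ, v₀+βᵥ)` with `|βᵤ| ≤ K₀ε²`, `|βᵥ| ≤ K₀ε³`, there are shifts `δu`, `δv`
with `|δu − βᵤ| ≤ C₀ε³` and `|δv + βᵥ| ≤ C₀(ε|βᵥ| + ε²|βᵤ| + ε⁴)` such that the point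
`M = f(u₀+ε+δu, v₀+ε+δv)` makes the quadrilaterals `A B₁ M C` and `B₁ M F E` planar. -/
theorem exists_point_making_two_adjacent_quads_planar_perturbed
    (Ω : Set (ℝ × ℝ)) (hΩ : IsOpen Ω) (f : ℝ × ℝ → E3) (a b : ℝ × ℝ → ℝ)
    (hf : ContDiffOn ℝ (⊤ : ℕ∞) f Ω) (ha : ContDiffOn ℝ (⊤ : ℕ∞) a Ω) (hb : ContDiffOn ℝ (⊤ : ℕ∞) b Ω)
    (hindep : ∀ p ∈ Ω, LinearIndependent ℝ ![pd1 f p, pd2 f p])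
    (hconj : ∀ p ∈ Ω, pd2 (pd1 f) p = a p • pd1 f p + b p • pd2 f p)
    (hnonpar : ∀ p ∈ Ω,
      dot3 (cross3 (pd1 (pd1 f) p) (pd1 f p)) (pd2 f p) ≠ 0 ∧
      dot3 (cross3 (pd2 (pd2 f) p) (pd1 f p)) (pd2 f p) ≠ 0)
    (u₀ v₀ : ℝ) (h₀ : (u₀, v₀) ∈ Ω) :
    ∀ K₀ > (0 : ℝ), ∃ C₀ > (0 : ℝ), ∃ ε₀ > (0 : ℝ), ∀ ε : ℝ, 0 < ε → ε < ε₀ →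
      ∀ βu βv : ℝ, |βu| ≤ K₀ * ε ^ 2 → |βv| ≤ K₀ * ε ^ 3 →
        ∃ δu δv : ℝ,
          |δu - βu| ≤ C₀ * ε ^ 3 ∧
          |δv + βv| ≤ C₀ * (ε * |βv| + ε ^ 2 * |βu| + ε ^ 4) ∧
          Coplanar ℝ ({f (u₀, v₀), f (u₀ + ε + βu, v₀ + βv),
            f (u₀ + ε + δu, v₀ + ε + δv), f (u₀, v₀ + ε)} : Set E3) ∧
          Coplanar ℝ ({f (u₀ + ε + βu, v₀ + βv), f (u₀ + ε + δu, v₀ + ε + δv),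
            f (u₀ + 2 * ε, v₀ + ε), f (u₀ + 2 * ε, v₀)} : Set E3) := by
  intro K₀ hK₀
  obtain ⟨hL, hN⟩ := hnonpar _ h₀
  have cyclic : ∀ x y z : E3, dot3 (cross3 z x) y = tripleProd x y z := fun x y z => by
    change tripleProd z x y = _
    simp only [tripleProd_eq]
    ring
  rw [cyclic] at hL hN
  obtain ⟨r, hr0, hr⟩ := Metric.isOpen_iff.1 hΩ _ h₀
  have hR : closedBall (u₀, v₀) (r / 4 + r / 4) ⊆ Ω :=
    (closedBall_subset_ball (by linarith)).trans hr
  obtain ⟨X, C, ε₁, hC, hε₁, hquad⟩ :=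
    exists_perturbedQuadDet_bound hΩ hf ha hb hconj (by positivity) hR hL hK₀.le
  set l := tripleProd (pd1 f (u₀, v₀)) (pd2 f (u₀, v₀)) (pd1 (pd1 f) (u₀, v₀)) / 2
  set n := tripleProd (pd1 f (u₀, v₀)) (pd2 f (u₀, v₀)) (pd2 (pd2 f) (u₀, v₀)) / 2
  have hl : l ≠ 0 := div_ne_zero hL two_ne_zero
  have hn : n ≠ 0 := div_ne_zero hN two_ne_zero
  set m := max |l|⁻¹ |n|⁻¹
  have hm : 0 < m := lt_max_of_lt_left (inv_pos.2 (abs_pos.2 hl))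
  refine ⟨|X| + 2 * m * C, by positivity, min ε₁ (min 1 (1 / (4 * m * C))), by positivity, ?_⟩
  intro ε h0 hε βu βv hβu hβv
  obtain ⟨hε₁, h1, hεm⟩ : ε < ε₁ ∧ ε < 1 ∧ ε < 1 / (4 * m * C) := by
    simpa only [lt_min_iff] using hε
  rw [lt_div_iff₀ (by positivity)] at hεm
  have hs : |βu / ε| ≤ K₀ * ε := by
    rw [abs_div, abs_of_pos h0, div_le_iff₀ h0]
    linarith
  have hQ : |βv / ε ^ 3| ≤ K₀ := by
    rwa [abs_div, abs_of_pos (pow_pos h0 3), div_le_iff₀ (by positivity)]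
  obtain ⟨z₁, i₁⟩ := hquad ε h0 hε₁ (u₀, v₀) (by simpa using h0.le) 1 (1 + βu / ε) (βv / ε ^ 3)
    (by norm_num) (by simpa using hs) hQ
  obtain ⟨z₂, i₂⟩ := hquad ε h0 hε₁ (u₀ + 2 * ε, v₀) (by
      simp [Prod.norm_def, abs_of_pos h0, h0.le]) (-1) (-1 + βu / ε) (βv / ε ^ 3)
    (by norm_num) (by simpa using hs) hQ
  obtain ⟨d, hd, q₁, q₂⟩ := exists_common_zero_s11 (r := ε ^ 2 / 2) hl hn (le_max_left _ _)
    (le_max_right _ _) (pow_pos h0 3) (by linarith)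
    (by
      calc 2 * m * (C * ε ^ 4) = ε ^ 2 * (ε * (ε * (4 * m * C))) / 2 := by ring
        _ ≤ ε ^ 2 * 1 / 2 := by gcongr; nlinarith
        _ = _ := by ring) z₁ z₂
    (fun d hd d' hd' => (congrArg abs (by ring)).trans_le (i₁ d hd d' hd'))
    (fun d hd d' hd' => (congrArg abs (by ring)).trans_le (i₂ d hd d' hd'))
  have hd₁ : |d.1| ≤ 2 * m * (C * ε ^ 4) := (norm_fst_le d).trans hd
  have hd₂ : |d.2| ≤ 2 * m * (C * ε ^ 4) := (norm_snd_le d).trans hd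
  refine ⟨βu + ε ^ 3 * X + d.1, -βv + d.2, ?_, ?_, ?_, ?_⟩
  · rw [add_assoc, add_sub_cancel_left]
    have hX : |ε ^ 3 * X| = ε ^ 3 * |X| := by rw [abs_mul, abs_of_pos (pow_pos h0 3)]
    have h43 : m * C * ε ^ 4 ≤ m * C * ε ^ 3 :=
      mul_le_mul_of_nonneg_left (pow_le_pow_of_le_one h0.le h1.le (by norm_num)) (by positivity)
    linarith [abs_add_le (ε ^ 3 * X) d.1]
  · rw [neg_add_cancel_comm]
    have e₁ : 0 ≤ |X| * (ε * |βv| + ε ^ 2 * |βu| + ε ^ 4) := by positivity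
    have e₂ : 0 ≤ m * C * (ε * |βv| + ε ^ 2 * |βu|) := by positivity
    linarith
  · have h := coplanar_of_tripleProd_eq_zero q₁
    have hB : ((u₀, v₀) + ((1 + βu / ε) * ε, ε ^ 3 * (βv / ε ^ 3)) : ℝ × ℝ) =
        (u₀ + ε + βu, v₀ + βv) := by
      ext <;> simp <;> field_simp
      ring
    have hM : ((u₀, v₀) + ((1 + βu / ε) * ε + ε ^ 3 * X, ε - ε ^ 3 * (βv / ε ^ 3)) + d : ℝ × ℝ) =
        (u₀ + ε + (βu + ε ^ 3 * X + d.1), v₀ + ε + (-βv + d.2)) := by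
      ext <;> simp <;> field_simp <;> ring
    rw [hB, hM] at h
    simpa using h
  · have h := coplanar_of_tripleProd_eq_zero q₂
    have hB : ((u₀ + 2 * ε, v₀) + ((-1 + βu / ε) * ε, ε ^ 3 * (βv / ε ^ 3)) : ℝ × ℝ) =
        (u₀ + ε + βu, v₀ + βv) := by
      ext <;> simp <;> field_simp
      ring
    have hM : ((u₀ + 2 * ε, v₀) + ((-1 + βu / ε) * ε + ε ^ 3 * X, ε - ε ^ 3 * (βv / ε ^ 3)) + d :
        ℝ × ℝ) = (u₀ + ε + (βu + ε ^ 3 * X + d.1), v₀ + ε + (-βv + d.2)) := by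
      ext <;> simp <;> field_simp <;> ring
    have hF : ((u₀ + 2 * ε, v₀) + (0, ε) : ℝ × ℝ) = (u₀ + 2 * ε, v₀ + ε) := by simp
    rw [hB, hM, hF] at h
    refine h.subset fun P => ?_
    simp only [Set.mem_insert_iff, Set.mem_singleton_iff]
    tauto

end
end
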